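/- Let h: [0,∞) → [0,∞) be of class C² with h(0) = h'(0) = 0 and suppose there are constants c₁, c₂ > 0 and an exponent μ with 1 < μ < 2 such that c₁(1+t)^{−μ} ≤ min{h''(t), h'(t)/t} and max{h''(t), h'(t)/t} ≤ c₂/(1+t) for all t ≥ 0. Suppose u ∈ C¹(ℝ², ℝ²) is divergence-free and a weak solution of the Stokes-type system −div[∇H(ε(u))] + ∇π = 0, i.e. ∫_{ℝ²} (h'(|ε(u)|)/|ε(u)|) ε(u) : ε(φ) dx = 0 for every divergence-free φ ∈ C_c^∞(ℝ², ℝ²). If there is α ∈ [0, 1) such that |x|^{−α}|u(x)| is bounded on ℝ² \ {0}, then u is a constant vector. -/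

import Mathlib

noncomputable section

open MeasureTheory Real Filter

/-- Partial derivative ∂ₖu(x) ∈ ℝⁿ of a vector field u : ℝⁿ → ℝⁿ. -/
def pd {n : ℕ} (u : EuclideanSpace ℝ (Fin n) → EuclideanSpace ℝ (Fin n))
    (k : Fin n) (x : EuclideanSpace ℝ (Fin n)) : EuclideanSpace ℝ (Fin n) :=
  fderiv ℝ u x (EuclideanSpace.single k 1)

/-- Divergence of u at x. -/
def divg {n : ℕ} (u : EuclideanSpace ℝ (Fin n) → EuclideanSpace ℝ (Fin n))
    (x : EuclideanSpace ℝ (Fin n)) : ℝ :=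
  ∑ k, pd u k x k

/-- Symmetric gradient ε(u)(x) = (1/2)(∇u + (∇u)ᵀ), entry (i,j) = (∂ⱼuⁱ + ∂ᵢuʲ)/2. -/
def symGrad {n : ℕ} (u : EuclideanSpace ℝ (Fin n) → EuclideanSpace ℝ (Fin n))
    (x : EuclideanSpace ℝ (Fin n)) : Matrix (Fin n) (Fin n) ℝ :=
  fun i j => (pd u j x i + pd u i x j) / 2

/-- Full gradient ∇u(x), entry (i,j) = ∂ⱼuⁱ. -/
def gradM {n : ℕ} (u : EuclideanSpace ℝ (Fin n) → EuclideanSpace ℝ (Fin n))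
    (x : EuclideanSpace ℝ (Fin n)) : Matrix (Fin n) (Fin n) ℝ :=
  fun i j => pd u j x i

/-- Frobenius inner product A : B. -/
def frob {n : ℕ} (A B : Matrix (Fin n) (Fin n) ℝ) : ℝ := ∑ i, ∑ j, A i j * B i j

/-- Frobenius norm |A|. -/
def fnorm {n : ℕ} (A : Matrix (Fin n) (Fin n) ℝ) : ℝ := Real.sqrt (frob A A)

/-- DH(ε) = (h'(|ε|)/|ε|) ε, interpreted as 0 at ε = 0. -/
def DH {n : ℕ} (h : ℝ → ℝ) (A : Matrix (Fin n) (Fin n) ℝ) : Matrix (Fin n) (Fin n) ℝ :=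
  if fnorm A = 0 then 0 else (deriv h (fnorm A) / fnorm A) • A

/-- u is a weak solution of -div DH(ε(u)) + (u·∇)u + ∇π = 0, div u = 0:
for all smooth compactly supported divergence-free φ,
∫ DH(ε(u)) : ε(φ) dx + ∫ uᵏ ∂ₖuⁱ φⁱ dx = 0. -/
def IsWeakSolution {n : ℕ} (h : ℝ → ℝ)
    (u : EuclideanSpace ℝ (Fin n) → EuclideanSpace ℝ (Fin n)) : Prop :=
  ∀ φ : EuclideanSpace ℝ (Fin n) → EuclideanSpace ℝ (Fin n),
    ContDiff ℝ (⊤ : ℕ∞) φ → HasCompactSupport φ → (∀ x, divg φ x = 0) →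
    (∫ x, frob (DH h (symGrad u x)) (symGrad φ x)) +
      (∫ x, ∑ k, ∑ i, u x k * pd u k x i * φ x i) = 0

/-- u is a weak solution of the Stokes-type system -div DH(ε(u)) + ∇π = 0, div u = 0:
for all smooth compactly supported divergence-free φ, ∫ DH(ε(u)) : ε(φ) dx = 0. -/
def IsStokesWeakSolution {n : ℕ} (h : ℝ → ℝ)
    (u : EuclideanSpace ℝ (Fin n) → EuclideanSpace ℝ (Fin n)) : Prop :=
  ∀ φ : EuclideanSpace ℝ (Fin n) → EuclideanSpace ℝ (Fin n),
    ContDiff ℝ (⊤ : ℕ∞) φ → HasCompactSupport φ → (∀ x, divg φ x = 0) →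
    (∫ x, frob (DH h (symGrad u x)) (symGrad φ x)) = 0

/-- The open square Q_R(x₀) ⊂ ℝ². -/
def sqr (R : ℝ) (x₀ : EuclideanSpace ℝ (Fin 2)) : Set (EuclideanSpace ℝ (Fin 2)) :=
  {x | |x 0 - x₀ 0| < R ∧ |x 1 - x₀ 1| < R}

/-- h'(t)/t, extended by h''(0) at t = 0. -/
def slopeH (h : ℝ → ℝ) (t : ℝ) : ℝ :=
  if t = 0 then deriv (deriv h) 0 else deriv h t / t

abbrev E2 := EuclideanSpace ℝ (Fin 2)

/-- Standard basis vector. -/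
def ee (k : Fin 2) : E2 := EuclideanSpace.single k 1

/-- Scalar partial derivative. -/
def dd (k : Fin 2) (f : E2 → ℝ) (x : E2) : ℝ := fderiv ℝ f x (ee k)

/-- Difference quotient. -/
def Dq (k : Fin 2) (s : ℝ) (f : E2 → ℝ) (x : E2) : ℝ := (f (x + s • ee k) - f x) / s

/-- First component of the symmetric gradient of the curl of `ψ`. -/
def LA (ψ : E2 → ℝ) (x : E2) : ℝ := dd 0 (dd 1 ψ) x

/-- Second component of the symmetric gradient of the curl of `ψ`. -/
def LB (ψ : E2 → ℝ) (x : E2) : ℝ := (dd 1 (dd 1 ψ) x - dd 0 (dd 0 ψ) x) / 2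

theorem norm_ee (k : Fin 2) : ‖ee k‖ = 1 := by simp [ee]

theorem dd_contDiff {n : ℕ∞} {k : Fin 2} {f : E2 → ℝ} (hf : ContDiff ℝ (n + 1) f) :
    ContDiff ℝ n (dd k f) := by
  have := hf.fderiv_right (m := n) le_rfl
  exact this.clm_apply contDiff_const

theorem dd_c1 {k : Fin 2} {f : E2 → ℝ} (hf : ContDiff ℝ 2 f) : ContDiff ℝ 1 (dd k f) := by
  have := hf.fderiv_right (m := 1) (by norm_num)
  exact this.clm_apply contDiff_const

theorem dd_cont {k : Fin 2} {f : E2 → ℝ} (hf : ContDiff ℝ 1 f) : Continuous (dd k f) :=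
  (hf.continuous_fderiv (by norm_num)).clm_apply continuous_const

theorem dd_dd_cont {j k : Fin 2} {f : E2 → ℝ} (hf : ContDiff ℝ 2 f) :
    Continuous (dd j (dd k f)) := dd_cont (dd_c1 hf)

theorem LA_cont {f : E2 → ℝ} (hf : ContDiff ℝ 2 f) : Continuous (LA f) := dd_dd_cont hf

theorem LB_cont {f : E2 → ℝ} (hf : ContDiff ℝ 2 f) : Continuous (LB f) :=
  ((dd_dd_cont hf).sub (dd_dd_cont hf)).div_const _

theorem dd_mul {k : Fin 2} {f g : E2 → ℝ} (hf : ContDiff ℝ 1 f) (hg : ContDiff ℝ 1 g) (x : E2) :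
    dd k (fun y => f y * g y) x = dd k f x * g x + f x * dd k g x := by
  have h1 := (hf.differentiable (by norm_num) x).hasFDerivAt
  have h2 := (hg.differentiable (by norm_num) x).hasFDerivAt
  unfold dd
  rw [(h1.fun_mul h2).fderiv]
  simp; ring

theorem dd_add {k : Fin 2} {f g : E2 → ℝ} (hf : ContDiff ℝ 1 f) (hg : ContDiff ℝ 1 g) (x : E2) :
    dd k (fun y => f y + g y) x = dd k f x + dd k g x := by
  have h1 := (hf.differentiable (by norm_num) x).hasFDerivAt
  have h2 := (hg.differentiable (by norm_num) x).hasFDerivAt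
  unfold dd
  rw [(h1.fun_add h2).fderiv]
  simp

theorem dd_sub {k : Fin 2} {f g : E2 → ℝ} (hf : ContDiff ℝ 1 f) (hg : ContDiff ℝ 1 g) (x : E2) :
    dd k (fun y => f y - g y) x = dd k f x - dd k g x := by
  have h1 := (hf.differentiable (by norm_num) x).hasFDerivAt
  have h2 := (hg.differentiable (by norm_num) x).hasFDerivAt
  unfold dd
  rw [(h1.fun_sub h2).fderiv]
  simp

theorem dd_mul_const {k : Fin 2} {f : E2 → ℝ} (hf : ContDiff ℝ 1 f) (c : ℝ) (x : E2) :
    dd k (fun y => f y * c) x = dd k f x * c := by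
  have h1 := (hf.differentiable (by norm_num) x).hasFDerivAt
  unfold dd
  rw [(h1.mul_const c).fderiv]
  simp; ring

theorem dd_pow {k : Fin 2} {f : E2 → ℝ} (hf : ContDiff ℝ 1 f) (n : ℕ) (x : E2) :
    dd k (fun y => f y ^ n) x = n * f x ^ (n-1) * dd k f x := by
  have h1 := (hf.differentiable (by norm_num) x).hasFDerivAt
  unfold dd
  rw [(h1.pow n).fderiv]
  simp

theorem dd_shift (k : Fin 2) (f : E2 → ℝ) (v x : E2) :
    dd k (fun y => f (y + v)) x = dd k f (x + v) := by
  unfold dd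
  rw [fderiv_comp_add_right]

theorem dd_dd_mul {j k : Fin 2} {f g : E2 → ℝ} (hf : ContDiff ℝ 2 f) (hg : ContDiff ℝ 2 g)
    (x : E2) :
    dd j (dd k (fun y => f y * g y)) x = dd j (dd k f) x * g x + dd k f x * dd j g x
      + dd j f x * dd k g x + f x * dd j (dd k g) x := by
  have hf1 : ContDiff ℝ 1 f := hf.of_le (by norm_num)
  have hg1 : ContDiff ℝ 1 g := hg.of_le (by norm_num)
  have : dd k (fun y => f y * g y) = fun x => dd k f x * g x + f x * dd k g x := by
    ext x; exact dd_mul hf1 hg1 x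
  rw [this, dd_add ((dd_c1 hf).mul hg1) (hf1.mul (dd_c1 hg)), dd_mul (dd_c1 hf) hg1,
    dd_mul hf1 (dd_c1 hg)]
  ring

theorem LA_mul {f g : E2 → ℝ} (hf : ContDiff ℝ 2 f) (hg : ContDiff ℝ 2 g) (x : E2) :
    LA (fun y => f y * g y) x = f x * LA g x + (LA f x * g x + dd 1 f x * dd 0 g x
      + dd 0 f x * dd 1 g x) := by
  unfold LA; rw [dd_dd_mul hf hg]; ring

theorem LB_mul {f g : E2 → ℝ} (hf : ContDiff ℝ 2 f) (hg : ContDiff ℝ 2 g) (x : E2) :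
    LB (fun y => f y * g y) x = f x * LB g x + (LB f x * g x + dd 1 f x * dd 1 g x
      - dd 0 f x * dd 0 g x) := by
  unfold LB; rw [dd_dd_mul hf hg, dd_dd_mul hf hg]; ring

theorem dd_dd_shift (j k : Fin 2) (f : E2 → ℝ) (v x : E2) :
    dd j (dd k (fun y => f (y + v))) x = dd j (dd k f) (x + v) := by
  have : dd k (fun y => f (y + v)) = fun y => dd k f (y + v) := by
    ext y; exact dd_shift k f v y
  rw [this, dd_shift]

theorem LA_shift (f : E2 → ℝ) (v x : E2) : LA (fun y => f (y + v)) x = LA f (x + v) :=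
  dd_dd_shift _ _ _ _ _

theorem LB_shift (f : E2 → ℝ) (v x : E2) : LB (fun y => f (y + v)) x = LB f (x + v) := by
  unfold LB; rw [dd_dd_shift, dd_dd_shift]

theorem shift_contDiff {n : WithTop ℕ∞} {f : E2 → ℝ} (hf : ContDiff ℝ n f) (v : E2) :
    ContDiff ℝ n (fun y => f (y + v)) := hf.comp (contDiff_id.add contDiff_const)

theorem Dq_contDiff {n : WithTop ℕ∞} {k : Fin 2} {s : ℝ} {f : E2 → ℝ} (hf : ContDiff ℝ n f) :
    ContDiff ℝ n (Dq k s f) := ((shift_contDiff hf _).sub hf).div_const s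

theorem Dq_cont {k : Fin 2} {s : ℝ} {f : E2 → ℝ} (hf : Continuous f) :
    Continuous (Dq k s f) := by unfold Dq; fun_prop

theorem dd_Dq {j k : Fin 2} {s : ℝ} {f : E2 → ℝ} (hf : ContDiff ℝ 1 f) :
    dd j (Dq k s f) = Dq k s (dd j f) := by
  ext x
  have h1 := shift_contDiff hf (s • ee k)
  have : Dq k s f = fun y => (f (y + s • ee k) - f y) * s⁻¹ := by
    ext y; simp [Dq, div_eq_mul_inv]
  rw [this, dd_mul_const (h1.sub hf), dd_sub h1 hf, dd_shift]
  simp [Dq, div_eq_mul_inv]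

theorem dd_dd_Dq {i j k : Fin 2} {s : ℝ} {f : E2 → ℝ} (hf : ContDiff ℝ 2 f) :
    dd i (dd j (Dq k s f)) = Dq k s (dd i (dd j f)) := by
  rw [dd_Dq (hf.of_le (by norm_num)), dd_Dq (dd_c1 hf)]

theorem LA_Dq {k : Fin 2} {s : ℝ} {f : E2 → ℝ} (hf : ContDiff ℝ 2 f) :
    LA (Dq k s f) = Dq k s (LA f) := dd_dd_Dq hf

theorem LB_Dq {k : Fin 2} {s : ℝ} {f : E2 → ℝ} (hf : ContDiff ℝ 2 f) :
    LB (Dq k s f) = Dq k s (LB f) := by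
  ext x; simp only [LB]; rw [dd_dd_Dq hf, dd_dd_Dq hf]; simp only [Dq, LB]; ring

theorem dd_symm {f : E2 → ℝ} (hf : ContDiff ℝ 2 f) (j k : Fin 2) (x : E2) :
    dd j (dd k f) x = dd k (dd j f) x := by
  have h := (hf.contDiffAt (x := x)).isSymmSndFDerivAt (by simp)
  have key : ∀ a b : Fin 2, dd a (dd b f) x = fderiv ℝ (fderiv ℝ f) x (ee a) (ee b) := by
    intro a b
    have hd : DifferentiableAt ℝ (fderiv ℝ f) x :=
      (hf.fderiv_right (m := 1) (by norm_num)).differentiable (by norm_num) x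
    unfold dd
    rw [fderiv_clm_apply hd (differentiableAt_const _)]
    simp
  rw [key, key]; exact h _ _

theorem dd_compactSupport {k : Fin 2} {f : E2 → ℝ} (hf : HasCompactSupport f) :
    HasCompactSupport (dd k f) := by
  have := hf.fderiv (𝕜 := ℝ)
  exact this.comp_left (g := fun L : E2 →L[ℝ] ℝ => L (ee k)) (by simp)

theorem LA_compactSupport {f : E2 → ℝ} (hf : HasCompactSupport f) :
    HasCompactSupport (LA f) := dd_compactSupport (dd_compactSupport hf)

theorem LB_compactSupport {f : E2 → ℝ} (hf : HasCompactSupport f) :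
    HasCompactSupport (LB f) := by
  have h1 := dd_compactSupport (k := 1) (dd_compactSupport (k := 1) hf)
  have h2 := dd_compactSupport (k := 0) (dd_compactSupport (k := 0) hf)
  have h3 := (h1.sub h2).mul_right (f' := fun _ => (1/2 : ℝ))
  have e : LB f = (dd 1 (dd 1 f) - dd 0 (dd 0 f)) * (fun _ => (1/2 : ℝ)) := by
    funext x; simp [LB, div_eq_mul_inv]
  rw [e]; exact h3

open scoped Convolution Topology in
/-- Mollification. -/
def moll (ρ : ContDiffBump (0 : E2)) (f : E2 → ℝ) : E2 → ℝ :=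
  (ρ.normed volume) ⋆[ContinuousLinearMap.lsmul ℝ ℝ, volume] f

theorem moll_dd (ρ : ContDiffBump (0 : E2)) {f : E2 → ℝ} (hf : ContDiff ℝ 1 f)
    (hc : HasCompactSupport f) (k : Fin 2) : dd k (moll ρ f) = moll ρ (dd k f) := by
  ext x
  have hl : LocallyIntegrable (ρ.normed volume) volume := by
    exact (ρ.continuous_normed).locallyIntegrable
  have h := hc.hasFDerivAt_convolution_right (ContinuousLinearMap.lsmul ℝ ℝ) hl hf x
  unfold dd moll
  rw [h.fderiv]
  unfold convolution
  have hcv := (hc.fderiv (𝕜 := ℝ)).convolutionExists_right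
      ((ContinuousLinearMap.lsmul ℝ ℝ : ℝ →L[ℝ] ℝ →L[ℝ] ℝ).precompR E2) hl
      (hf.continuous_fderiv (by norm_num)) x
  rw [ContinuousLinearMap.integral_apply hcv]
  rfl

theorem moll_smooth (ρ : ContDiffBump (0 : E2)) {f : E2 → ℝ} (hf : Continuous f) :
    ContDiff ℝ (⊤ : ℕ∞) (moll ρ f) :=
  HasCompactSupport.contDiff_convolution_left _ ρ.hasCompactSupport_normed ρ.contDiff_normed
    hf.locallyIntegrable

theorem moll_compact (ρ : ContDiffBump (0 : E2)) {f : E2 → ℝ} (hc : HasCompactSupport f) :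
    HasCompactSupport (moll ρ f) :=
  HasCompactSupport.convolution _ ρ.hasCompactSupport_normed hc

theorem moll_dist (ρ : ContDiffBump (0 : E2)) {f : E2 → ℝ} (hf : Continuous f) {ω : ℝ} {x : E2}
    (h : ∀ y, dist y x < ρ.rOut → dist (f y) (f x) ≤ ω) : |moll ρ f x - f x| ≤ ω := by
  have := ρ.dist_normed_convolution_le (μ := volume) (g := f) (x₀ := x) (ε := ω)
    hf.aestronglyMeasurable (fun y hy => h y hy)
  rwa [Real.dist_eq] at this

theorem moll_supp (ρ : ContDiffBump (0 : E2)) {f : E2 → ℝ} (hf : Continuous f) {r : ℝ}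
    (hr : ∀ x, r < ‖x‖ → f x = 0) (h1 : ρ.rOut ≤ 1) (x : E2) (hx : r + 1 < ‖x‖) :
    moll ρ f x = 0 := by
  have hfx : f x = 0 := hr x (by linarith)
  have := moll_dist ρ hf (ω := 0) (x := x) (by
    intro y hy
    have : ‖x‖ ≤ ‖y‖ + dist y x := by
      rw [dist_eq_norm, norm_sub_rev]
      have := norm_add_le y (x - y); simpa using this
    rw [hr y (by linarith), hfx]; simp)
  rw [hfx, sub_zero] at this
  exact abs_nonpos_iff.1 this

/-- Weak equation for smooth tests extends to `C²` tests. -/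
theorem weak_ext {SA SB : E2 → ℝ} (hSA : Continuous SA) (hSB : Continuous SB)
    (hw : ∀ ζ : E2 → ℝ, ContDiff ℝ (⊤ : ℕ∞) ζ → HasCompactSupport ζ →
      ∫ x, (SA x * LA ζ x + SB x * LB ζ x) = 0)
    (ζ : E2 → ℝ) (hζ : ContDiff ℝ 2 ζ) (hc : HasCompactSupport ζ) :
    ∫ x, (SA x * LA ζ x + SB x * LB ζ x) = 0 := by
  classical
  -- a sequence of bumps
  let ρ : ℕ → ContDiffBump (0 : E2) := fun n =>
    ⟨(1 / ((n : ℝ) + 1)) / 2, 1 / ((n : ℝ) + 1), by positivity, by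
      have : 0 < 1 / ((n : ℝ) + 1) := by positivity
      linarith⟩
  have hρ : Tendsto (fun n => (ρ n).rOut) atTop (nhds 0) := tendsto_one_div_add_atTop_nhds_zero_nat
  have hρ1 : ∀ n, (ρ n).rOut ≤ 1 := by
    intro n
    show 1 / ((n : ℝ) + 1) ≤ 1
    rw [div_le_one (by positivity)]
    have : (0 : ℝ) ≤ n := Nat.cast_nonneg n
    linarith
  have hζ1 : ContDiff ℝ 1 ζ := hζ.of_le (by norm_num)
  have e2 : ∀ n j k, dd j (dd k (moll (ρ n) ζ)) = moll (ρ n) (dd j (dd k ζ)) := by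
    intro n j k
    rw [moll_dd _ hζ1 hc, moll_dd _ (dd_c1 hζ) (dd_compactSupport hc)]
  obtain ⟨r, hr⟩ : ∃ r : ℝ, ∀ x, r < ‖x‖ → ∀ j k, dd j (dd k ζ) x = 0 := by
    have hcc : ∀ j k, ∃ r : ℝ, ∀ x, r < ‖x‖ → dd j (dd k ζ) x = 0 := by
      intro j k
      have h := dd_compactSupport (k := j) (dd_compactSupport (k := k) hc)
      obtain ⟨r, hr⟩ := h.isCompact.isBounded.subset_closedBall (0 : E2)
      refine ⟨r, fun x hx => ?_⟩
      by_contra hne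
      have := hr (subset_tsupport _ hne)
      simp at this; linarith
    choose r hr using hcc
    refine ⟨max (max (r 0 0) (r 0 1)) (max (r 1 0) (r 1 1)), fun x hx j k => ?_⟩
    simp only [max_lt_iff] at hx
    fin_cases j <;> fin_cases k <;> apply hr <;> tauto
  -- bound
  have hbd : ∃ M : ℝ, ∀ n j k x, |moll (ρ n) (dd j (dd k ζ)) x| ≤ M := by
    have hcc : ∀ j k, ∃ M : ℝ, ∀ x, |dd j (dd k ζ) x| ≤ M := by
      intro j k
      obtain ⟨M, hM⟩ := (dd_compactSupport (k := j) (dd_compactSupport (k := k) hc)).exists_bound_of_continuous (dd_dd_cont hζ)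
      exact ⟨M, hM⟩
    choose M hM using hcc
    have hM0 : ∀ j k, 0 ≤ M j k := fun j k => (abs_nonneg _).trans (hM j k 0)
    refine ⟨3 * (M 0 0 + M 0 1 + M 1 0 + M 1 1), fun n j k x => ?_⟩
    have h1 := moll_dist (ρ n) (dd_dd_cont (j := j) (k := k) hζ) (ω := 2 * M j k) (x := x) (by
      intro y _
      rw [Real.dist_eq]
      have a := hM j k y
      have b := hM j k x
      have := abs_sub (dd j (dd k ζ) y) (dd j (dd k ζ) x)
      linarith)
    have h2 := hM j k x
    have h3 : |moll (ρ n) (dd j (dd k ζ)) x| ≤ 3 * M j k := by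
      have := abs_add_le (moll (ρ n) (dd j (dd k ζ)) x - dd j (dd k ζ) x) (dd j (dd k ζ) x)
      simp only [sub_add_cancel] at this
      linarith
    have a := hM0 0 0; have b := hM0 0 1; have c := hM0 1 0; have d := hM0 1 1
    fin_cases j <;> fin_cases k <;> simp at * <;> linarith
  obtain ⟨M, hM⟩ := hbd
  have hlim : ∀ j k x, Tendsto (fun n => moll (ρ n) (dd j (dd k ζ)) x) atTop
      (nhds (dd j (dd k ζ) x)) := fun j k x =>
    ContDiffBump.convolution_tendsto_right_of_continuous hρ (dd_dd_cont hζ) x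
  have hz : ∀ n, ∫ x, (SA x * LA (moll (ρ n) ζ) x + SB x * LB (moll (ρ n) ζ) x) = 0 :=
    fun n => hw _ (moll_smooth _ hζ.continuous) (moll_compact _ hc)
  have hT : Tendsto (fun n => ∫ x, (SA x * LA (moll (ρ n) ζ) x + SB x * LB (moll (ρ n) ζ) x))
      atTop (nhds (∫ x, (SA x * LA ζ x + SB x * LB ζ x))) := by
    refine tendsto_integral_of_dominated_convergence
      (fun x => (Metric.closedBall (0:E2) (r+1)).indicator (fun x => (|SA x| + |SB x|) * M) x)
      ?_ ?_ ?_ ?_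
    · intro n
      have hs : ContDiff ℝ 2 (moll (ρ n) ζ) := (moll_smooth (ρ n) hζ.continuous).of_le (by
        show ((2 : ℕ∞) : WithTop ℕ∞) ≤ _
        exact_mod_cast le_top)
      exact ((hSA.mul (LA_cont hs)).add (hSB.mul (LB_cont hs))).aestronglyMeasurable
    · rw [integrable_indicator_iff measurableSet_closedBall]
      exact (Continuous.continuousOn (by fun_prop)).integrableOn_compact
        (isCompact_closedBall _ _)
    · intro n
      refine Eventually.of_forall fun x => ?_
      have f0 : LA (moll (ρ n) ζ) x = moll (ρ n) (dd 0 (dd 1 ζ)) x := by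
        unfold LA; rw [e2]
      have f1 : LB (moll (ρ n) ζ) x = (moll (ρ n) (dd 1 (dd 1 ζ)) x
        - moll (ρ n) (dd 0 (dd 0 ζ)) x) / 2 := by
        unfold LB; rw [e2, e2]
      rw [f0, f1]
      by_cases hx : x ∈ Metric.closedBall (0:E2) (r+1)
      · rw [Set.indicator_of_mem hx, Real.norm_eq_abs]
        have a := hM n 0 1 x
        have b : |(moll (ρ n) (dd 1 (dd 1 ζ)) x - moll (ρ n) (dd 0 (dd 0 ζ)) x) / 2| ≤ M := by
          rw [abs_div, abs_two]
          have := abs_sub (moll (ρ n) (dd 1 (dd 1 ζ)) x) (moll (ρ n) (dd 0 (dd 0 ζ)) x)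
          have := hM n 1 1 x
          have := hM n 0 0 x
          linarith
        refine (abs_add_le _ _).trans ?_
        rw [abs_mul, abs_mul, add_mul]
        gcongr
      · have hx' : r + 1 < ‖x‖ := by simpa using hx
        have hv : ∀ j k, moll (ρ n) (dd j (dd k ζ)) x = 0 := fun j k =>
          moll_supp _ (dd_dd_cont hζ) (fun y hy => hr y hy j k) (hρ1 n) x hx'
        rw [Set.indicator_of_notMem hx]
        simp [hv]
    · refine Eventually.of_forall fun x => ?_
      simp only [LA, LB, e2]
      exact ((hlim 0 1 x).const_mul _).add ((((hlim 1 1 x).sub (hlim 0 0 x)).div_const 2).const_mul _)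
  simp only [hz] at hT
  exact (tendsto_nhds_unique hT tendsto_const_nhds)

theorem integral_shift (f : E2 → ℝ) (v : E2) : ∫ x, f (x + v) = ∫ x, f x :=
  integral_add_right_eq_self f v

/-- Weak equation for the difference quotient. -/
theorem weak_Dq {SA SB : E2 → ℝ} (hSA : Continuous SA) (hSB : Continuous SB)
    (hw : ∀ ζ : E2 → ℝ, ContDiff ℝ 2 ζ → HasCompactSupport ζ →
      ∫ x, (SA x * LA ζ x + SB x * LB ζ x) = 0) (k : Fin 2) (s : ℝ)
    (ζ : E2 → ℝ) (hζ : ContDiff ℝ 2 ζ) (hc : HasCompactSupport ζ) :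
    ∫ x, (Dq k s SA x * LA ζ x + Dq k s SB x * LB ζ x) = 0 := by
  have h1 := hw ζ hζ hc
  have h2 := hw (fun y => ζ (y + -(s • ee k))) (shift_contDiff hζ _)
    (hc.comp_homeomorph (Homeomorph.addRight (-(s • ee k))))
  rw [← integral_shift _ (s • ee k)] at h2
  simp only [LA_shift, LB_shift, add_neg_cancel_right] at h2
  have i1 : Integrable (fun x => SA x * LA ζ x + SB x * LB ζ x) :=
    Continuous.integrable_of_hasCompactSupport
      ((hSA.mul (LA_cont hζ)).add (hSB.mul (LB_cont hζ)))
      ((LA_compactSupport hc).mul_left.add (LB_compactSupport hc).mul_left)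
  have i2 : Integrable (fun x => SA (x + s • ee k) * LA ζ x + SB (x + s • ee k) * LB ζ x) :=
    Continuous.integrable_of_hasCompactSupport
      (((hSA.comp (by fun_prop)).mul (LA_cont hζ)).add ((hSB.comp (by fun_prop)).mul (LB_cont hζ)))
      ((LA_compactSupport hc).mul_left.add (LB_compactSupport hc).mul_left)
  have : (fun x => Dq k s SA x * LA ζ x + Dq k s SB x * LB ζ x) = fun x =>
      ((SA (x + s • ee k) * LA ζ x + SB (x + s • ee k) * LB ζ x) -
      (SA x * LA ζ x + SB x * LB ζ x)) / s := by
    funext x; simp only [Dq]; ring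
  rw [this, integral_div, integral_sub i2 i1, h1, h2]; simp

/-- Fixed bump function. -/
def chi0 : ContDiffBump (0 : E2) := ⟨1, 2, by norm_num, by norm_num⟩

/-- Cutoff at scale `R`. -/
def eta (R : ℝ) (x : E2) : ℝ := chi0 (R⁻¹ • x)

theorem eta_smooth (R : ℝ) (n : ℕ∞) : ContDiff ℝ n (eta R) := by
  have h : ContDiff ℝ n (chi0 : E2 → ℝ) := chi0.contDiff
  exact h.comp (contDiff_const_smul _)

theorem eta_c2 (R : ℝ) : ContDiff ℝ 2 (eta R) := eta_smooth R 2

theorem eta_c1 (R : ℝ) : ContDiff ℝ 1 (eta R) := eta_smooth R 1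

theorem eta_cont (R : ℝ) : Continuous (eta R) := (eta_c1 R).continuous

theorem eta_nonneg (R : ℝ) (x : E2) : 0 ≤ eta R x := chi0.nonneg

theorem eta_le_one (R : ℝ) (x : E2) : eta R x ≤ 1 := chi0.le_one

theorem eta_one {R : ℝ} (hR : 0 < R) {x : E2} (hx : ‖x‖ ≤ R) : eta R x = 1 := by
  apply chi0.one_of_mem_closedBall
  rw [mem_closedBall_zero_iff, norm_smul, norm_inv, Real.norm_of_nonneg hR.le]
  show R⁻¹ * ‖x‖ ≤ 1
  rw [inv_mul_le_iff₀ hR]; linarith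

theorem eta_zero {R : ℝ} (hR : 0 < R) {x : E2} (hx : 2 * R ≤ ‖x‖) : eta R x = 0 := by
  apply chi0.zero_of_le_dist
  rw [dist_zero_right, norm_smul, norm_inv, Real.norm_of_nonneg hR.le]
  show 2 ≤ R⁻¹ * ‖x‖
  rw [le_inv_mul_iff₀ hR]; linarith

theorem eta_compact {R : ℝ} (hR : 0 < R) : HasCompactSupport (eta R) := by
  refine HasCompactSupport.intro (isCompact_closedBall (0 : E2) (2 * R)) ?_
  intro x hx
  apply eta_zero hR
  have : 2 * R < ‖x‖ := by simpa using hx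
  exact this.le

theorem dd_scale {f : E2 → ℝ} (hf : ContDiff ℝ 1 f) (k : Fin 2) (c : ℝ) :
    dd k (fun x => f (c • x)) = fun x => dd k f (c • x) * c := by
  ext x
  have h1 := (hf.differentiable (by norm_num) (c • x)).hasFDerivAt
  have h2 : HasFDerivAt (fun x : E2 => c • x) (c • ContinuousLinearMap.id ℝ E2) x :=
    (hasFDerivAt_id x).const_smul c
  have := h1.comp x h2
  unfold dd
  change fderiv ℝ (f ∘ fun x => c • x) x (ee k) = _
  rw [this.fderiv]
  simp; ring

theorem eta_bounds : ∃ K : ℝ, 1 ≤ K ∧ ∀ R : ℝ, 1 ≤ R → ∀ x : E2,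
    (∀ k, |dd k (eta R) x| ≤ K / R) ∧ (∀ j k, |dd j (dd k (eta R)) x| ≤ K / R ^ 2) := by
  have hs : ContDiff ℝ 2 (chi0 : E2 → ℝ) := chi0.contDiff (n := 2)
  have hs1 : ContDiff ℝ 1 (chi0 : E2 → ℝ) := chi0.contDiff (n := 1)
  have hcs : HasCompactSupport (chi0 : E2 → ℝ) := chi0.hasCompactSupport
  have h1 : ∀ k, ∃ M : ℝ, ∀ x, |dd k chi0 x| ≤ M := fun k =>
    (dd_compactSupport hcs).exists_bound_of_continuous (dd_cont hs1)
  have h2 : ∀ j k, ∃ M : ℝ, ∀ x, |dd j (dd k chi0) x| ≤ M := fun j k =>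
    (dd_compactSupport (dd_compactSupport hcs)).exists_bound_of_continuous (dd_dd_cont hs)
  choose M hM using h1
  choose N hN using h2
  have hM0 : ∀ k, 0 ≤ M k := fun k => (abs_nonneg _).trans (hM k 0)
  have hN0 : ∀ j k, 0 ≤ N j k := fun j k => (abs_nonneg _).trans (hN j k 0)
  have hKM : ∀ k, M k ≤ 1 + ∑ k, M k + ∑ j, ∑ k, N j k := by
    intro k
    have h1 := Finset.single_le_sum (fun i _ => hM0 i) (Finset.mem_univ k)
    have h2 : 0 ≤ ∑ j, ∑ k, N j k :=
      Finset.sum_nonneg fun j _ => Finset.sum_nonneg fun k _ => hN0 j k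
    linarith
  have hKN : ∀ j k, N j k ≤ 1 + ∑ k, M k + ∑ j, ∑ k, N j k := by
    intro j k
    have h1 := Finset.single_le_sum (fun i _ => hN0 j i) (Finset.mem_univ k)
    have h2 := Finset.single_le_sum (f := fun j => ∑ k, N j k)
      (fun i _ => Finset.sum_nonneg fun k _ => hN0 i k) (Finset.mem_univ j)
    have h3 : 0 ≤ ∑ k, M k := Finset.sum_nonneg fun k _ => hM0 k
    linarith
  refine ⟨1 + ∑ k, M k + ∑ j, ∑ k, N j k, ?_, ?_⟩
  · have h2 : 0 ≤ ∑ j, ∑ k, N j k :=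
      Finset.sum_nonneg fun j _ => Finset.sum_nonneg fun k _ => hN0 j k
    have h3 : 0 ≤ ∑ k, M k := Finset.sum_nonneg fun k _ => hM0 k
    linarith
  · intro R hR x
    have hR0 : 0 < R := by linarith
    have e1 : ∀ k, dd k (eta R) = fun x => dd k chi0 (R⁻¹ • x) * R⁻¹ := fun k =>
      dd_scale hs1 k R⁻¹
    have c1 : ∀ k, ContDiff ℝ 1 (dd k chi0) := fun k => dd_c1 hs
    have e2 : ∀ j k, dd j (dd k (eta R)) x = dd j (dd k chi0) (R⁻¹ • x) * R⁻¹ * R⁻¹ := by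
      intro j k
      rw [e1, dd_mul_const (f := fun x => dd k chi0 (R⁻¹ • x))
        ((c1 k).comp (contDiff_const_smul _)), dd_scale (c1 k)]
    constructor
    · intro k
      rw [e1]; simp only
      rw [abs_mul, abs_of_pos (inv_pos.2 hR0), div_eq_mul_inv]
      gcongr
      exact (hM k _).trans (hKM k)
    · intro j k
      rw [e2, abs_mul, abs_mul, abs_of_pos (inv_pos.2 hR0), div_eq_mul_inv, mul_assoc]
      have : (R^2)⁻¹ = R⁻¹ * R⁻¹ := by rw [pow_two, mul_inv]
      rw [this]
      gcongr
      exact (hN j k _).trans (hKN j k)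

theorem unif_shift {f : E2 → ℝ} (hf : Continuous f) (k : Fin 2) (r : ℝ) {ω : ℝ} (hω : 0 < ω) :
    ∃ δ > 0, ∀ s : ℝ, |s| < δ → ∀ x : E2, ‖x‖ ≤ r → |f (x + s • ee k) - f x| ≤ ω := by
  have hc : Continuous (fun z : ℝ × E2 => |f (z.2 + z.1 • ee k) - f z.2|) := by fun_prop
  have := (isCompact_closedBall (0 : E2) r).eventually_forall_of_forall_eventually
    (x₀ := (0 : ℝ)) (P := fun s x => |f (x + s • ee k) - f x| ≤ ω) (by
      intro y _
      have h1 : Tendsto (fun z : ℝ × E2 => |f (z.2 + z.1 • ee k) - f z.2|) (nhds (0, y))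
          (nhds 0) := by
        have := hc.tendsto (0, y)
        simpa using this
      exact (h1.eventually (gt_mem_nhds hω)).mono fun z hz => le_of_lt hz)
  obtain ⟨δ, hδ, h⟩ := Metric.eventually_nhds_iff.1 this
  refine ⟨δ, hδ, fun s hs x hx => h (by simpa using hs) x (by simpa using hx)⟩

theorem unif_Dq {f : E2 → ℝ} (hf : ContDiff ℝ 1 f) (k : Fin 2) (r : ℝ) {ω : ℝ} (hω : 0 < ω) :
    ∃ δ > 0, ∀ s : ℝ, s ≠ 0 → |s| < δ → ∀ x : E2, ‖x‖ ≤ r → |Dq k s f x - dd k f x| ≤ ω := by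
  obtain ⟨δ, hδ, h⟩ := unif_shift (dd_cont (k := k) hf) k r hω
  refine ⟨δ, hδ, fun s hs0 hs x hx => ?_⟩
  have hder : ∀ t : ℝ, HasDerivAt (fun t : ℝ => f (x + t • ee k) - t * dd k f x)
      (dd k f (x + t • ee k) - dd k f x) t := by
    intro t
    have h1 := (hf.differentiable (by norm_num) (x + t • ee k)).hasFDerivAt
    have h2 : HasDerivAt (fun t : ℝ => x + t • ee k) (ee k) t := by
      simpa using ((hasDerivAt_id t).smul_const (ee k)).const_add x
    have h3 := h1.comp_hasDerivAt t h2
    have h4 := (hasDerivAt_id t).mul_const (dd k f x)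
    rw [one_mul] at h4
    exact h3.sub h4
  have := (convex_uIcc (0:ℝ) s).norm_image_sub_le_of_norm_hasDerivWithin_le (C := ω)
    (f := fun t : ℝ => f (x + t • ee k) - t * dd k f x)
    (fun t _ => (hder t).hasDerivWithinAt) (by
      intro t ht
      rw [Real.norm_eq_abs]
      apply h t _ x hx
      have := Set.abs_sub_left_of_mem_uIcc ht
      simp only [sub_zero] at this
      linarith) Set.left_mem_uIcc Set.right_mem_uIcc
  simp only [zero_smul, add_zero, zero_mul, sub_zero, Real.norm_eq_abs] at this
  have e : Dq k s f x - dd k f x = (f (x + s • ee k) - s * dd k f x - f x) / s := by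
    unfold Dq; field_simp; ring
  rw [e, abs_div, div_le_iff₀ (abs_pos.2 hs0)]
  exact this

theorem det_disc {p q W : E2 → ℝ} (hp : Continuous p) (hq : Continuous q) (hW : Continuous W)
    (hc : HasCompactSupport W) {s : ℝ} (hs : s ≠ 0) :
    ∫ x, (Dq 0 s p x * Dq 1 (-s) q x - Dq 1 s p x * Dq 0 (-s) q x) * W x =
    - ∫ x, (p (x + s • ee 0) * Dq 1 (-s) q x * Dq 0 s W x -
      p (x + s • ee 1) * Dq 0 (-s) q x * Dq 1 s W x) := by
  set a := s • ee 0 with ha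
  set b := s • ee 1 with hb
  set F : E2 → ℝ := fun x => p x * W x with hF
  have hFc : Continuous F := hp.mul hW
  have hFs : HasCompactSupport F := hc.mul_left
  have shc : ∀ v : E2, HasCompactSupport (fun x => W (x + v)) := fun v =>
    hc.comp_homeomorph (Homeomorph.addRight v)
  have shF : ∀ v : E2, HasCompactSupport (fun x => F (x + v)) := fun v =>
    hFs.comp_homeomorph (Homeomorph.addRight v)
  let Q1 : E2 → ℝ := fun x => q x - q (x - b)
  let Q0 : E2 → ℝ := fun x => q x - q (x - a)
  have hQ1 : Continuous Q1 := by fun_prop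
  have hQ0 : Continuous Q0 := by fun_prop
  have i1 : Integrable (fun x => F (x + a) * Q1 x) :=
    Continuous.integrable_of_hasCompactSupport (by fun_prop) (shF a).mul_right
  have i2 : Integrable (fun x => F (x + b) * Q0 x) :=
    Continuous.integrable_of_hasCompactSupport (by fun_prop) (shF b).mul_right
  have i3 : Integrable (fun x => F x * (Q0 x - Q1 x)) :=
    Continuous.integrable_of_hasCompactSupport (by fun_prop) hFs.mul_right
  have i4 : Integrable (fun x => F x * Q1 (x - a)) :=
    Continuous.integrable_of_hasCompactSupport (by fun_prop) hFs.mul_right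
  have i5 : Integrable (fun x => F x * Q0 (x - b)) :=
    Continuous.integrable_of_hasCompactSupport (by fun_prop) hFs.mul_right
  have s1 : ∫ x, F (x + a) * Q1 x = ∫ x, F x * Q1 (x - a) := by
    rw [← integral_shift (fun x => F x * Q1 (x - a)) a]; simp
  have s2 : ∫ x, F (x + b) * Q0 x = ∫ x, F x * Q0 (x - b) := by
    rw [← integral_shift (fun x => F x * Q0 (x - b)) b]; simp
  have key : ∫ x, (F x * (Q0 x - Q1 x) + F (x + a) * Q1 x - F (x + b) * Q0 x) = 0 := by
    rw [integral_sub (by exact i3.add i1) i2, integral_add i3 i1, s1, s2, ← integral_add i3 i4,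
      ← integral_sub (by exact i3.add i4) i5]
    rw [← integral_zero E2 ℝ (μ := volume)]
    congr 1
    funext x
    have : x - a - b = x - b - a := by abel
    simp only [Q0, Q1, this]; ring
  have dW : ∀ k, HasCompactSupport (Dq k s W) := by
    intro k
    have := ((shc (s • ee k)).sub hc).mul_right (f' := fun _ => s⁻¹)
    exact this
  have j1 : Integrable (fun x => (Dq 0 s p x * Dq 1 (-s) q x - Dq 1 s p x * Dq 0 (-s) q x) * W x) :=
    Continuous.integrable_of_hasCompactSupport (((((Dq_cont hp).mul (Dq_cont hq)).sub
      ((Dq_cont hp).mul (Dq_cont hq)))).mul hW) hc.mul_left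
  have j2 : Integrable (fun x => (p (x + a) * Dq 1 (-s) q x * Dq 0 s W x -
      p (x + b) * Dq 0 (-s) q x * Dq 1 s W x)) := by
    refine Continuous.integrable_of_hasCompactSupport ?_ ?_
    · have h1 := Dq_cont (k := 1) (s := -s) hq
      have h2 := Dq_cont (k := 0) (s := -s) hq
      have h3 := Dq_cont (k := 0) (s := s) hW
      have h4 := Dq_cont (k := 1) (s := s) hW
      fun_prop
    · exact ((dW 0).mul_left).sub ((dW 1).mul_left)
  rw [eq_neg_iff_add_eq_zero, ← integral_add j1 j2]
  have e : (fun x => (Dq 0 s p x * Dq 1 (-s) q x - Dq 1 s p x * Dq 0 (-s) q x) * W x +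
      (p (x + a) * Dq 1 (-s) q x * Dq 0 s W x - p (x + b) * Dq 0 (-s) q x * Dq 1 s W x)) =
      fun x => (F x * (Q0 x - Q1 x) + F (x + a) * Q1 x - F (x + b) * Q0 x) / s ^ 2 := by
    funext x
    have n1 : x + (-s) • ee 0 = x - a := by rw [neg_smul, sub_eq_add_neg]
    have n2 : x + (-s) • ee 1 = x - b := by rw [neg_smul, sub_eq_add_neg]
    simp only [Dq, n1, n2, Q0, Q1, F, ← ha, ← hb]
    field_simp
    ring
  rw [e, integral_div, key, zero_div]

/-- Norm of a pair. -/
def nrm (a b : ℝ) : ℝ := √(a ^ 2 + b ^ 2)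

theorem nrm_nonneg (a b : ℝ) : 0 ≤ nrm a b := Real.sqrt_nonneg _

theorem nrm_sq (a b : ℝ) : nrm a b ^ 2 = a ^ 2 + b ^ 2 := Real.sq_sqrt (by positivity)

theorem nrm_cs (a b a' b' : ℝ) : a * a' + b * b' ≤ nrm a b * nrm a' b' := by
  have h1 := nrm_sq a b
  have h2 := nrm_sq a' b'
  have h3 := nrm_nonneg a b
  have h4 := nrm_nonneg a' b'
  apply le_of_sq_le_sq _ (by positivity)
  rw [mul_pow, h1, h2]
  nlinarith [sq_nonneg (a * b' - b * a')]

theorem nrm_abs_sub (a b a' b' : ℝ) : (nrm a' b' - nrm a b) ^ 2 ≤ (a' - a) ^ 2 + (b' - b) ^ 2 := by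
  have h1 := nrm_sq a b
  have h2 := nrm_sq a' b'
  have h3 := nrm_cs a b a' b'
  nlinarith

theorem nrm_cont {f g : E2 → ℝ} (hf : Continuous f) (hg : Continuous g) :
    Continuous (fun x => nrm (f x) (g x)) := by unfold nrm; fun_prop

/-- Structural assumptions on the nonlinearity `P ↦ g(|P|) P`. -/
structure Adm (g : ℝ → ℝ) (c C μ : ℝ) : Prop where
  cont : Continuous g
  cpos : 0 < c
  Cge : 1 ≤ C
  low : ∀ t, 0 ≤ t → c / (1 + t) ≤ g t
  up : ∀ t, 0 ≤ t → g t ≤ C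
  mono : ∀ a b a' b' : ℝ, (a' - a) ^ 2 + (b' - b) ^ 2 ≤ 1 →
    c * (1 + nrm a b) ^ (-μ) * ((a' - a) ^ 2 + (b' - b) ^ 2) ≤
      (g (nrm a' b') * a' - g (nrm a b) * a) * (a' - a) +
      (g (nrm a' b') * b' - g (nrm a b) * b) * (b' - b)
  coco : ∀ a b a' b' : ℝ, (a' - a) ^ 2 + (b' - b) ^ 2 ≤ 1 →
    (g (nrm a' b') * a' - g (nrm a b) * a) ^ 2 + (g (nrm a' b') * b' - g (nrm a b) * b) ^ 2 ≤
      C / (1 + nrm a b) * ((g (nrm a' b') * a' - g (nrm a b) * a) * (a' - a) +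
      (g (nrm a' b') * b' - g (nrm a b) * b) * (b' - b))

theorem coco_alg {a b a' b' r r' g g' lam Lam : ℝ} (hr : r ^ 2 = a ^ 2 + b ^ 2)
    (hr' : r' ^ 2 = a' ^ 2 + b' ^ 2) (hcs : a * a' + b * b' ≤ r * r')
    (hg : lam ≤ g) (hg' : lam ≤ g') (hgu : g ≤ Lam) (hgu' : g' ≤ Lam) (hg0 : 0 ≤ g) (hg0' : 0 ≤ g')
    (h1 : lam * (r' - r) ^ 2 ≤ (g' * r' - g * r) * (r' - r))
    (h2 : (g' * r' - g * r) ^ 2 ≤ Lam * ((g' * r' - g * r) * (r' - r))) :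
    lam * ((a' - a) ^ 2 + (b' - b) ^ 2) ≤ (g' * a' - g * a) * (a' - a) + (g' * b' - g * b) * (b' - b) ∧
    (g' * a' - g * a) ^ 2 + (g' * b' - g * b) ^ 2 ≤
      Lam * ((g' * a' - g * a) * (a' - a) + (g' * b' - g * b) * (b' - b)) := by
  set d := r * r' - (a * a' + b * b') with hd
  have hd0 : 0 ≤ d := by linarith
  have e1 : (a' - a) ^ 2 + (b' - b) ^ 2 = (r' - r) ^ 2 + 2 * d := by
    rw [hd]; linear_combination -hr - hr'
  have e2 : (g' * a' - g * a) * (a' - a) + (g' * b' - g * b) * (b' - b) =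
      (g' * r' - g * r) * (r' - r) + (g + g') * d := by
    rw [hd]; linear_combination -g * hr - g' * hr'
  have e3 : (g' * a' - g * a) ^ 2 + (g' * b' - g * b) ^ 2 =
      (g' * r' - g * r) ^ 2 + 2 * (g * g') * d := by
    rw [hd]; linear_combination -g^2 * hr - g'^2 * hr'
  rw [e1, e2, e3]
  constructor
  · nlinarith [mul_le_mul_of_nonneg_right hg hd0, mul_le_mul_of_nonneg_right hg' hd0]
  · have : 2 * (g * g') ≤ Lam * (g + g') := by nlinarith
    nlinarith [mul_le_mul_of_nonneg_right this hd0]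

theorem adm_of_h (h : ℝ → ℝ) (c₁ c₂ μ : ℝ)
    (hc₁ : 0 < c₁) (hc₂ : 0 < c₂) (hμ₁ : 1 < μ) (hμ₂ : μ < 2)
    (hreg : ContDiff ℝ 2 h) (h0' : deriv h 0 = 0)
    (hlow : ∀ t, 0 ≤ t →
      c₁ * (1 + t) ^ (-μ) ≤ min (deriv (deriv h) t) (slopeH h t))
    (hup : ∀ t, 0 ≤ t →
      max (deriv (deriv h) t) (slopeH h t) ≤ c₂ / (1 + t)) :
    ∃ c C, Adm (fun t => slopeH h (√2 * t)) c C μ := by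
  have hd1 : ContDiff ℝ 1 (deriv h) := by
    have := (contDiff_succ_iff_deriv (n := 1) (f := h)).1 (by rw [one_add_one_eq_two]; exact hreg)
    exact this.2.2
  have hdd : Differentiable ℝ (deriv h) := hd1.differentiable (by norm_num)
  have hsl : slopeH h = dslope (deriv h) 0 := by
    funext t
    unfold slopeH
    split_ifs with ht
    · subst ht; simp
    · rw [dslope_of_ne _ ht, slope_def_field, h0']; simp
  have hcont : Continuous (slopeH h) := by
    rw [hsl, ← continuousOn_univ, continuousOn_dslope univ_mem]
    exact ⟨hd1.continuous.continuousOn, hdd 0⟩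
  have hs2 : (1:ℝ) ≤ √2 := by rw [Real.one_le_sqrt]; norm_num
  have hs2' : √2 ≤ (2:ℝ) := by rw [Real.sqrt_le_left (by norm_num)]; norm_num
  have hsq : √2 * √2 = (2:ℝ) := Real.mul_self_sqrt (by norm_num)
  have hφ : ∀ t, slopeH h t * t = deriv h t := by
    intro t; unfold slopeH; split_ifs with ht
    · subst ht; simp [h0']
    · field_simp
  have l1 : ∀ t, 0 ≤ t → c₁ * (1 + t) ^ (-μ) ≤ slopeH h t := fun t ht =>
    (hlow t ht).trans (min_le_right _ _)
  have l2 : ∀ t, 0 ≤ t → c₁ * (1 + t) ^ (-μ) ≤ deriv (deriv h) t := fun t ht =>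
    (hlow t ht).trans (min_le_left _ _)
  have u1 : ∀ t, 0 ≤ t → slopeH h t ≤ c₂ / (1 + t) := fun t ht =>
    (le_max_right _ _).trans (hup t ht)
  have u2 : ∀ t, 0 ≤ t → deriv (deriv h) t ≤ c₂ / (1 + t) := fun t ht =>
    (le_max_left _ _).trans (hup t ht)
  have pw : ∀ x y : ℝ, 0 < x → x ≤ y → y ^ (-μ) ≤ x ^ (-μ) := fun x y hx hxy =>
    Real.rpow_le_rpow_of_nonpos hx hxy (by linarith)
  have pw2 : ∀ x : ℝ, 1 ≤ x → (1/16) * x ^ (-μ) ≤ (4 * x) ^ (-μ) := by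
    intro x hx
    rw [Real.mul_rpow (by norm_num) (by linarith)]
    have : (1/16 : ℝ) ≤ 4 ^ (-μ) := by
      calc (1/16 : ℝ) = 4 ^ (-2 : ℝ) := by
            rw [Real.rpow_neg (by norm_num)]; norm_num
        _ ≤ 4 ^ (-μ) := Real.rpow_le_rpow_of_exponent_le (by norm_num) (by linarith)
    have h0 : 0 ≤ x ^ (-μ) := Real.rpow_nonneg (by linarith) _
    nlinarith
  -- pairwise estimate
  have main : ∀ a b a' b' : ℝ, (a' - a) ^ 2 + (b' - b) ^ 2 ≤ 1 →
    (c₁/16) * (1 + nrm a b) ^ (-μ) * ((a' - a) ^ 2 + (b' - b) ^ 2) ≤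
      (slopeH h (√2 * nrm a' b') * a' - slopeH h (√2 * nrm a b) * a) * (a' - a) +
      (slopeH h (√2 * nrm a' b') * b' - slopeH h (√2 * nrm a b) * b) * (b' - b) ∧
    (slopeH h (√2 * nrm a' b') * a' - slopeH h (√2 * nrm a b) * a) ^ 2
      + (slopeH h (√2 * nrm a' b') * b' - slopeH h (√2 * nrm a b) * b) ^ 2 ≤
      (2 * c₂) / (1 + nrm a b) * ((slopeH h (√2 * nrm a' b') * a' - slopeH h (√2 * nrm a b) * a) * (a' - a) +
      (slopeH h (√2 * nrm a' b') * b' - slopeH h (√2 * nrm a b) * b) * (b' - b)) := by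
    intro a b a' b' hab
    set r := nrm a b with hr
    set r' := nrm a' b' with hr'
    have r0 : 0 ≤ r := nrm_nonneg _ _
    have r0' : 0 ≤ r' := nrm_nonneg _ _
    have hdiff : |r' - r| ≤ 1 := by
      rw [← sq_le_one_iff_abs_le_one]
      exact (nrm_abs_sub a b a' b').trans hab
    obtain ⟨hd1', hd2'⟩ := abs_le.1 hdiff
    -- bounds at all points with √2-scale between
    have bl : ∀ ρ, 0 ≤ ρ → ρ ≤ r + 1 → (c₁/16) * (1 + r) ^ (-μ) ≤ c₁ * (1 + √2 * ρ) ^ (-μ) := by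
      intro ρ h0 h1
      have h2 : √2 * ρ ≤ 2 * ρ := by gcongr
      have h3 := pw (1 + √2 * ρ) (4 * (1 + r)) (by positivity) (by linarith)
      have h4 := pw2 (1 + r) (by linarith)
      have := mul_le_mul_of_nonneg_left (h4.trans h3) hc₁.le
      linarith
    have bu : ∀ ρ, 0 ≤ ρ → r - 1 ≤ ρ → c₂ / (1 + √2 * ρ) ≤ (2 * c₂) / (1 + r) := by
      intro ρ h0 h1
      rw [div_le_div_iff₀ (by positivity) (by positivity)]
      have : ρ ≤ √2 * ρ := by nlinarith
      nlinarith
    have g0 : ∀ t, 0 ≤ t → 0 ≤ slopeH h t := fun t ht =>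
      le_trans (by positivity) (l1 t ht)
    -- mean value
    obtain ⟨m, hm1, hm2⟩ : ∃ m, ((c₁/16) * (1 + r) ^ (-μ) ≤ m ∧ m ≤ (2 * c₂) / (1 + r)) ∧
        deriv h (√2 * r') - deriv h (√2 * r) = m * (√2 * r' - √2 * r) := by
      rcases lt_trichotomy r r' with hlt | heq | hgt
      · have hlt2 : √2 * r < √2 * r' := by nlinarith
        obtain ⟨ξ, hξ, e⟩ := exists_deriv_eq_slope (deriv h) hlt2 hd1.continuous.continuousOn
          hdd.differentiableOn
        have hξ0 : 0 ≤ ξ := le_trans (by positivity) hξ.1.le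
        have e1 : ξ = √2 * (ξ / √2) := by field_simp
        have a1 : ξ / √2 ≤ r' := by rw [div_le_iff₀ (by positivity)]; linarith [hξ.2]
        have a2 : r ≤ ξ / √2 := by rw [le_div_iff₀ (by positivity)]; linarith [hξ.1]
        refine ⟨deriv (deriv h) ξ, ⟨(bl (ξ/√2) (by positivity) (by linarith)).trans ?_,
          le_trans ?_ (bu (ξ/√2) (by positivity) (by linarith))⟩, ?_⟩
        · rw [← e1]; exact l2 ξ hξ0
        · rw [← e1]; exact u2 ξ hξ0
        · rw [e, div_mul_cancel₀ _ (by linarith)]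
      · refine ⟨deriv (deriv h) (√2 * r), ⟨(bl r r0 (by linarith)).trans (l2 _ (by positivity)),
          (u2 _ (by positivity)).trans (bu r r0 (by linarith))⟩, ?_⟩
        rw [heq]; ring
      · have hlt2 : √2 * r' < √2 * r := by nlinarith
        obtain ⟨ξ, hξ, e⟩ := exists_deriv_eq_slope (deriv h) hlt2 hd1.continuous.continuousOn
          hdd.differentiableOn
        have hξ0 : 0 ≤ ξ := le_trans (by positivity) hξ.1.le
        have e1 : ξ = √2 * (ξ / √2) := by field_simp
        have a1 : ξ / √2 ≤ r := by rw [div_le_iff₀ (by positivity)]; linarith [hξ.2]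
        have a2 : r' ≤ ξ / √2 := by rw [le_div_iff₀ (by positivity)]; linarith [hξ.1]
        refine ⟨deriv (deriv h) ξ, ⟨(bl (ξ/√2) (by positivity) (by linarith)).trans ?_,
          le_trans ?_ (bu (ξ/√2) (by positivity) (by linarith))⟩, ?_⟩
        · rw [← e1]; exact l2 ξ hξ0
        · rw [← e1]; exact u2 ξ hξ0
        · have : √2 * r - √2 * r' ≠ 0 := by linarith
          have e3 := (eq_div_iff this).1 e
          linarith
    have hm0 : 0 ≤ m := le_trans (by positivity) hm1.1
    have hphi : slopeH h (√2 * r') * r' - slopeH h (√2 * r) * r = m * (r' - r) := by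
      have : √2 * (slopeH h (√2 * r') * r' - slopeH h (√2 * r) * r) = √2 * (m * (r' - r)) := by
        have e1 := hφ (√2 * r)
        have e2 := hφ (√2 * r')
        linear_combination hm2 + e2 - e1
      exact mul_left_cancel₀ (by positivity) this
    apply coco_alg (r := r) (r' := r') (nrm_sq a b) (nrm_sq a' b') (nrm_cs a b a' b')
    · exact (bl r r0 (by linarith)).trans (l1 _ (by positivity))
    · exact (bl r' r0' (by linarith)).trans (l1 _ (by positivity))
    · exact (u1 _ (by positivity)).trans (bu r r0 (by linarith))
    · exact (u1 _ (by positivity)).trans (bu r' r0' (by linarith))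
    · exact g0 _ (by positivity)
    · exact g0 _ (by positivity)
    · rw [hphi]; nlinarith [sq_nonneg (r' - r), hm1.1]
    · rw [hphi]
      have : 0 ≤ m * (r' - r)^2 := by positivity
      nlinarith [hm1.2]
  refine ⟨c₁ / 16, 1 + 2 * c₂, ⟨by fun_prop, by positivity, by linarith, ?_, ?_, ?_, ?_⟩⟩
  · -- lower bound
    intro t ht
    have hmono : ∀ x y, 0 ≤ x → x ≤ y → deriv h x ≤ deriv h y := by
      have := monotoneOn_of_deriv_nonneg (convex_Ici (0:ℝ)) hd1.continuous.continuousOn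
        hdd.differentiableOn (by
          intro x hx
          have hx0 : 0 ≤ x := by simp at hx; exact hx.le
          exact le_trans (by positivity) (l2 x hx0))
      intro x y hx hxy
      exact this hx (hx.trans hxy) hxy
    set r := √2 * t with hr
    have hr0 : 0 ≤ r := by positivity
    have hr2 : r ≤ 2 * t := by rw [hr]; gcongr
    have htr : t ≤ r := by rw [hr]; nlinarith
    have q4 : ∀ x : ℝ, 1 ≤ x → x ≤ 2 → 1/4 ≤ x ^ (-μ) := by
      intro x h1 h2
      calc (1/4 : ℝ) = 2 ^ (-2 : ℝ) := by
            rw [Real.rpow_neg (by norm_num)]; norm_num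
        _ ≤ 2 ^ (-μ) := Real.rpow_le_rpow_of_exponent_le (by norm_num) (by linarith)
        _ ≤ x ^ (-μ) := pw _ _ (by linarith) h2
    rcases le_total r 1 with hr1 | hr1
    · have h1 := l1 r hr0
      have h2 := q4 (1 + r) (by linarith) (by linarith)
      have : c₁ / 16 / (1 + t) ≤ c₁ / 16 := div_le_self (by positivity) (by linarith)
      show _ ≤ slopeH h r
      nlinarith
    · have h1 := l1 1 zero_le_one
      have h2 := q4 (1 + 1) (by norm_num) (by norm_num)
      have h3 := hmono 1 r zero_le_one hr1
      have e1 := hφ 1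
      have e2 := hφ r
      show _ ≤ slopeH h r
      have h6 : c₁ * (1/4) ≤ c₁ * (1 + 1) ^ (-μ) := mul_le_mul_of_nonneg_left h2 hc₁.le
      have h5 : c₁ / 4 ≤ slopeH h r * r := by
        have h7 := (h6.trans h1)
        rw [e2]; linarith
      have hs0 : 0 ≤ slopeH h r := le_trans (by positivity) (l1 r hr0)
      rw [div_le_iff₀ (by positivity)]
      nlinarith
  · intro t ht
    have := u1 (√2 * t) (by positivity)
    have h2 : c₂ / (1 + √2 * t) ≤ c₂ := div_le_self hc₂.le (by nlinarith)
    show slopeH h (√2 * t) ≤ _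
    linarith
  · intro a b a' b' hab; exact (main a b a' b' hab).1
  · intro a b a' b' hab
    obtain ⟨m1, m2⟩ := main a b a' b' hab
    refine m2.trans ?_
    have n0 := nrm_nonneg a b
    have hp : 0 ≤ (c₁/16) * (1 + nrm a b) ^ (-μ) * ((a' - a) ^ 2 + (b' - b) ^ 2) := by positivity
    apply mul_le_mul_of_nonneg_right _ (hp.trans m1)
    gcongr; linarith

theorem int_of_zero {f : E2 → ℝ} {R : ℝ} (hf : Continuous f) (h0 : ∀ x, R ≤ ‖x‖ → f x = 0) :
    Integrable f := by
  apply hf.integrable_of_hasCompactSupport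
  refine HasCompactSupport.intro (isCompact_closedBall (0 : E2) R) ?_
  intro x hx
  apply h0
  have : R < ‖x‖ := by simpa using hx
  exact this.le

theorem int_le2 {f g1 g2 : E2 → ℝ} {c1 c2 : ℝ} (hf : Integrable f) (h1 : Integrable g1)
    (h2 : Integrable g2) (h : ∀ x, f x ≤ c1 * g1 x + c2 * g2 x) :
    ∫ x, f x ≤ c1 * (∫ x, g1 x) + c2 * ∫ x, g2 x := by
  rw [← integral_const_mul, ← integral_const_mul,
    ← integral_add (h1.const_mul c1) (h2.const_mul c2)]
  exact integral_mono hf ((h1.const_mul c1).add (h2.const_mul c2)) h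

theorem int_le1 {f g1 : E2 → ℝ} {c1 : ℝ} (hf : Integrable f) (h1 : Integrable g1)
    (h : ∀ x, f x ≤ c1 * g1 x) : ∫ x, f x ≤ c1 * (∫ x, g1 x) := by
  rw [← integral_const_mul]
  exact integral_mono hf (h1.const_mul c1) h

theorem cacc_pt {SA SB eA eB y Y A F D : ℝ} (hA : 0 < A) (_hF : 0 ≤ F) (_hD : 0 ≤ D) (_hy : 0 ≤ y)
    (h : SA ^ 2 + SB ^ 2 ≤ A * Y) (h1 : |eA| ≤ y * D * F) (h2 : |eB| ≤ y * D * F) :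
    -(SA * eA + SB * eB) ≤ y ^ 2 * Y / 2 + D ^ 2 * F ^ 2 * A := by
  have hAY : 0 ≤ A * Y := le_trans (by positivity) h
  have hY : 0 ≤ Y := by
    by_contra hh
    exact absurd hAY (not_le.2 (mul_neg_of_pos_of_neg hA (not_le.1 hh)))
  have hz : -(SA * eA + SB * eB) ≤ y * D * F * (|SA| + |SB|) := by
    have a1 : |SA * eA| ≤ |SA| * (y * D * F) := by
      rw [abs_mul]; exact mul_le_mul_of_nonneg_left h1 (abs_nonneg _)
    have a2 : |SB * eB| ≤ |SB| * (y * D * F) := by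
      rw [abs_mul]; exact mul_le_mul_of_nonneg_left h2 (abs_nonneg _)
    have := neg_abs_le (SA * eA)
    have := neg_abs_le (SB * eB)
    linarith
  have hs : (|SA| + |SB|) ^ 2 ≤ 2 * (A * Y) := by
    have e1 := sq_abs SA
    have e2 := sq_abs SB
    nlinarith [sq_nonneg (|SA| - |SB|)]
  have hz2 : (y * D * F * (|SA| + |SB|)) ^ 2 ≤ ((y ^ 2 * Y + 2 * (D ^ 2 * F ^ 2 * A)) / 2) ^ 2 := by
    have : (y * D * F * (|SA| + |SB|)) ^ 2 ≤ (y * D * F) ^ 2 * (2 * (A * Y)) := by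
      rw [mul_pow]; exact mul_le_mul_of_nonneg_left hs (by positivity)
    nlinarith [sq_nonneg (y ^ 2 * Y - 2 * (D ^ 2 * F ^ 2 * A))]
  have := le_of_sq_le_sq hz2 (by positivity)
  linarith

theorem eta_pow_bounds (n : ℕ) : ∃ K : ℝ, 1 ≤ K ∧ ∀ R : ℝ, 1 ≤ R → ∀ x : E2,
    (∀ k, |dd k (fun y => eta R y ^ (n+2)) x| ≤ K / R * eta R x ^ (n+1)) ∧
    (∀ j k, |dd j (dd k (fun y => eta R y ^ (n+2))) x| ≤ K / R ^ 2 * eta R x ^ n) := by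
  obtain ⟨K, hK, hb⟩ := eta_bounds
  refine ⟨2 * (n+2)^2 * K^2, ?_, ?_⟩
  · have : (0:ℝ) ≤ n := n.cast_nonneg
    nlinarith [sq_nonneg (K-1), sq_nonneg (n:ℝ), mul_nonneg this (sq_nonneg K)]
  intro R hR x
  obtain ⟨h1, h2⟩ := hb R hR x
  have hn : (0:ℝ) ≤ n := n.cast_nonneg
  have hR0 : 0 < R := by linarith
  have he0 := eta_nonneg R x
  have he1 := eta_le_one R x
  have hd : ∀ k, dd k (fun y => eta R y ^ (n+2)) =
      fun x => (((n+2 : ℕ) : ℝ) * eta R x ^ (n+1)) * dd k (eta R) x := by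
    intro k; ext x; rw [dd_pow (eta_c1 R)]; rfl
  constructor
  · intro k
    rw [hd, abs_mul, abs_of_nonneg (by positivity)]
    push_cast
    calc ((n:ℝ)+2) * eta R x ^ (n+1) * |dd k (eta R) x| ≤ ((n:ℝ)+2) * eta R x ^ (n+1) * (K / R) :=
          mul_le_mul_of_nonneg_left (h1 k) (by positivity)
      _ = ((n:ℝ)+2) * K * (1/R * eta R x ^ (n+1)) := by ring
      _ ≤ (2 * (n+2)^2 * K^2) * (1/R * eta R x ^ (n+1)) := by
          apply mul_le_mul_of_nonneg_right _ (by positivity)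
          have a1 : (n:ℝ)+2 ≤ 2 * (n+2)^2 := by nlinarith
          have a2 : K ≤ K^2 := by nlinarith
          exact mul_le_mul a1 a2 (by linarith) (by positivity)
      _ = _ := by ring
  · intro j k
    rw [hd]
    have hc : ContDiff ℝ 1 (fun x => ((n+2 : ℕ) : ℝ) * eta R x ^ (n+1)) :=
      contDiff_const.mul ((eta_c1 R).pow _)
    rw [dd_mul hc (dd_c1 (eta_c2 R))]
    have e : dd j (fun x => ((n+2 : ℕ) : ℝ) * eta R x ^ (n+1)) x =
        ((n+2:ℕ):ℝ) * (((n+1:ℕ):ℝ) * eta R x ^ n * dd j (eta R) x) := by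
      have : (fun x => ((n+2 : ℕ) : ℝ) * eta R x ^ (n+1)) =
        fun x => eta R x ^ (n+1) * ((n+2 : ℕ) : ℝ) := by ext; ring
      rw [this, dd_mul_const ((eta_c1 R).pow _), dd_pow (eta_c1 R)]
      simp only [Nat.add_sub_cancel]; ring
    rw [e]
    push_cast
    have b1 : |dd j (eta R) x * dd k (eta R) x| ≤ (K/R) * (K/R) := by
      rw [abs_mul]; exact mul_le_mul (h1 j) (h1 k) (abs_nonneg _) (by positivity)
    have b2 := h2 j k
    have hp : eta R x ^ (n+1) ≤ eta R x ^ n := pow_le_pow_of_le_one he0 he1 (by omega)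
    calc |((n:ℝ)+2) * (((n:ℝ)+1) * eta R x ^ n * dd j (eta R) x) * dd k (eta R) x
          + ((n:ℝ)+2) * eta R x ^ (n+1) * dd j (dd k (eta R)) x|
        ≤ |((n:ℝ)+2) * (((n:ℝ)+1) * eta R x ^ n * dd j (eta R) x) * dd k (eta R) x|
          + |((n:ℝ)+2) * eta R x ^ (n+1) * dd j (dd k (eta R)) x| := abs_add_le _ _
      _ = ((n:ℝ)+2) * ((n:ℝ)+1) * eta R x ^ n * |dd j (eta R) x * dd k (eta R) x|
          + ((n:ℝ)+2) * eta R x ^ (n+1) * |dd j (dd k (eta R)) x| := by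
          rw [show ((n:ℝ)+2) * (((n:ℝ)+1) * eta R x ^ n * dd j (eta R) x) * dd k (eta R) x =
            (((n:ℝ)+2) * ((n:ℝ)+1) * eta R x ^ n) * (dd j (eta R) x * dd k (eta R) x) by ring,
            abs_mul, abs_mul (((n:ℝ)+2) * eta R x ^ (n+1)), abs_of_nonneg (by positivity),
            abs_of_nonneg (a := ((n:ℝ)+2) * eta R x ^ (n+1)) (by positivity)]
      _ ≤ ((n:ℝ)+2) * ((n:ℝ)+1) * eta R x ^ n * ((K/R) * (K/R))
          + ((n:ℝ)+2) * eta R x ^ n * (K / R^2) := by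
          gcongr
      _ = (((n:ℝ)+2) * ((n:ℝ)+1) * K^2 + ((n:ℝ)+2) * K) * (1 / R^2 * eta R x ^ n) := by
          field_simp
      _ ≤ (2 * (n+2)^2 * K^2) * (1 / R^2 * eta R x ^ n) := by
          apply mul_le_mul_of_nonneg_right _ (by positivity)
          have a2 : K ≤ K^2 := by nlinarith
          nlinarith [mul_le_mul_of_nonneg_left a2 (by positivity : 0 ≤ (n:ℝ)+2), mul_nonneg hn (sq_nonneg K),
            mul_nonneg (mul_nonneg hn hn) (sq_nonneg K), sq_nonneg K]
      _ = _ := by ring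

/-- General Caccioppoli inequality. -/
theorem cacc (n : ℕ) (hn : 1 ≤ n) : ∃ C : ℝ, 1 ≤ C ∧ ∀ R : ℝ, 1 ≤ R →
    ∀ (SA SB A ψ : E2 → ℝ), Continuous SA → Continuous SB → Continuous A → ContDiff ℝ 2 ψ →
    (∀ ζ : E2 → ℝ, ContDiff ℝ 2 ζ → HasCompactSupport ζ →
      ∫ x, (SA x * LA ζ x + SB x * LB ζ x) = 0) →
    (∀ x, 0 < A x) →
    (∀ x, ‖x‖ ≤ 2 * R → SA x ^ 2 + SB x ^ 2 ≤ A x * (SA x * LA ψ x + SB x * LB ψ x)) →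
    ∫ x, eta R x ^ (2 * n + 4) * (SA x * LA ψ x + SB x * LB ψ x) ≤
      C * ∫ x, A x * (eta R x ^ (2 * n + 2) * (1 / R ^ 2) * (dd 0 ψ x ^ 2 + dd 1 ψ x ^ 2) +
        eta R x ^ (2 * n) * (1 / R ^ 4) * ψ x ^ 2) := by
  obtain ⟨K, hK, hb⟩ := eta_pow_bounds (2 * n + 2)
  refine ⟨8 * K ^ 2, by nlinarith, ?_⟩
  intro R hR SA SB A ψ hSA hSB hA hψ hw hApos hbd
  have hR0 : 0 < R := by linarith
  have hη : Continuous (eta R) := eta_cont R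
  have hψ1 : ContDiff ℝ 1 ψ := hψ.of_le (by norm_num)
  have hLA := LA_cont hψ
  have hLB := LB_cont hψ
  have hd0 : Continuous (dd 0 ψ) := dd_cont hψ1
  have hd1 : Continuous (dd 1 ψ) := dd_cont hψ1
  have hψc := hψ.continuous
  set M := 2 * n + 4 with hM
  set θ : E2 → ℝ := fun y => eta R y ^ M with hθ
  have hθ2 : ContDiff ℝ 2 θ := (eta_c2 R).pow M
  have hθ1 : ContDiff ℝ 1 θ := (eta_c1 R).pow M
  have hcs : HasCompactSupport (fun y => θ y * ψ y) := by
    refine HasCompactSupport.intro (isCompact_closedBall (0 : E2) (2 * R)) ?_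
    intro x hx
    have : 2 * R < ‖x‖ := by simpa using hx
    simp [hθ, eta_zero hR0 this.le, hM]
  have hw' := hw _ (hθ2.mul hψ) hcs
  set eA : E2 → ℝ := fun x => LA θ x * ψ x + dd 1 θ x * dd 0 ψ x + dd 0 θ x * dd 1 ψ x with heA
  set eB : E2 → ℝ := fun x => LB θ x * ψ x + dd 1 θ x * dd 1 ψ x - dd 0 θ x * dd 0 ψ x with heB
  set Y : E2 → ℝ := fun x => SA x * LA ψ x + SB x * LB ψ x with hY
  set G : E2 → ℝ := fun x => A x * (eta R x ^ (2 * n + 2) * (1 / R ^ 2) * (dd 0 ψ x ^ 2 + dd 1 ψ x ^ 2) +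
        eta R x ^ (2 * n) * (1 / R ^ 4) * ψ x ^ 2) with hG
  have hYc : Continuous Y := by fun_prop
  have hGc : Continuous G := by fun_prop
  have hGi : Integrable G := int_of_zero (R := 2 * R) hGc (by
    intro x hx
    have h1 : 2 * n ≠ 0 := by omega
    simp [hG, eta_zero hR0 hx, h1])
  have hYi : Integrable (fun x => eta R x ^ M * Y x) := int_of_zero (R := 2 * R) (by fun_prop) (by
    intro x hx
    simp [eta_zero hR0 hx, hM])
  have heAc : Continuous eA := by
    have := LA_cont hθ2
    have : Continuous (dd 0 θ) := dd_cont hθ1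
    have : Continuous (dd 1 θ) := dd_cont hθ1
    fun_prop
  have heBc : Continuous eB := by
    have := LB_cont hθ2
    have : Continuous (dd 0 θ) := dd_cont hθ1
    have : Continuous (dd 1 θ) := dd_cont hθ1
    fun_prop
  -- bounds on the error terms
  have ebd : ∀ x, |eA x| ≤ eta R x ^ (n+2) * K * (eta R x ^ (n+1) * (1/R) * (|dd 0 ψ x| + |dd 1 ψ x|) +
      eta R x ^ n * (1/R^2) * |ψ x|) ∧ |eB x| ≤ eta R x ^ (n+2) * K *
      (eta R x ^ (n+1) * (1/R) * (|dd 0 ψ x| + |dd 1 ψ x|) + eta R x ^ n * (1/R^2) * |ψ x|) := by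
    intro x
    obtain ⟨h1, h2⟩ := hb R hR x
    have e1 : eta R x ^ (n+2) * K * (eta R x ^ (n+1) * (1/R) * (|dd 0 ψ x| + |dd 1 ψ x|) +
      eta R x ^ n * (1/R^2) * |ψ x|) = (K / R ^ 2 * eta R x ^ (2 * n + 2)) * |ψ x| +
        (K / R * eta R x ^ (2 * n + 2 + 1)) * |dd 0 ψ x| + (K / R * eta R x ^ (2 * n + 2 + 1)) * |dd 1 ψ x| := by
      ring
    rw [e1]
    have k1 : |LA θ x| ≤ K / R ^ 2 * eta R x ^ (2 * n + 2) := h2 0 1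
    have k2 : |LB θ x| ≤ K / R ^ 2 * eta R x ^ (2 * n + 2) := by
      have a := h2 1 1
      have b := h2 0 0
      unfold LB
      rw [abs_le] at *
      constructor <;> linarith [a.1, a.2, b.1, b.2]
    have k3 := h1 0
    have k4 := h1 1
    constructor
    · calc |eA x| ≤ |LA θ x * ψ x| + |dd 1 θ x * dd 0 ψ x| + |dd 0 θ x * dd 1 ψ x| := by
            rw [heA]; exact (abs_add_le _ _).trans (by gcongr; exact abs_add_le _ _)
        _ ≤ _ := by simp only [abs_mul]; gcongr
    · calc |eB x| ≤ |LB θ x * ψ x| + |dd 1 θ x * dd 1 ψ x| + |dd 0 θ x * dd 0 ψ x| := by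
            rw [heB]; exact (abs_sub _ _).trans (by gcongr; exact abs_add_le _ _)
        _ = |LB θ x * ψ x| + |dd 0 θ x * dd 0 ψ x| + |dd 1 θ x * dd 1 ψ x| := by ring
        _ ≤ _ := by simp only [abs_mul]; gcongr
  have hei : Integrable (fun x => SA x * eA x + SB x * eB x) := int_of_zero (R := 2 * R) (by fun_prop) (by
    intro x hx
    obtain ⟨h1, h2⟩ := ebd x
    have h0 := eta_zero hR0 hx
    simp only [h0, ne_eq, Nat.add_eq_zero_iff, OfNat.ofNat_ne_zero, and_false, not_false_eq_true,
      zero_pow, zero_mul] at h1 h2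
    have h1 := abs_nonpos_iff.1 h1
    have h2 := abs_nonpos_iff.1 h2
    rw [h1, h2]; simp)
  have hsplit : ∫ x, (SA x * LA (fun y => θ y * ψ y) x + SB x * LB (fun y => θ y * ψ y) x) =
      (∫ x, eta R x ^ M * Y x) + ∫ x, (SA x * eA x + SB x * eB x) := by
    rw [← integral_add hYi hei]
    congr 1; ext x
    rw [LA_mul hθ2 hψ, LB_mul hθ2 hψ]
    simp only [heA, heB, hY, hθ]; ring
  rw [hsplit] at hw'
  have hpt : ∀ x, -(SA x * eA x + SB x * eB x) ≤ eta R x ^ M * Y x / 2 + 4 * K ^ 2 * G x := by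
    intro x
    obtain ⟨h1, h2⟩ := ebd x
    have he0 := eta_nonneg R x
    set F := eta R x ^ (n+1) * (1/R) * (|dd 0 ψ x| + |dd 1 ψ x|) + eta R x ^ n * (1/R^2) * |ψ x| with hF
    have hF0 : 0 ≤ F := by positivity
    rcases le_total ‖x‖ (2 * R) with hx | hx
    · have := cacc_pt (hApos x) hF0 (by linarith : 0 ≤ K) (by positivity) (hbd x hx) h1 h2
      have e : (eta R x ^ (n+2)) ^ 2 = eta R x ^ M := by rw [← pow_mul]; congr 1; omega
      rw [e] at this
      refine this.trans ?_
      have hF2 : F ^ 2 ≤ 4 * (eta R x ^ (2 * n + 2) * (1 / R ^ 2) * (dd 0 ψ x ^ 2 + dd 1 ψ x ^ 2) +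
        eta R x ^ (2 * n) * (1 / R ^ 4) * ψ x ^ 2) := by
        have f1 : F ^ 2 ≤ 2 * (eta R x ^ (n+1) * (1/R) * (|dd 0 ψ x| + |dd 1 ψ x|)) ^ 2 +
          2 * (eta R x ^ n * (1/R^2) * |ψ x|) ^ 2 := by
          rw [hF]
          nlinarith [sq_nonneg (eta R x ^ (n+1) * (1/R) * (|dd 0 ψ x| + |dd 1 ψ x|) - eta R x ^ n * (1/R^2) * |ψ x|)]
        have f2 : (|dd 0 ψ x| + |dd 1 ψ x|) ^ 2 ≤ 2 * (dd 0 ψ x ^ 2 + dd 1 ψ x ^ 2) := by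
          rw [← sq_abs (dd 0 ψ x), ← sq_abs (dd 1 ψ x)]
          nlinarith [sq_nonneg (|dd 0 ψ x| - |dd 1 ψ x|)]
        have f3 : (eta R x ^ (n+1) * (1/R) * (|dd 0 ψ x| + |dd 1 ψ x|)) ^ 2 ≤
            eta R x ^ (2 * n + 2) * (1 / R ^ 2) * (2 * (dd 0 ψ x ^ 2 + dd 1 ψ x ^ 2)) := by
          rw [show (eta R x ^ (n+1) * (1/R) * (|dd 0 ψ x| + |dd 1 ψ x|)) ^ 2 =
            eta R x ^ (2 * n + 2) * (1 / R ^ 2) * (|dd 0 ψ x| + |dd 1 ψ x|) ^ 2 by ring]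
          exact mul_le_mul_of_nonneg_left f2 (by positivity)
        have f4 : (eta R x ^ n * (1/R^2) * |ψ x|) ^ 2 = eta R x ^ (2 * n) * (1 / R ^ 4) * ψ x ^ 2 := by
          rw [← sq_abs (ψ x)]; ring
        have f5 : 0 ≤ eta R x ^ (2 * n) * (1 / R ^ 4) * ψ x ^ 2 := by positivity
        linarith
      have := mul_le_mul_of_nonneg_left hF2 (mul_nonneg (sq_nonneg K) (hApos x).le)
      simp only [hG, hY]
      linarith
    · have h0 := eta_zero hR0 hx
      simp only [h0, ne_eq, Nat.add_eq_zero_iff, OfNat.ofNat_ne_zero, and_false, not_false_eq_true,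
        zero_pow, zero_mul] at h1 h2
      have h1 := abs_nonpos_iff.1 h1
      have h2 := abs_nonpos_iff.1 h2
      rw [h1, h2, h0]
      have : 0 ≤ G x := by
        have := (hApos x).le
        simp only [hG]; positivity
      have hM0 : M ≠ 0 := by omega
      simp only [mul_zero, add_zero, neg_zero, ne_eq, hM0, not_false_eq_true, zero_pow, zero_mul, zero_div, zero_add]
      positivity
  have hinteg := int_le2 (f := fun x => -(SA x * eA x + SB x * eB x)) (c1 := 1/2) (c2 := 4 * K ^ 2) hei.neg hYi hGi
    (fun x => (hpt x).trans (by linarith))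
  rw [integral_neg] at hinteg
  linarith

/-- Modulus of the (trace-free) strain. -/
def tt (ψ : E2 → ℝ) (x : E2) : ℝ := nrm (LA ψ x) (LB ψ x)

/-- Squared Hessian. -/
def HH (ψ : E2 → ℝ) (x : E2) : ℝ :=
  dd 0 (dd 0 ψ) x ^ 2 + dd 1 (dd 1 ψ) x ^ 2 + 2 * dd 0 (dd 1 ψ) x ^ 2

/-- Weight. -/
def WW (p : ℕ) (R : ℝ) (ψ : E2 → ℝ) (x : E2) : ℝ :=
  eta R x ^ (2 * p + 6) / (1 + eta R x ^ p * tt ψ x)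

/-- Weighted Hessian energy. -/
def JJ (p : ℕ) (R : ℝ) (ψ : E2 → ℝ) : ℝ := ∫ x, WW p R ψ x * HH ψ x

/-- Squared difference quotient of strain. -/
def DP2 (k : Fin 2) (s : ℝ) (ψ : E2 → ℝ) (x : E2) : ℝ :=
  Dq k s (LA ψ) x ^ 2 + Dq k s (LB ψ) x ^ 2

/-- Weighted energy of difference quotients. -/
def XX (μ : ℝ) (p : ℕ) (R : ℝ) (ψ : E2 → ℝ) (k : Fin 2) (s : ℝ) : ℝ :=
  ∫ x, eta R x ^ (2 * p + 8) * (1 + tt ψ x) ^ (-μ) * DP2 k s ψ x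

/-- Scalar form of the problem for the stream function. -/
structure Sol (g : ℝ → ℝ) (ψ : E2 → ℝ) : Prop where
  c2 : ContDiff ℝ 2 ψ
  weak : ∀ ζ : E2 → ℝ, ContDiff ℝ 2 ζ → HasCompactSupport ζ →
      ∫ x, (g (tt ψ x) * LA ψ x * LA ζ x + g (tt ψ x) * LB ψ x * LB ζ x) = 0

/-- Growth bounds at scale `R`. -/
structure Bd (ψ : E2 → ℝ) (M R U : ℝ) : Prop where
  d : ∀ k x, ‖x‖ ≤ 3 * R → |dd k ψ x| ≤ M * U
  z : ∀ x, ‖x‖ ≤ 3 * R → |ψ x| ≤ M * U * R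

theorem tt_nonneg (ψ : E2 → ℝ) (x : E2) : 0 ≤ tt ψ x := nrm_nonneg _ _

theorem tt_cont {ψ : E2 → ℝ} (hψ : ContDiff ℝ 2 ψ) : Continuous (tt ψ) :=
  nrm_cont (LA_cont hψ) (LB_cont hψ)

theorem HH_nonneg (ψ : E2 → ℝ) (x : E2) : 0 ≤ HH ψ x := by unfold HH; positivity

theorem HH_cont {ψ : E2 → ℝ} (hψ : ContDiff ℝ 2 ψ) : Continuous (HH ψ) := by
  have h1 : Continuous (dd 0 (dd 0 ψ)) := dd_dd_cont hψ
  have h2 : Continuous (dd 1 (dd 1 ψ)) := dd_dd_cont hψ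
  have h3 : Continuous (dd 0 (dd 1 ψ)) := dd_dd_cont hψ
  unfold HH; fun_prop

theorem den_pos (p : ℕ) (R : ℝ) (ψ : E2 → ℝ) (x : E2) : 0 < 1 + eta R x ^ p * tt ψ x := by
  have := eta_nonneg R x
  have := tt_nonneg ψ x
  positivity

theorem WW_nonneg (p : ℕ) (R : ℝ) (ψ : E2 → ℝ) (x : E2) : 0 ≤ WW p R ψ x := by
  have := eta_nonneg R x
  have := den_pos p R ψ x
  unfold WW; positivity

theorem WW_cont (p : ℕ) (R : ℝ) {ψ : E2 → ℝ} (hψ : ContDiff ℝ 2 ψ) : Continuous (WW p R ψ) := by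
  have h1 := eta_cont R
  have h2 := tt_cont hψ
  unfold WW
  exact (h1.pow _).div (by fun_prop) (fun x => (den_pos p R ψ x).ne')

theorem WW_zero (p : ℕ) {R : ℝ} (hR : 1 ≤ R) (ψ : E2 → ℝ) {x : E2} (hx : 2 * R ≤ ‖x‖) :
    WW p R ψ x = 0 := by simp [WW, eta_zero (by linarith) hx]

theorem WH_int (p : ℕ) {R : ℝ} (hR : 1 ≤ R) {ψ : E2 → ℝ} (hψ : ContDiff ℝ 2 ψ) :
    Integrable (fun x => WW p R ψ x * HH ψ x) :=
  int_of_zero (R := 2 * R) ((WW_cont p R hψ).mul (HH_cont hψ)) (fun x hx => by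
    rw [WW_zero p hR ψ hx, zero_mul])

theorem DP2_cont {k : Fin 2} {s : ℝ} {ψ : E2 → ℝ} (hψ : ContDiff ℝ 2 ψ) :
    Continuous (DP2 k s ψ) := by
  have h1 : Continuous (Dq k s (LA ψ)) := Dq_cont (LA_cont hψ)
  have h2 : Continuous (Dq k s (LB ψ)) := Dq_cont (LB_cont hψ)
  unfold DP2; fun_prop

theorem tpow_cont (μ : ℝ) {ψ : E2 → ℝ} (hψ : ContDiff ℝ 2 ψ) :
    Continuous (fun x => (1 + tt ψ x) ^ (-μ)) := by
  have h2 := tt_cont hψ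
  apply Continuous.rpow_const (by fun_prop)
  intro x; left
  have := tt_nonneg ψ x
  positivity

theorem X_int (μ : ℝ) (p : ℕ) {R : ℝ} (hR : 1 ≤ R) {ψ : E2 → ℝ} (hψ : ContDiff ℝ 2 ψ) (k : Fin 2) (s : ℝ) :
    Integrable (fun x => eta R x ^ (2 * p + 8) * (1 + tt ψ x) ^ (-μ) * DP2 k s ψ x) :=
  int_of_zero (R := 2 * R) ((((eta_cont R).pow _).mul (tpow_cont μ hψ)).mul (DP2_cont hψ)) (fun x hx => by
    simp [eta_zero (by linarith) hx])

theorem eta2_one {R : ℝ} (hR : 1 ≤ R) {x : E2} (hx : ‖x‖ ≤ 2 * R) : eta (2 * R) x = 1 :=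
  eta_one (by linarith) hx

theorem eta2_int {R : ℝ} (hR : 1 ≤ R) : Integrable (eta (2 * R)) :=
  (eta_cont _).integrable_of_hasCompactSupport (eta_compact (by linarith))

theorem eta_vol : ∃ V : ℝ, 1 ≤ V ∧ ∀ R : ℝ, 1 ≤ R → ∫ x, eta (2 * R) x ≤ V * R ^ 2 := by
  have h0 : 0 ≤ ∫ x : E2, chi0 x := integral_nonneg (fun x => chi0.nonneg)
  refine ⟨1 + 4 * ∫ x : E2, chi0 x, by linarith, ?_⟩
  intro R hR
  have : ∫ x, eta (2 * R) x = |(2 * R) ^ 2| • ∫ x : E2, chi0 x := by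
    have := Measure.integral_comp_inv_smul (volume : Measure E2) (fun x => chi0 x) (2 * R)
    rw [finrank_euclideanSpace_fin] at this
    exact this
  rw [this, abs_of_nonneg (by positivity), smul_eq_mul]
  nlinarith [sq_nonneg R]

theorem energy {g : ℝ → ℝ} {c C μ : ℝ} (hg : Adm g c C μ) {M : ℝ} (hM : 1 ≤ M) :
    ∃ C₁ : ℝ, 1 ≤ C₁ ∧ ∀ R U : ℝ, 1 ≤ R → 1 ≤ U → ∀ ψ, Sol g ψ → Bd ψ M R U →
      ∫ x, eta R x ^ 6 * (tt ψ x ^ 2 / (1 + tt ψ x)) ≤ C₁ * U ^ 2 := by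
  obtain ⟨K, hK, hc⟩ := cacc 1 le_rfl
  obtain ⟨V, hV, hvol⟩ := eta_vol
  have hcp := hg.cpos
  have hC1 := hg.Cge
  refine ⟨1 + 1 / c * (K * (C * (3 * M ^ 2) * V)), by
    have : 0 ≤ 1 / c * (K * (C * (3 * M ^ 2) * V)) := by positivity
    linarith, ?_⟩
  intro R U hR hU ψ hs hb
  have hψ := hs.c2
  have hψ1 : ContDiff ℝ 1 ψ := hψ.of_le (by norm_num)
  have htc := tt_cont hψ
  have hgc : Continuous g := hg.cont
  have hη := eta_cont R
  have hLA := LA_cont hψ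
  have hLB := LB_cont hψ
  have hd0 : Continuous (dd 0 ψ) := dd_cont hψ1
  have hd1 : Continuous (dd 1 ψ) := dd_cont hψ1
  have hψc := hψ.continuous
  have hR0 : 0 < R := by linarith
  have hsq : ∀ x, LA ψ x ^ 2 + LB ψ x ^ 2 = tt ψ x ^ 2 := fun x => (nrm_sq _ _).symm
  have hg0 : ∀ x, 0 ≤ g (tt ψ x) := fun x => by
    have h0 := tt_nonneg ψ x
    exact le_trans (by positivity) (hg.low _ h0)
  have h1 := hc R hR (fun x => g (tt ψ x) * LA ψ x) (fun x => g (tt ψ x) * LB ψ x) (fun _ => C) ψ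
    (by fun_prop) (by fun_prop) continuous_const hψ hs.weak (fun _ => by linarith) (by
      intro x _
      have e1 : (g (tt ψ x) * LA ψ x) ^ 2 + (g (tt ψ x) * LB ψ x) ^ 2 =
        g (tt ψ x) * (g (tt ψ x) * tt ψ x ^ 2) := by rw [← hsq]; ring
      have e2 : g (tt ψ x) * LA ψ x * LA ψ x + g (tt ψ x) * LB ψ x * LB ψ x =
        g (tt ψ x) * tt ψ x ^ 2 := by rw [← hsq]; ring
      rw [e1, e2]
      exact mul_le_mul_of_nonneg_right (hg.up _ (tt_nonneg ψ x)) (mul_nonneg (hg0 x) (sq_nonneg _)))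
  have i1 : Integrable (fun x => eta R x ^ 6 * (tt ψ x ^ 2 / (1 + tt ψ x))) :=
    int_of_zero (R := 2 * R) ((hη.pow _).mul ((htc.pow 2).div (by fun_prop) (fun x => by
      have := tt_nonneg ψ x; positivity))) (fun x hx => by simp [eta_zero hR0 hx])
  have i2 : Integrable (fun x => eta R x ^ (2 * 1 + 4) * (g (tt ψ x) * LA ψ x * LA ψ x +
      g (tt ψ x) * LB ψ x * LB ψ x)) :=
    int_of_zero (R := 2 * R) (by fun_prop) (fun x hx => by simp [eta_zero hR0 hx])
  have k1 := int_le1 (c1 := 1 / c) i1 i2 (by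
    intro x
    have e2 : g (tt ψ x) * LA ψ x * LA ψ x + g (tt ψ x) * LB ψ x * LB ψ x =
        g (tt ψ x) * tt ψ x ^ 2 := by rw [← hsq]; ring
    rw [e2]
    have hl := hg.low _ (tt_nonneg ψ x)
    have he := eta_nonneg R x
    have h2 : tt ψ x ^ 2 / (1 + tt ψ x) ≤ 1 / c * (g (tt ψ x) * tt ψ x ^ 2) := by
      have := mul_le_mul_of_nonneg_right hl (sq_nonneg (tt ψ x))
      calc tt ψ x ^ 2 / (1 + tt ψ x) = 1 / c * (c / (1 + tt ψ x) * tt ψ x ^ 2) := by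
            field_simp
        _ ≤ _ := mul_le_mul_of_nonneg_left this (by positivity)
    calc eta R x ^ 6 * (tt ψ x ^ 2 / (1 + tt ψ x)) ≤
        eta R x ^ 6 * (1 / c * (g (tt ψ x) * tt ψ x ^ 2)) := mul_le_mul_of_nonneg_left h2 (by positivity)
      _ = _ := by ring)
  have k2 := int_le1 (f := fun x => C * (eta R x ^ (2 * 1 + 2) * (1 / R ^ 2) * (dd 0 ψ x ^ 2 + dd 1 ψ x ^ 2) +
        eta R x ^ (2 * 1) * (1 / R ^ 4) * ψ x ^ 2)) (c1 := C * (3 * M ^ 2) * U ^ 2 / R ^ 2)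
      (int_of_zero (R := 2 * R) (by fun_prop) (fun x hx => by simp [eta_zero hR0 hx])) (eta2_int hR) (by
    intro x
    have he := eta_nonneg R x
    have he1 := eta_le_one R x
    rcases le_total ‖x‖ (2 * R) with hx | hx
    · rw [eta2_one hR hx]
      have b0 : dd 0 ψ x ^ 2 ≤ (M * U) ^ 2 := sq_le_sq' (by linarith [(abs_le.1 (hb.d 0 x (by linarith))).1])
        (abs_le.1 (hb.d 0 x (by linarith))).2
      have b1 : dd 1 ψ x ^ 2 ≤ (M * U) ^ 2 := sq_le_sq' (by linarith [(abs_le.1 (hb.d 1 x (by linarith))).1])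
        (abs_le.1 (hb.d 1 x (by linarith))).2
      have b2 : ψ x ^ 2 ≤ (M * U * R) ^ 2 := sq_le_sq' (by linarith [(abs_le.1 (hb.z x (by linarith))).1])
        (abs_le.1 (hb.z x (by linarith))).2
      calc C * (eta R x ^ (2 * 1 + 2) * (1 / R ^ 2) * (dd 0 ψ x ^ 2 + dd 1 ψ x ^ 2) +
        eta R x ^ (2 * 1) * (1 / R ^ 4) * ψ x ^ 2) ≤ C * (1 * (1 / R ^ 2) * ((M * U) ^ 2 + (M * U) ^ 2) +
        1 * (1 / R ^ 4) * (M * U * R) ^ 2) := by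
            have p1 : eta R x ^ (2 * 1 + 2) ≤ 1 := pow_le_one₀ he he1
            have p2 : eta R x ^ (2 * 1) ≤ 1 := pow_le_one₀ he he1
            gcongr
        _ = _ := by field_simp; ring
    · have := eta_nonneg (2 * R) x
      rw [eta_zero hR0 hx]
      simp only [ne_eq, mul_one, Nat.reduceAdd, OfNat.ofNat_ne_zero, not_false_eq_true, zero_pow, zero_mul, add_zero, mul_zero]
      positivity)
  have k3 := hvol R hR
  calc _ ≤ _ := k1
    _ ≤ 1 / c * (K * (C * (3 * M ^ 2) * U ^ 2 / R ^ 2 * (V * R ^ 2))) := by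
        apply mul_le_mul_of_nonneg_left _ (by positivity)
        refine h1.trans ?_
        apply mul_le_mul_of_nonneg_left _ (by positivity)
        refine k2.trans ?_
        exact mul_le_mul_of_nonneg_left k3 (by positivity)
    _ = (1 / c * (K * (C * (3 * M ^ 2) * V))) * U ^ 2 := by field_simp
    _ ≤ _ := by nlinarith [sq_nonneg U]

theorem ev_of_delta {P : ℝ → Prop} (h : ∃ δ > 0, ∀ s : ℝ, s ≠ 0 → |s| < δ → P s) :
    ∀ᶠ s in nhdsWithin (0:ℝ) (Set.Ioi 0), 0 < s ∧ P s ∧ P (-s) := by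
  obtain ⟨δ, hδ, h⟩ := h
  filter_upwards [Ioo_mem_nhdsGT hδ] with s hs
  obtain ⟨h1, h2⟩ := hs
  refine ⟨h1, h s h1.ne' (by rw [abs_of_pos h1]; exact h2), h (-s) (by linarith [h1]; ) (by
    rw [abs_neg, abs_of_pos h1]; exact h2)⟩

theorem ev_shift {f : E2 → ℝ} (hf : Continuous f) (r : ℝ) {ω : ℝ} (hω : 0 < ω) :
    ∀ᶠ s in nhdsWithin (0:ℝ) (Set.Ioi 0), ∀ k : Fin 2, ∀ x : E2, ‖x‖ ≤ r →
      |f (x + s • ee k) - f x| ≤ ω := by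
  rw [eventually_all]
  intro k
  obtain ⟨δ, hδ, h⟩ := unif_shift hf k r hω
  filter_upwards [ev_of_delta (P := fun s => ∀ x : E2, ‖x‖ ≤ r →
      |f (x + s • ee k) - f x| ≤ ω) ⟨δ, hδ, fun s _ hs => h s hs⟩] with s hs
  exact hs.2.1

theorem ev_Dq {f : E2 → ℝ} (hf : ContDiff ℝ 1 f) (r : ℝ) {ω : ℝ} (hω : 0 < ω) :
    ∀ᶠ s in nhdsWithin (0:ℝ) (Set.Ioi 0), ∀ k : Fin 2, ∀ x : E2, ‖x‖ ≤ r →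
      |Dq k s f x - dd k f x| ≤ ω ∧ |Dq k (-s) f x - dd k f x| ≤ ω := by
  rw [eventually_all]
  intro k
  filter_upwards [ev_of_delta (unif_Dq hf k r hω)] with s hs
  exact fun x hx => ⟨hs.2.1 x hx, hs.2.2 x hx⟩

theorem eta_den {y t : ℝ} (p : ℕ) (hy : 0 ≤ y) (hy1 : y ≤ 1) (ht : 0 ≤ t) :
    1 / (1 + t) ≤ 1 / (1 + y ^ p * t) := by
  have := pow_le_one₀ (n := p) hy hy1
  have h0 : 0 ≤ y ^ p := by positivity
  apply one_div_le_one_div_of_le (by positivity)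
  nlinarith

set_option maxHeartbeats 1600000 in
theorem stepI {g : ℝ → ℝ} {c C μ : ℝ} (hg : Adm g c C μ) {M : ℝ} (hM : 1 ≤ M) (p : ℕ) :
    ∃ C₁ : ℝ, 1 ≤ C₁ ∧ ∀ R U : ℝ, 1 ≤ R → 1 ≤ U → ∀ ψ, Sol g ψ → Bd ψ M R U →
      ∀ᶠ s in nhdsWithin (0:ℝ) (Set.Ioi 0), ∀ k,
        XX μ p R ψ k s ≤ C₁ / R ^ 2 * JJ p R ψ + C₁ * U ^ 2 / R ^ 2 := by
  obtain ⟨K, hK, hc⟩ := cacc (p + 2) (by omega)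
  obtain ⟨V, hV, hvol⟩ := eta_vol
  have hcp := hg.cpos
  have hC1 := hg.Cge
  set C₂ : ℝ := 1 / c * K * C * ((4 + (M + 1) ^ 2) * V) with hC₂
  have hC₂0 : 0 ≤ C₂ := by positivity
  have hC₃ : 2 / c * K * C ≤ C₂ := by
    have : 2 ≤ (4 + (M + 1) ^ 2) * V := by nlinarith [sq_nonneg (M + 1)]
    have h0 : 0 ≤ 1 / c * K * C := by positivity
    calc 2 / c * K * C = 1 / c * K * C * 2 := by ring
      _ ≤ _ := mul_le_mul_of_nonneg_left this h0
  refine ⟨1 + C₂, by linarith, ?_⟩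
  intro R U hR hU ψ hs hb
  have hψ := hs.c2
  have hψ1 : ContDiff ℝ 1 ψ := hψ.of_le (by norm_num)
  have htc := tt_cont hψ
  have hgc : Continuous g := hg.cont
  have hη := eta_cont R
  have hLA := LA_cont hψ
  have hLB := LB_cont hψ
  have hR0 : 0 < R := by linarith
  have hSA : Continuous (fun x => g (tt ψ x) * LA ψ x) := by fun_prop
  have hSB : Continuous (fun x => g (tt ψ x) * LB ψ x) := by fun_prop
  have hR1 : 0 < 1 / R := by positivity
  filter_upwards [self_mem_nhdsWithin, ev_shift hLA (2 * R) (ω := 1/2) (by norm_num),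
    ev_shift hLB (2 * R) (ω := 1/2) (by norm_num), ev_Dq (dd_c1 (k := 0) hψ) (2 * R) hR1,
    ev_Dq (dd_c1 (k := 1) hψ) (2 * R) hR1, ev_Dq hψ1 (2 * R) one_pos] with s hs0 s1 s2 s3 s4 s5
  intro k
  have hs0 : 0 < s := hs0
  have hdq0 : Continuous (Dq k s (dd 0 ψ)) := Dq_cont (dd_cont hψ1)
  have hdq1 : Continuous (Dq k s (dd 1 ψ)) := Dq_cont (dd_cont hψ1)
  have hdq : Continuous (Dq k s ψ) := Dq_cont hψ.continuous
  have hcA : Continuous (Dq k s (LA ψ)) := Dq_cont hLA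
  have hcB : Continuous (Dq k s (LB ψ)) := Dq_cont hLB
  have hcSA : Continuous (Dq k s (fun x => g (tt ψ x) * LA ψ x)) := Dq_cont hSA
  have hcSB : Continuous (Dq k s (fun x => g (tt ψ x) * LB ψ x)) := Dq_cont hSB
  have hAc : Continuous (fun x => C / (1 + tt ψ x)) := continuous_const.div (by fun_prop) (fun x => by
      have := tt_nonneg ψ x; positivity)
  have hP1 : ∀ x, ‖x‖ ≤ 2 * R → (LA ψ (x + s • ee k) - LA ψ x) ^ 2 + (LB ψ (x + s • ee k) - LB ψ x) ^ 2 ≤ 1 := by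
    intro x hx
    have a := s1 k x hx
    have b := s2 k x hx
    rw [← sq_abs, ← sq_abs (LB ψ (x + s • ee k) - LB ψ x)]
    nlinarith [abs_nonneg (LA ψ (x + s • ee k) - LA ψ x), abs_nonneg (LB ψ (x + s • ee k) - LB ψ x)]
  have h1 := hc R hR (Dq k s (fun x => g (tt ψ x) * LA ψ x)) (Dq k s (fun x => g (tt ψ x) * LB ψ x))
    (fun x => C / (1 + tt ψ x)) (Dq k s ψ) hcSA hcSB hAc (Dq_contDiff hψ)
    (weak_Dq hSA hSB hs.weak k s) (fun x => by have := tt_nonneg ψ x; positivity) (by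
      intro x hx
      have := hg.coco _ _ _ _ (hP1 x hx)
      rw [LA_Dq hψ, LB_Dq hψ]
      simp only [Dq]
      simp only [tt]
      calc _ = 1 / s ^ 2 * ((g (nrm (LA ψ (x + s • ee k)) (LB ψ (x + s • ee k))) * LA ψ (x + s • ee k) -
            g (nrm (LA ψ x) (LB ψ x)) * LA ψ x) ^ 2 + (g (nrm (LA ψ (x + s • ee k)) (LB ψ (x + s • ee k))) *
            LB ψ (x + s • ee k) - g (nrm (LA ψ x) (LB ψ x)) * LB ψ x) ^ 2) := by ring
        _ ≤ 1 / s ^ 2 * _ := mul_le_mul_of_nonneg_left this (by positivity)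
        _ = _ := by ring)
  rw [LA_Dq hψ, LB_Dq hψ, dd_Dq hψ1, dd_Dq hψ1] at h1
  rw [show 2 * (p + 2) + 4 = 2 * p + 8 by ring, show 2 * (p + 2) + 2 = 2 * p + 6 by ring,
    show 2 * (p + 2) = 2 * p + 4 by ring] at h1
  have i2 : Integrable (fun x => eta R x ^ (2 * p + 8) * (Dq k s (fun x => g (tt ψ x) * LA ψ x) x *
      Dq k s (LA ψ) x + Dq k s (fun x => g (tt ψ x) * LB ψ x) x * Dq k s (LB ψ) x)) :=
    int_of_zero (R := 2 * R) (by fun_prop) (fun x hx => by simp [eta_zero hR0 hx])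
  have k1 := int_le1 (c1 := 1 / c) (X_int μ p hR hψ k s) i2 (by
    intro x
    have he := eta_nonneg R x
    rcases le_total ‖x‖ (2 * R) with hx | hx
    · have := hg.mono _ _ _ _ (hP1 x hx)
      have h2 : c * (1 + tt ψ x) ^ (-μ) * DP2 k s ψ x ≤ Dq k s (fun x => g (tt ψ x) * LA ψ x) x *
        Dq k s (LA ψ) x + Dq k s (fun x => g (tt ψ x) * LB ψ x) x * Dq k s (LB ψ) x := by
        simp only [DP2, Dq]
        simp only [tt]
        calc _ = 1 / s ^ 2 * (c * (1 + nrm (LA ψ x) (LB ψ x)) ^ (-μ) * ((LA ψ (x + s • ee k) - LA ψ x) ^ 2 +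
                (LB ψ (x + s • ee k) - LB ψ x) ^ 2)) := by ring
          _ ≤ 1 / s ^ 2 * _ := mul_le_mul_of_nonneg_left this (by positivity)
          _ = _ := by ring
      calc _ = 1 / c * (eta R x ^ (2 * p + 8) * (c * (1 + tt ψ x) ^ (-μ) * DP2 k s ψ x)) := by field_simp
        _ ≤ _ := by gcongr
    · rw [eta_zero hR0 hx]; simp)
  have k2 := int_le2 (c1 := 2 * C / R ^ 2) (c2 := C * (4 + (M + 1) ^ 2) * U ^ 2 / R ^ 4)
      (f := fun x => C / (1 + tt ψ x) * (eta R x ^ (2 * p + 6) * (1 / R ^ 2) *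
        (Dq k s (dd 0 ψ) x ^ 2 + Dq k s (dd 1 ψ) x ^ 2) +
        eta R x ^ (2 * p + 4) * (1 / R ^ 4) * Dq k s ψ x ^ 2))
      (int_of_zero (R := 2 * R) (by fun_prop) (fun x hx => by simp [eta_zero hR0 hx]))
      (WH_int p hR hψ) (eta2_int hR) (by
    intro x
    have he := eta_nonneg R x
    have he1 := eta_le_one R x
    have ht := tt_nonneg ψ x
    rcases le_total ‖x‖ (2 * R) with hx | hx
    · rw [eta2_one hR hx]
      have hR2 : (1 / R) ^ 2 = 1 / R ^ 2 := by ring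
      have sqb : ∀ a b w : ℝ, |a - b| ≤ w → a ^ 2 ≤ 2 * b ^ 2 + 2 * w ^ 2 := by
        intro a b w h
        have h2 : (a - b) ^ 2 ≤ w ^ 2 := sq_le_sq' (by linarith [(abs_le.1 h).1]) (abs_le.1 h).2
        nlinarith [sq_nonneg (a - 2 * b)]
      have b0 := sqb _ _ _ (s3 k x hx).1
      have b1 := sqb _ _ _ (s4 k x hx).1
      have hH : dd k (dd 0 ψ) x ^ 2 + dd k (dd 1 ψ) x ^ 2 ≤ HH ψ x := by
        unfold HH
        fin_cases k
        · simp only [Fin.mk_zero, Fin.zero_eta]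
          nlinarith [sq_nonneg (dd 1 (dd 1 ψ) x), sq_nonneg (dd 0 (dd 1 ψ) x)]
        · simp only [Fin.mk_one]
          rw [dd_symm hψ 1 0]
          nlinarith [sq_nonneg (dd 0 (dd 0 ψ) x), sq_nonneg (dd 0 (dd 1 ψ) x)]
      have b2 : Dq k s ψ x ^ 2 ≤ (M + 1) ^ 2 * U ^ 2 := by
        have a1 := (s5 k x hx).1
        have a2 := hb.d k x (by linarith)
        rw [← mul_pow]
        rw [abs_le] at a1 a2
        exact sq_le_sq' (by nlinarith) (by nlinarith)
      have b3 : Dq k s (dd 0 ψ) x ^ 2 + Dq k s (dd 1 ψ) x ^ 2 ≤ 2 * HH ψ x + 4 / R ^ 2 := by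
        rw [hR2] at b0 b1
        rw [show 4 / R ^ 2 = 4 * (1 / R ^ 2) by ring]
        linarith
      have d1 := eta_den p he he1 ht
      have d2 : 1 / (1 + tt ψ x) ≤ 1 := by
        rw [div_le_one (by positivity)]; linarith
      have p1 : eta R x ^ (2 * p + 6) ≤ 1 := pow_le_one₀ he he1
      have p2 : eta R x ^ (2 * p + 4) ≤ 1 := pow_le_one₀ he he1
      have hH0 := HH_nonneg ψ x
      have hU2 : 1 ≤ U ^ 2 := by nlinarith
      calc C / (1 + tt ψ x) * (eta R x ^ (2 * p + 6) * (1 / R ^ 2) *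
        (Dq k s (dd 0 ψ) x ^ 2 + Dq k s (dd 1 ψ) x ^ 2) +
        eta R x ^ (2 * p + 4) * (1 / R ^ 4) * Dq k s ψ x ^ 2)
          ≤ C / (1 + tt ψ x) * (eta R x ^ (2 * p + 6) * (1 / R ^ 2) *
        (2 * HH ψ x + 4 / R ^ 2) + eta R x ^ (2 * p + 4) * (1 / R ^ 4) * ((M + 1) ^ 2 * U ^ 2)) := by gcongr
        _ = C * (2 / R ^ 2) * eta R x ^ (2 * p + 6) * HH ψ x * (1 / (1 + tt ψ x)) +
            C * (1 / (1 + tt ψ x)) * ((eta R x ^ (2 * p + 6)) * (4 / R ^ 4) + eta R x ^ (2 * p + 4) * (1 / R ^ 4) * ((M + 1) ^ 2 * U ^ 2)) := by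
            ring
        _ ≤ C * (2 / R ^ 2) * eta R x ^ (2 * p + 6) * HH ψ x * (1 / (1 + eta R x ^ p * tt ψ x)) +
            C * 1 * (1 * (4 / R ^ 4) + 1 * (1 / R ^ 4) * ((M + 1) ^ 2 * U ^ 2)) := by gcongr
        _ = 2 * C / R ^ 2 * (WW p R ψ x * HH ψ x) + C / R ^ 4 * (4 * 1 + (M + 1) ^ 2 * U ^ 2) := by
            unfold WW; ring
        _ ≤ 2 * C / R ^ 2 * (WW p R ψ x * HH ψ x) + C / R ^ 4 * (4 * U ^ 2 + (M + 1) ^ 2 * U ^ 2) := by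
            gcongr
        _ = _ := by ring
    · have := eta_nonneg (2 * R) x
      rw [WW_zero p hR ψ hx, eta_zero hR0 hx]
      simp only [ne_eq, Nat.add_eq_zero_iff, OfNat.ofNat_ne_zero, and_false, not_false_eq_true, zero_pow, zero_mul, add_zero, mul_zero, zero_add]
      positivity)
  have k3 := hvol R hR
  have hJ0 : 0 ≤ JJ p R ψ := integral_nonneg (fun x => mul_nonneg (WW_nonneg _ _ _ _) (HH_nonneg _ _))
  calc XX μ p R ψ k s ≤ _ := k1
    _ ≤ 1 / c * (K * (2 * C / R ^ 2 * JJ p R ψ + C * (4 + (M + 1) ^ 2) * U ^ 2 / R ^ 4 * (V * R ^ 2))) := by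
        apply mul_le_mul_of_nonneg_left _ (by positivity)
        refine h1.trans ?_
        apply mul_le_mul_of_nonneg_left _ (by positivity)
        refine k2.trans ?_
        unfold JJ
        gcongr
    _ = (2 / c * K * C) * (JJ p R ψ / R ^ 2) + C₂ * (U ^ 2 / R ^ 2) := by rw [hC₂]; field_simp
    _ ≤ (1 + C₂) * (JJ p R ψ / R ^ 2) + (1 + C₂) * (U ^ 2 / R ^ 2) := by
        gcongr <;> linarith
    _ = _ := by ring

theorem W_diff {y y' t t' : ℝ} {p Q : ℕ} (hy : 0 ≤ y) (hy1 : y ≤ 1) (hy' : 0 ≤ y')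
    (ht : 0 ≤ t) (ht' : 0 ≤ t') (htt : |t' - t| ≤ 1 / 2) (hQ : p + 1 ≤ Q) :
    |y' ^ Q / (1 + y' ^ p * t') - y ^ Q / (1 + y ^ p * t)| ≤
      2 * y ^ (Q + p) * |t' - t| / (1 + y ^ p * t) ^ 2 +
      2 * Q * |y' - y| * max y y' ^ (Q - 1) := by
  have hd : 0 < 1 + y ^ p * t := by positivity
  have hd' : 0 < 1 + y ^ p * t' := by positivity
  have hd2 : 0 < 1 + y' ^ p * t' := by positivity
  have hyp : y ^ p ≤ 1 := pow_le_one₀ hy hy1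
  have hyp0 : 0 ≤ y ^ p := by positivity
  set m := max y y' with hm
  have hm0 : 0 ≤ m := le_max_of_le_left hy
  have hym : y ≤ m := le_max_left _ _
  have hym' : y' ≤ m := le_max_right _ _
  have s2 : |y ^ Q / (1 + y ^ p * t') - y ^ Q / (1 + y ^ p * t)| ≤
      2 * y ^ (Q + p) * |t' - t| / (1 + y ^ p * t) ^ 2 := by
    have e : y ^ Q / (1 + y ^ p * t') - y ^ Q / (1 + y ^ p * t) =
        y ^ (Q + p) * (t - t') / ((1 + y ^ p * t') * (1 + y ^ p * t)) := by
      field_simp; ring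
    rw [e, abs_div, abs_mul, abs_of_nonneg (by positivity : 0 ≤ y ^ (Q + p)),
      abs_of_pos (by positivity : 0 < (1 + y ^ p * t') * (1 + y ^ p * t)), abs_sub_comm]
    have hh : (1 + y ^ p * t) / 2 ≤ 1 + y ^ p * t' := by
      have := (abs_le.1 htt).1
      nlinarith
    rw [div_le_div_iff₀ (by positivity) (by positivity)]
    have h3 : (1 + y ^ p * t) ^ 2 ≤ 2 * ((1 + y ^ p * t') * (1 + y ^ p * t)) := by nlinarith
    have h4 : 0 ≤ y ^ (Q + p) * |t' - t| := by positivity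
    calc _ ≤ y ^ (Q + p) * |t' - t| * (2 * ((1 + y ^ p * t') * (1 + y ^ p * t))) :=
          mul_le_mul_of_nonneg_left h3 h4
      _ = _ := by ring
  have pd : ∀ n : ℕ, |y' ^ n - y ^ n| ≤ |y' - y| * n * m ^ (n - 1) := by
    intro n
    have := abs_pow_sub_pow_le y' y n
    rwa [abs_of_nonneg hy, abs_of_nonneg hy', max_comm] at this
  have s1 : |y' ^ Q / (1 + y' ^ p * t') - y ^ Q / (1 + y ^ p * t')| ≤
      2 * Q * |y' - y| * m ^ (Q - 1) := by
    obtain ⟨r, rfl⟩ : ∃ r, Q = p + 1 + r := ⟨Q - (p + 1), by omega⟩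
    have e : y' ^ (p + 1 + r) / (1 + y' ^ p * t') - y ^ (p + 1 + r) / (1 + y ^ p * t') =
        (y' ^ (p + 1 + r) - y ^ (p + 1 + r)) * (1 / ((1 + y' ^ p * t') * (1 + y ^ p * t'))) +
        (y' ^ (1 + r) - y ^ (1 + r)) * (y' ^ p * ((y ^ p * t') / (1 + y ^ p * t')) * (1 / (1 + y' ^ p * t'))) := by
      field_simp; ring
    have q1 : 1 / ((1 + y' ^ p * t') * (1 + y ^ p * t')) ≤ 1 := by
      rw [div_le_one (by positivity)]
      have h1 : 0 ≤ y' ^ p * t' := by positivity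
      have h2 : 0 ≤ y ^ p * t' := by positivity
      nlinarith
    have q2 : y' ^ p * ((y ^ p * t') / (1 + y ^ p * t')) * (1 / (1 + y' ^ p * t')) ≤ m ^ p := by
      have a1 : (y ^ p * t') / (1 + y ^ p * t') ≤ 1 := by
        rw [div_le_one (by positivity)]; linarith
      have a2 : 1 / (1 + y' ^ p * t') ≤ 1 := by
        rw [div_le_one (by positivity)]
        have h1 : 0 ≤ y' ^ p * t' := by positivity
        linarith
      calc _ ≤ m ^ p * 1 * 1 := by gcongr
        _ = _ := by ring
    have w1 := pd (p + 1 + r)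
    have w2 := pd (1 + r)
    rw [e]
    refine (abs_add_le _ _).trans ?_
    rw [abs_mul, abs_mul, abs_of_nonneg (a := 1 / ((1 + y' ^ p * t') * (1 + y ^ p * t'))) (by positivity),
      abs_of_nonneg (a := y' ^ p * ((y ^ p * t') / (1 + y ^ p * t')) * (1 / (1 + y' ^ p * t'))) (by positivity)]
    have e2 : p + 1 + r - 1 = p + r := by omega
    have e3 : 1 + r - 1 = r := by omega
    rw [e2] at w1 ⊢
    rw [e3] at w2
    calc _ ≤ (|y' - y| * (p + 1 + r : ℕ) * m ^ (p + r)) * 1 + (|y' - y| * (1 + r : ℕ) * m ^ r) * m ^ p := by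
          gcongr
      _ = |y' - y| * m ^ (p + r) * ((p + 1 + r : ℕ) + (1 + r : ℕ)) := by ring
      _ ≤ |y' - y| * m ^ (p + r) * ((p + 1 + r : ℕ) + (p + 1 + r : ℕ)) := by
          gcongr; omega
      _ = _ := by ring
  calc _ = |(y' ^ Q / (1 + y' ^ p * t') - y ^ Q / (1 + y ^ p * t')) +
        (y ^ Q / (1 + y ^ p * t') - y ^ Q / (1 + y ^ p * t))| := by congr 1; ring
    _ ≤ _ := abs_add_le _ _
    _ ≤ _ := by linarith

theorem weight_cmp {y t μ : ℝ} {p : ℕ} (hy : 0 ≤ y) (hy1 : y ≤ 1) (ht : 0 ≤ t) (hμ1 : 1 < μ)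
    (hμ2 : μ < 2) (hp : 2 ≤ p * (2 - μ)) :
    y ^ (2 * p + 6 + 2 * p) / (1 + y ^ p * t) ^ 3 ≤ y ^ (2 * p + 8) * (1 + t) ^ (-μ) := by
  have hd1 : 1 ≤ 1 + y ^ p * t := by
    have : 0 ≤ y ^ p * t := by positivity
    linarith
  have hp1 : 1 ≤ p := by
    by_contra h
    have : p = 0 := by omega
    subst this; norm_num at hp
  have h1t : 0 < 1 + t := by linarith
  have hyp : y ^ p ≤ 1 := pow_le_one₀ hy hy1
  rw [Real.rpow_neg h1t.le, ← div_eq_mul_inv, div_le_div_iff₀ (by positivity) (by positivity)]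
  obtain ⟨q, rfl⟩ : ∃ q, p = q + 1 := ⟨p - 1, by omega⟩
  have key : y ^ (2 * q) * (1 + t) ^ μ ≤ (1 + y ^ (q + 1) * t) ^ 3 := by
    have k1 : y ^ (2 * q) ≤ (y ^ (q + 1)) ^ μ := by
      rw [← Real.rpow_natCast, ← Real.rpow_natCast, ← Real.rpow_mul hy]
      rcases hy.eq_or_lt with h0 | h0
      · rw [← h0]
        rw [Real.zero_rpow (x := ((q + 1 : ℕ) : ℝ) * μ) (by positivity)]
        rcases Nat.eq_zero_or_pos q with hq | hq
        · subst hq; push_cast at hp; linarith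
        · rw [Real.zero_rpow (by positivity)]
      · apply Real.rpow_le_rpow_of_exponent_ge h0 hy1
        push_cast at hp ⊢
        linarith
    have k2 : (y ^ (q + 1)) ^ μ * (1 + t) ^ μ = (y ^ (q + 1) * (1 + t)) ^ μ := by
      rw [Real.mul_rpow (by positivity) h1t.le]
    calc y ^ (2 * q) * (1 + t) ^ μ ≤ (y ^ (q + 1)) ^ μ * (1 + t) ^ μ := by gcongr
      _ = (y ^ (q + 1) * (1 + t)) ^ μ := k2
      _ ≤ (1 + y ^ (q + 1) * t) ^ μ := by
          apply Real.rpow_le_rpow (by positivity) _ (by linarith)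
          linarith
      _ ≤ (1 + y ^ (q + 1) * t) ^ (3:ℝ) := Real.rpow_le_rpow_of_exponent_le hd1 (by linarith)
      _ = _ := by norm_cast
  calc _ = y ^ (2 * (q + 1) + 8) * (y ^ (2 * q) * (1 + t) ^ μ) := by ring
    _ ≤ _ := mul_le_mul_of_nonneg_left key (by positivity)

set_option maxHeartbeats 1600000 in
theorem pt_main {y t h D U R ω B B3 χ μ : ℝ} {p : ℕ} (hy : 0 ≤ y) (hy1 : y ≤ 1) (ht : 0 ≤ t)
    (hμ1 : 1 < μ) (hμ2 : μ < 2) (hp : 2 ≤ p * (2 - μ)) (hh : 0 ≤ h) (hD : 0 ≤ D)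
    (hU : 1 ≤ U) (hR : 1 ≤ R) (hω : 0 ≤ ω) (hω1 : ω ≤ 1 / R) (hB : 1 ≤ B) (hB3 : 1 ≤ B3)
    (hω2 : B * B3 * (h + ω) * ω ≤ 1 / R) (hχ : χ = 1) :
    B * U * (h + ω) * (2 * y ^ (2 * p + 6 + p) * D / (1 + y ^ p * t) ^ 2 +
      B3 / R * (y ^ (2 * p + 5) + ω)) ≤
    1 / 8 * (y ^ (2 * p + 6) / (1 + y ^ p * t) * h ^ 2) +
    32 * B ^ 2 * U ^ 2 * (y ^ (2 * p + 8) * (1 + t) ^ (-μ) * D ^ 2) +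
    16 * (B * B3) ^ 2 * U ^ 2 / R ^ 2 * (y ^ 6 * (t ^ 2 / (1 + t))) +
    (16 * (B * B3) ^ 2 + 2) * U ^ 2 / R ^ 2 * χ := by
  subst hχ
  have hp0 : 0 ≤ y ^ p * t := by positivity
  set d := 1 + y ^ p * t with hd
  have hd1 : 1 ≤ d := by linarith
  have hd0 : 0 < d := by linarith
  have hR0 : 0 < R := by linarith
  set h' := h + ω with hh'
  have hy6 : y ^ (2 * p + 6) / d ≤ 1 := by
    rw [div_le_one hd0]
    exact (pow_le_one₀ hy hy1).trans hd1
  have hW0 : 0 ≤ y ^ (2 * p + 6) / d := by positivity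
  -- first term
  have t1 : B * U * h' * (2 * y ^ (2 * p + 6 + p) * D / d ^ 2) ≤
      1 / 32 * (y ^ (2 * p + 6) / d * h' ^ 2) + 32 * B ^ 2 * U ^ 2 * (y ^ (2 * p + 8) * (1 + t) ^ (-μ) * D ^ 2) := by
    have w := weight_cmp (p := p) hy hy1 ht hμ1 hμ2 hp
    rw [← hd] at w
    have e1 : B * U * h' * (2 * y ^ (2 * p + 6 + p) * D / d ^ 2) =
        y ^ (2 * p + 6) / d * (h' * (2 * B * U * y ^ p * D / d)) := by
      field_simp; ring
    have e2 : h' * (2 * B * U * y ^ p * D / d) ≤ h' ^ 2 / 32 + 8 * (2 * B * U * y ^ p * D / d) ^ 2 := by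
      nlinarith [sq_nonneg (h' - 16 * (2 * B * U * y ^ p * D / d))]
    have e3 : y ^ (2 * p + 6) / d * (8 * (2 * B * U * y ^ p * D / d) ^ 2) =
        32 * B ^ 2 * U ^ 2 * (y ^ (2 * p + 6 + 2 * p) / d ^ 3 * D ^ 2) := by
      field_simp; ring
    rw [e1]
    calc _ ≤ y ^ (2 * p + 6) / d * (h' ^ 2 / 32 + 8 * (2 * B * U * y ^ p * D / d) ^ 2) :=
          mul_le_mul_of_nonneg_left e2 hW0
      _ = 1 / 32 * (y ^ (2 * p + 6) / d * h' ^ 2) + 32 * B ^ 2 * U ^ 2 * (y ^ (2 * p + 6 + 2 * p) / d ^ 3 * D ^ 2) := by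
          rw [mul_add, e3]; ring
      _ ≤ _ := by gcongr
  have t2 : B * U * h' * (B3 / R * y ^ (2 * p + 5)) ≤
      1 / 32 * (y ^ (2 * p + 6) / d * h' ^ 2) + 8 * (B * B3) ^ 2 * U ^ 2 / R ^ 2 * (y ^ (2 * p + 4) * d) := by
    set z := B * B3 * U / R with hz
    have e1 : B * U * h' * (B3 / R * y ^ (2 * p + 5)) = y ^ (2 * p + 4) / d * ((h' * y) * (d * z)) := by
      rw [hz]; field_simp; ring
    have e2 : (h' * y) * (d * z) ≤ (h' * y) ^ 2 / 32 + 8 * (d * z) ^ 2 := by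
      nlinarith [sq_nonneg (h' * y - 16 * (d * z))]
    rw [e1]
    calc _ ≤ y ^ (2 * p + 4) / d * ((h' * y) ^ 2 / 32 + 8 * (d * z) ^ 2) :=
          mul_le_mul_of_nonneg_left e2 (by positivity)
      _ = _ := by rw [hz]; field_simp; ring
  have t3 : y ^ (2 * p + 4) * d ≤ 2 * (y ^ 6 * (t ^ 2 / (1 + t))) + 2 := by
    have a1 : y ^ (2 * p + 4) ≤ 1 := pow_le_one₀ hy hy1
    have hp2 : 2 ≤ p := by
      by_contra hcon
      have : (p:ℝ) ≤ 1 := by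
        have : p ≤ 1 := by omega
        exact_mod_cast this
      nlinarith
    have a2 : y ^ (2 * p + 4) * y ^ p ≤ y ^ 6 := by
      rw [← pow_add]; exact pow_le_pow_of_le_one hy hy1 (by omega)
    have a3 : t ≤ 1 + 2 * (t ^ 2 / (1 + t)) := by
      have : 1 + 2 * (t ^ 2 / (1 + t)) = (1 + t + 2 * t ^ 2) / (1 + t) := by field_simp
      rw [this, le_div_iff₀ (by positivity)]; nlinarith
    have a4 : y ^ 6 ≤ 1 := pow_le_one₀ hy hy1
    have a5 : 0 ≤ t ^ 2 / (1 + t) := by positivity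
    calc y ^ (2 * p + 4) * d = y ^ (2 * p + 4) + (y ^ (2 * p + 4) * y ^ p) * t := by rw [hd]; ring
      _ ≤ 1 + y ^ 6 * (1 + 2 * (t ^ 2 / (1 + t))) := by gcongr
      _ = 1 + y ^ 6 + 2 * (y ^ 6 * (t ^ 2 / (1 + t))) := by ring
      _ ≤ _ := by linarith
  have t4 : B * U * h' * (B3 / R * ω) ≤ U ^ 2 / R ^ 2 := by
    calc _ = U / R * (B * B3 * h' * ω) := by ring
      _ ≤ U / R * (1 / R) := by gcongr
      _ = U * 1 / R ^ 2 := by ring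
      _ ≤ U * U / R ^ 2 := by gcongr
      _ = _ := by ring
  have t5 : y ^ (2 * p + 6) / d * h' ^ 2 ≤ 2 * (y ^ (2 * p + 6) / d * h ^ 2) + 2 * (U ^ 2 / R ^ 2) := by
    have b1 : h' ^ 2 ≤ 2 * h ^ 2 + 2 * ω ^ 2 := by rw [hh']; nlinarith [sq_nonneg (h - ω)]
    have b2 : ω ^ 2 ≤ U ^ 2 / R ^ 2 := by
      rw [← div_pow]
      apply pow_le_pow_left₀ hω
      exact hω1.trans (by gcongr)
    calc _ ≤ y ^ (2 * p + 6) / d * (2 * h ^ 2 + 2 * ω ^ 2) := by gcongr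
      _ = 2 * (y ^ (2 * p + 6) / d * h ^ 2) + 2 * (y ^ (2 * p + 6) / d * ω ^ 2) := by ring
      _ ≤ 2 * (y ^ (2 * p + 6) / d * h ^ 2) + 2 * (1 * (U ^ 2 / R ^ 2)) := by gcongr
      _ = _ := by ring
  have t6 : 8 * (B * B3) ^ 2 * U ^ 2 / R ^ 2 * (y ^ (2 * p + 4) * d) ≤
      8 * (B * B3) ^ 2 * U ^ 2 / R ^ 2 * (2 * (y ^ 6 * (t ^ 2 / (1 + t))) + 2) := by gcongr
  have e : B * U * h' * (2 * y ^ (2 * p + 6 + p) * D / d ^ 2 + B3 / R * (y ^ (2 * p + 5) + ω)) =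
    B * U * h' * (2 * y ^ (2 * p + 6 + p) * D / d ^ 2) + B * U * h' * (B3 / R * y ^ (2 * p + 5)) +
    B * U * h' * (B3 / R * ω) := by ring
  rw [e]
  have e6 : 8 * (B * B3) ^ 2 * U ^ 2 / R ^ 2 * (2 * (y ^ 6 * (t ^ 2 / (1 + t))) + 2) =
    16 * (B * B3) ^ 2 * U ^ 2 / R ^ 2 * (y ^ 6 * (t ^ 2 / (1 + t))) + 16 * (B * B3) ^ 2 * U ^ 2 / R ^ 2 := by ring
  have e7 : (16 * (B * B3) ^ 2 + 2) * U ^ 2 / R ^ 2 * 1 = 16 * (B * B3) ^ 2 * U ^ 2 / R ^ 2 + 2 * (U ^ 2 / R ^ 2) := by ring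
  rw [e7]
  have hUR : 0 ≤ U ^ 2 / R ^ 2 := by positivity
  linarith

theorem int_le5 {f g1 g2 g3 g4 g5 : E2 → ℝ} {c1 c2 c3 c4 c5 : ℝ} (hf : Integrable f) (h1 : Integrable g1)
    (h2 : Integrable g2) (h3 : Integrable g3) (h4 : Integrable g4) (h5 : Integrable g5)
    (h : ∀ x, f x ≤ c1 * g1 x + c2 * g2 x + c3 * g3 x + c4 * g4 x + c5 * g5 x) :
    ∫ x, f x ≤ c1 * (∫ x, g1 x) + c2 * (∫ x, g2 x) + c3 * (∫ x, g3 x) + c4 * (∫ x, g4 x) +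
      c5 * (∫ x, g5 x) := by
  have i1 := h1.const_mul c1
  have i2 := i1.add (h2.const_mul c2)
  have i3 := i2.add (h3.const_mul c3)
  have i4 := i3.add (h4.const_mul c4)
  have i5 := i4.add (h5.const_mul c5)
  have e : c1 * (∫ x, g1 x) + c2 * (∫ x, g2 x) + c3 * (∫ x, g3 x) + c4 * (∫ x, g4 x) +
      c5 * (∫ x, g5 x) = ∫ x, (((((fun x => c1 * g1 x) + (fun x => c2 * g2 x)) + (fun x => c3 * g3 x)) +
        (fun x => c4 * g4 x)) + (fun x => c5 * g5 x) : E2 → ℝ) x := by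
    rw [integral_add' i4 (h5.const_mul c5), integral_add' i3 (h4.const_mul c4),
      integral_add' i2 (h3.const_mul c3), integral_add' i1 (h2.const_mul c2)]
    simp only [integral_const_mul]
  rw [e]
  exact integral_mono hf i5 h

theorem DqW_bd {p : ℕ} {R s ω K : ℝ} {ψ : E2 → ℝ} {k : Fin 2} {x : E2} (hs : 0 < s) (hR : 1 ≤ R)
    (h1 : |tt ψ (x + s • ee k) - tt ψ x| ≤ 1 / 2) (h2 : |Dq k s (eta R) x| ≤ K / R)
    (h3 : |eta R (x + s • ee k) ^ (2 * p + 5) - eta R x ^ (2 * p + 5)| ≤ ω) :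
    |Dq k s (WW p R ψ) x| ≤ 2 * eta R x ^ (2 * p + 6 + p) * √(DP2 k s ψ x) / (1 + eta R x ^ p * tt ψ x) ^ 2 +
      (2 * (2 * p + 6) * K) / R * (eta R x ^ (2 * p + 5) + ω) := by
  have he := eta_nonneg R x
  have he' := eta_nonneg R (x + s • ee k)
  have ht := tt_nonneg ψ x
  have hd := den_pos p R ψ x
  have hK0 : 0 ≤ K / R := (abs_nonneg _).trans h2
  have hw := W_diff (p := p) (Q := 2 * p + 6) he (eta_le_one R x) he' (tt_nonneg ψ x)
    (tt_nonneg ψ (x + s • ee k)) h1 (by omega)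
  have e5 : 2 * p + 6 - 1 = 2 * p + 5 := by omega
  rw [e5] at hw
  have hmax : max (eta R x) (eta R (x + s • ee k)) ^ (2 * p + 5) ≤ eta R x ^ (2 * p + 5) + ω := by
    rcases max_cases (eta R x) (eta R (x + s • ee k)) with ⟨h, _⟩ | ⟨h, _⟩
    · rw [h]; linarith [(abs_nonneg _).trans h3]
    · rw [h]; linarith [(abs_le.1 h3).2]
  have hD : |tt ψ (x + s • ee k) - tt ψ x| ≤ s * √(DP2 k s ψ x) := by
    apply abs_le_of_sq_le_sq _ (by positivity)
    rw [mul_pow, Real.sq_sqrt (by unfold DP2; positivity)]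
    have := nrm_abs_sub (LA ψ x) (LB ψ x) (LA ψ (x + s • ee k)) (LB ψ (x + s • ee k))
    refine this.trans (le_of_eq ?_)
    unfold DP2 Dq
    field_simp
  have hY : |eta R (x + s • ee k) - eta R x| = s * |Dq k s (eta R) x| := by
    unfold Dq; rw [abs_div, abs_of_pos hs]; field_simp
  have hDW : |Dq k s (WW p R ψ) x| = 1 / s * |WW p R ψ (x + s • ee k) - WW p R ψ x| := by
    unfold Dq; rw [abs_div, abs_of_pos hs]; ring
  rw [hDW]
  have hw' : |WW p R ψ (x + s • ee k) - WW p R ψ x| ≤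
      2 * eta R x ^ (2 * p + 6 + p) * (s * √(DP2 k s ψ x)) / (1 + eta R x ^ p * tt ψ x) ^ 2 +
      2 * (2 * p + 6) * (s * (K / R)) * (eta R x ^ (2 * p + 5) + ω) := by
    unfold WW
    refine hw.trans ?_
    push_cast
    rw [hY]
    gcongr
  calc _ ≤ 1 / s * (2 * eta R x ^ (2 * p + 6 + p) * (s * √(DP2 k s ψ x)) / (1 + eta R x ^ p * tt ψ x) ^ 2 +
      2 * (2 * p + 6) * (s * (K / R)) * (eta R x ^ (2 * p + 5) + ω)) :=
        mul_le_mul_of_nonneg_left hw' (by positivity)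
    _ = _ := by field_simp

theorem prod_close {a b a' b' L ω : ℝ} (ha : |a| ≤ L) (hb : |b| ≤ L) (h1 : |a' - a| ≤ ω) (h2 : |b' - b| ≤ ω)
    (hω : ω ≤ 1) : |a * b - a' * b'| ≤ (2 * L + 1) * ω := by
  have hL : 0 ≤ L := (abs_nonneg _).trans ha
  have hw : 0 ≤ ω := (abs_nonneg _).trans h1
  have e : a * b - a' * b' = -((a' - a) * b) - a * (b' - b) - (a' - a) * (b' - b) := by ring
  have q1 : |(a' - a) * b| ≤ ω * L := by rw [abs_mul]; gcongr
  have q2 : |a * (b' - b)| ≤ L * ω := by rw [abs_mul]; gcongr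
  have q3 : |(a' - a) * (b' - b)| ≤ ω * 1 := by rw [abs_mul]; gcongr; linarith
  rw [e]
  rw [abs_le] at *
  constructor <;> linarith

theorem dd_le_HH {ψ : E2 → ℝ} (hψ : ContDiff ℝ 2 ψ) (j k : Fin 2) (x : E2) :
    |dd j (dd k ψ) x| ≤ √(HH ψ x) := by
  apply Real.abs_le_sqrt
  have hs := dd_symm hψ 0 1 x
  unfold HH
  fin_cases j <;> fin_cases k <;> simp only [Fin.zero_eta, Fin.mk_one, Fin.isValue] <;>
    (try rw [← hs]) <;> nlinarith [sq_nonneg (dd 0 (dd 0 ψ) x), sq_nonneg (dd 1 (dd 1 ψ) x), sq_nonneg (dd 0 (dd 1 ψ) x)]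

theorem HH_bdd {ψ : E2 → ℝ} (hψ : ContDiff ℝ 2 ψ) (r : ℝ) :
    ∃ L : ℝ, 0 ≤ L ∧ ∀ x : E2, ‖x‖ ≤ r → √(HH ψ x) ≤ L := by
  have hc : Continuous (fun x => √(HH ψ x)) := (HH_cont hψ).sqrt
  obtain ⟨L, hL⟩ := (isCompact_closedBall (0 : E2) r).exists_bound_of_continuousOn hc.continuousOn
  refine ⟨max L 0, le_max_right _ _, fun x hx => ?_⟩
  have := hL x (by simpa using hx)
  rw [Real.norm_eq_abs] at this
  exact (le_abs_self _).trans (this.trans (le_max_left _ _))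

/-- The smallness facts at a fixed step `s`. -/
structure Sm (p : ℕ) (ψ : E2 → ℝ) (R U B K ω L s : ℝ) : Prop where
  s0 : 0 < s
  s1 : s ≤ 1
  ft : ∀ k x, ‖x‖ ≤ 3 * R → |tt ψ (x + s • ee k) - tt ψ x| ≤ 1 / 2
  fu : ∀ k x, ‖x‖ ≤ 3 * R → |dd 0 ψ (x + s • ee k)| ≤ B * U
  fe : ∀ k x, ‖x‖ ≤ 3 * R → |Dq k s (eta R) x| ≤ K / R
  f5 : ∀ k x, ‖x‖ ≤ 3 * R → |eta R (x + s • ee k) ^ (2 * p + 5) - eta R x ^ (2 * p + 5)| ≤ ω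
  fp : ∀ k x, ‖x‖ ≤ 3 * R → |Dq k s (dd 0 ψ) x - dd k (dd 0 ψ) x| ≤ ω
  fq : ∀ k x, ‖x‖ ≤ 3 * R → |Dq k (-s) (dd 1 ψ) x - dd k (dd 1 ψ) x| ≤ ω
  L0 : 0 ≤ L
  hL : ∀ x, ‖x‖ ≤ 3 * R → √(HH ψ x) ≤ L

theorem shift_norm {s : ℝ} (h0 : 0 < s) (h1 : s ≤ 1) (k : Fin 2) {x : E2} {R : ℝ} (hR : 1 ≤ R)
    (hx : 3 * R ≤ ‖x‖) : 2 * R ≤ ‖x + s • ee k‖ := by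
  have h2 : ‖s • ee k‖ = s := by rw [norm_smul, norm_ee, mul_one, Real.norm_eq_abs, abs_of_pos h0]
  have h3 : ‖x‖ ≤ ‖x + s • ee k‖ + ‖s • ee k‖ := by
    have := norm_sub_le (x + s • ee k) (s • ee k)
    simpa using this
  linarith

theorem DqW_zero {p : ℕ} {R s : ℝ} {ψ : E2 → ℝ} (h0 : 0 < s) (h1 : s ≤ 1) (k : Fin 2) {x : E2} (hR : 1 ≤ R)
    (hx : 3 * R ≤ ‖x‖) : Dq k s (WW p R ψ) x = 0 := by
  unfold Dq
  rw [WW_zero p hR ψ (shift_norm h0 h1 k hR hx), WW_zero p hR ψ (by linarith)]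
  simp

theorem term_bd {p : ℕ} {ψ : E2 → ℝ} {R U B K ω L s μ : ℝ} (hψ : ContDiff ℝ 2 ψ)
    (hμ1 : 1 < μ) (hμ2 : μ < 2) (hp : 2 ≤ p * (2 - μ)) (hR : 1 ≤ R) (hU : 1 ≤ U) (hB : 1 ≤ B) (hK : 1 ≤ K)
    (hS : Sm p ψ R U B K ω L s) (hω : ω = 1 / (B * (2 * (2 * p + 6) * K) * (2 * L + 2) * R ^ 2))
    (j k : Fin 2) (x : E2) :
    |dd 0 ψ (x + s • ee j) * Dq k (-s) (dd 1 ψ) x * Dq j s (WW p R ψ) x| ≤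
      1 / 8 * (WW p R ψ x * HH ψ x) +
      32 * B ^ 2 * U ^ 2 * (eta R x ^ (2 * p + 8) * (1 + tt ψ x) ^ (-μ) * DP2 j s ψ x) +
      16 * (B * (2 * (2 * p + 6) * K)) ^ 2 * U ^ 2 / R ^ 2 * (eta R x ^ 6 * (tt ψ x ^ 2 / (1 + tt ψ x))) +
      (16 * (B * (2 * (2 * p + 6) * K)) ^ 2 + 2) * U ^ 2 / R ^ 2 * eta (2 * (2 * R)) x := by
  have hη := eta_nonneg R x
  have ht := tt_nonneg ψ x
  have hD2 : 0 ≤ DP2 j s ψ x := by unfold DP2; positivity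
  by_cases hx : 3 * R ≤ ‖x‖
  · rw [DqW_zero hS.s0 hS.s1 j hR hx, mul_zero, abs_zero]
    have a1 := WW_nonneg p R ψ x
    have a2 := HH_nonneg ψ x
    have a3 := eta_nonneg (2 * (2 * R)) x
    positivity
  · have hx' : ‖x‖ ≤ 3 * R := (not_le.1 hx).le
    have hL0 := hS.L0
    set B3 : ℝ := 2 * (2 * p + 6) * K with hB3d
    have hB3 : 1 ≤ B3 := by
      rw [hB3d]
      have : (0:ℝ) ≤ p := by positivity
      nlinarith
    have hBB : 1 ≤ B * B3 := by nlinarith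
    have hω0 : 0 ≤ ω := by rw [hω]; positivity
    have hω1 : ω ≤ 1 / R := by
      rw [hω]
      apply one_div_le_one_div_of_le (by linarith)
      have : 1 ≤ B * B3 * (2 * L + 2) := by nlinarith
      nlinarith
    have hωle1 : ω ≤ 1 := hω1.trans (by rw [div_le_one (by linarith)]; exact hR)
    have hh := hS.hL x hx'
    have hω2 : B * B3 * (√(HH ψ x) + ω) * ω ≤ 1 / R := by
      calc B * B3 * (√(HH ψ x) + ω) * ω ≤ B * B3 * (L + 1) * ω := by gcongr
        _ = 1 / (2 * R ^ 2) := by rw [hω]; field_simp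
        _ ≤ 1 / R := by
          apply one_div_le_one_div_of_le (by linarith)
          nlinarith
    have m := pt_main (y := eta R x) (t := tt ψ x) (h := √(HH ψ x)) (D := √(DP2 j s ψ x)) (χ := eta (2 * (2 * R)) x)
      hη (eta_le_one R x) ht hμ1 hμ2 hp (Real.sqrt_nonneg _) (Real.sqrt_nonneg _) hU hR hω0 hω1 hB hB3 hω2
      (eta2_one (by linarith) (by linarith))
    rw [Real.sq_sqrt hD2, Real.sq_sqrt (HH_nonneg ψ x)] at m
    refine le_trans ?_ m
    have w := DqW_bd hS.s0 hR (hS.ft j x hx') (hS.fe j x hx') (hS.f5 j x hx')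
    rw [← hB3d] at w
    have q : |Dq k (-s) (dd 1 ψ) x| ≤ √(HH ψ x) + ω := by
      have q1 := hS.fq k x hx'
      have q2 := dd_le_HH hψ k 1 x
      rw [abs_le] at *
      constructor <;> linarith
    rw [abs_mul, abs_mul]
    exact mul_le_mul (mul_le_mul (hS.fu j x hx') q (abs_nonneg _) (by positivity)) w (abs_nonneg _) (by positivity)

theorem det_id {ψ : E2 → ℝ} (hψ : ContDiff ℝ 2 ψ) (x : E2) :
    HH ψ x = 4 * tt ψ x ^ 2 + 2 * (dd 0 (dd 0 ψ) x * dd 1 (dd 1 ψ) x - dd 1 (dd 0 ψ) x * dd 0 (dd 1 ψ) x) := by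
  have hs := dd_symm hψ 0 1 x
  unfold tt HH
  rw [nrm_sq]
  unfold LA LB
  rw [← hs]
  ring

theorem J_pt {p : ℕ} {ψ : E2 → ℝ} {R U B K ω L s : ℝ} (hψ : ContDiff ℝ 2 ψ)
    (hR : 1 ≤ R) (hB : 1 ≤ B) (hK : 1 ≤ K)
    (hS : Sm p ψ R U B K ω L s) (hω : ω = 1 / (B * (2 * (2 * p + 6) * K) * (2 * L + 2) * R ^ 2))
    (x : E2) :
    WW p R ψ x * HH ψ x ≤ 4 * (eta R x ^ 6 * (tt ψ x ^ 2 / (1 + tt ψ x))) +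
      2 * ((Dq 0 s (dd 0 ψ) x * Dq 1 (-s) (dd 1 ψ) x - Dq 1 s (dd 0 ψ) x * Dq 0 (-s) (dd 1 ψ) x) * WW p R ψ x) +
      4 / R ^ 2 * eta (2 * (2 * R)) x := by
  have hη := eta_nonneg R x
  have hη1 := eta_le_one R x
  have ht := tt_nonneg ψ x
  by_cases hx : 3 * R ≤ ‖x‖
  · rw [WW_zero p hR ψ (by linarith)]
    have a3 := eta_nonneg (2 * (2 * R)) x
    rw [zero_mul, mul_zero]
    positivity
  · have hx' : ‖x‖ ≤ 3 * R := (not_le.1 hx).le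
    rw [eta2_one (R := 2 * R) (by linarith) (by linarith)]
    have hL0 := hS.L0
    have hωL : (4 * L + 2) * ω ≤ 2 / R ^ 2 := by
      have hB3 : (1:ℝ) ≤ 2 * (2 * p + 6) * K := by
        have : (0:ℝ) ≤ p := by positivity
        nlinarith
      have hBB : 1 ≤ B * (2 * (2 * p + 6) * K) := by nlinarith
      rw [hω, mul_one_div]
      calc (4 * L + 2) / (B * (2 * (2 * p + 6) * K) * (2 * L + 2) * R ^ 2)
          ≤ (4 * L + 4) / (1 * (2 * L + 2) * R ^ 2) := by gcongr; norm_num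
        _ = 2 / R ^ 2 := by field_simp; norm_num
    have hω1 : ω ≤ 1 := by
      have : 2 / R ^ 2 ≤ 2 := by
        rw [div_le_iff₀ (by positivity)]; nlinarith
      have hω0 : 0 ≤ ω := by rw [hω]; positivity
      nlinarith
    have d1 := prod_close ((dd_le_HH hψ 0 0 x).trans (hS.hL x hx')) ((dd_le_HH hψ 1 1 x).trans (hS.hL x hx'))
      (hS.fp 0 x hx') (hS.fq 1 x hx') hω1
    have d2 := prod_close ((dd_le_HH hψ 1 0 x).trans (hS.hL x hx')) ((dd_le_HH hψ 0 1 x).trans (hS.hL x hx'))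
      (hS.fp 1 x hx') (hS.fq 0 x hx') hω1
    have hW0 := WW_nonneg p R ψ x
    have hden := den_pos p R ψ x
    have hW1 : WW p R ψ x ≤ 1 := by
      unfold WW
      rw [div_le_one hden]
      have : eta R x ^ (2 * p + 6) ≤ 1 := pow_le_one₀ hη hη1
      have : 0 ≤ eta R x ^ p * tt ψ x := by positivity
      linarith
    have hWt : WW p R ψ x * tt ψ x ^ 2 ≤ eta R x ^ 6 * (tt ψ x ^ 2 / (1 + tt ψ x)) := by
      have h1 : WW p R ψ x ≤ eta R x ^ 6 / (1 + tt ψ x) := by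
        unfold WW
        rw [div_le_div_iff₀ hden (by positivity)]
        have hp1 : eta R x ^ p ≤ 1 := pow_le_one₀ hη hη1
        have e : eta R x ^ (2 * p + 6) = eta R x ^ 6 * eta R x ^ p * eta R x ^ p := by ring
        rw [e]
        have h2 : eta R x ^ p * (1 + tt ψ x) ≤ 1 + eta R x ^ p * tt ψ x := by nlinarith
        have h3 : eta R x ^ 6 * eta R x ^ p ≤ eta R x ^ 6 := by
          have : 0 ≤ eta R x ^ 6 := by positivity
          nlinarith
        calc eta R x ^ 6 * eta R x ^ p * eta R x ^ p * (1 + tt ψ x)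
            = (eta R x ^ 6 * eta R x ^ p) * (eta R x ^ p * (1 + tt ψ x)) := by ring
          _ ≤ eta R x ^ 6 * (1 + eta R x ^ p * tt ψ x) := by gcongr
      calc _ ≤ eta R x ^ 6 / (1 + tt ψ x) * tt ψ x ^ 2 := by gcongr
        _ = _ := by ring
    rw [det_id hψ x]
    set a := dd 0 (dd 0 ψ) x * dd 1 (dd 1 ψ) x
    set a' := Dq 0 s (dd 0 ψ) x * Dq 1 (-s) (dd 1 ψ) x
    set b := dd 1 (dd 0 ψ) x * dd 0 (dd 1 ψ) x
    set b' := Dq 1 s (dd 0 ψ) x * Dq 0 (-s) (dd 1 ψ) x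
    have hd : (a - b) - (a' - b') ≤ 2 / R ^ 2 := by
      have e1 := (abs_le.1 d1).2
      have e2 := (abs_le.1 d2).1
      linarith
    have h5 : WW p R ψ x * ((a - b) - (a' - b')) ≤ 2 / R ^ 2 := by
      have h6 : 0 ≤ 2 / R ^ 2 := by positivity
      calc _ ≤ WW p R ψ x * (2 / R ^ 2) := by gcongr
        _ ≤ 1 * (2 / R ^ 2) := by gcongr
        _ = _ := one_mul _
    have e4 : 4 / R ^ 2 * (1:ℝ) = 2 * (2 / R ^ 2) := by ring
    rw [e4]
    nlinarith

theorem WW_compact (p : ℕ) {R : ℝ} (hR : 1 ≤ R) (ψ : E2 → ℝ) : HasCompactSupport (WW p R ψ) := by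
  apply HasCompactSupport.intro (isCompact_closedBall (0 : E2) (2 * R))
  intro x hx
  apply WW_zero p hR
  simp at hx
  exact hx.le

theorem J_det {p : ℕ} {ψ : E2 → ℝ} {R U B K ω L s μ V : ℝ} (hψ : ContDiff ℝ 2 ψ)
    (hμ1 : 1 < μ) (hμ2 : μ < 2) (hp : 2 ≤ p * (2 - μ)) (hR : 1 ≤ R) (hU : 1 ≤ U) (hB : 1 ≤ B) (hK : 1 ≤ K)
    (hS : Sm p ψ R U B K ω L s) (hω : ω = 1 / (B * (2 * (2 * p + 6) * K) * (2 * L + 2) * R ^ 2))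
    (Ei : Integrable (fun x => eta R x ^ 6 * (tt ψ x ^ 2 / (1 + tt ψ x)))) :
    ∫ x, (Dq 0 s (dd 0 ψ) x * Dq 1 (-s) (dd 1 ψ) x - Dq 1 s (dd 0 ψ) x * Dq 0 (-s) (dd 1 ψ) x) * WW p R ψ x ≤
      1 / 4 * JJ p R ψ + 32 * B ^ 2 * U ^ 2 * XX μ p R ψ 0 s + 32 * B ^ 2 * U ^ 2 * XX μ p R ψ 1 s +
      2 * (16 * (B * (2 * (2 * p + 6) * K)) ^ 2 * U ^ 2 / R ^ 2) * (∫ x, eta R x ^ 6 * (tt ψ x ^ 2 / (1 + tt ψ x))) +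
      2 * ((16 * (B * (2 * (2 * p + 6) * K)) ^ 2 + 2) * U ^ 2 / R ^ 2) * ∫ x, eta (2 * (2 * R)) x := by
  have c0 : Continuous (dd 0 ψ) := (dd_c1 hψ).continuous
  have c1 : Continuous (dd 1 ψ) := (dd_c1 hψ).continuous
  have cW := WW_cont p R hψ
  rw [det_disc c0 c1 cW (WW_compact p hR ψ) hS.s0.ne', ← integral_neg]
  have q0 : Continuous (Dq 0 s (WW p R ψ)) := Dq_cont cW
  have q1 : Continuous (Dq 1 s (WW p R ψ)) := Dq_cont cW
  have q2 : Continuous (Dq 0 (-s) (dd 1 ψ)) := Dq_cont c1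
  have q3 : Continuous (Dq 1 (-s) (dd 1 ψ)) := Dq_cont c1
  unfold JJ XX
  apply int_le5
  · apply int_of_zero (R := 3 * R)
    · fun_prop
    · intro x hx
      rw [DqW_zero hS.s0 hS.s1 0 hR hx, DqW_zero hS.s0 hS.s1 1 hR hx]
      simp
  · exact WH_int p hR hψ
  · exact X_int μ p hR hψ 0 s
  · exact X_int μ p hR hψ 1 s
  · exact Ei
  · exact eta2_int (by linarith)
  · intro x
    have t0 := term_bd hψ hμ1 hμ2 hp hR hU hB hK hS hω 0 1 x
    have t1 := term_bd hψ hμ1 hμ2 hp hR hU hB hK hS hω 1 0 x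
    have t0' := (abs_le.1 t0).1
    have t1' := (abs_le.1 t1).2
    linarith

set_option maxHeartbeats 1000000 in
theorem stepII {g : ℝ → ℝ} {c C μ : ℝ} (hg : Adm g c C μ) {M : ℝ} (hM : 1 ≤ M) (p : ℕ)
    (hμ1 : 1 < μ) (hμ2 : μ < 2) (hp : 2 ≤ p * (2 - μ)) :
    ∃ C₂ : ℝ, 1 ≤ C₂ ∧ ∀ R U : ℝ, 1 ≤ R → 1 ≤ U → U ≤ R → ∀ ψ, Sol g ψ → Bd ψ M R U →
      ∀ᶠ s in nhdsWithin (0:ℝ) (Set.Ioi 0),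
        JJ p R ψ ≤ C₂ * U ^ 2 + C₂ * U ^ 2 * (XX μ p R ψ 0 s + XX μ p R ψ 1 s) := by
  obtain ⟨K, hK, hbd⟩ := eta_bounds
  obtain ⟨V, hV, hvol⟩ := eta_vol
  obtain ⟨CE, hCE, hen⟩ := energy hg hM
  set B : ℝ := M + 1 with hBd
  set Q : ℝ := (B * (2 * (2 * p + 6) * (K + 1))) ^ 2 with hQ
  have hQ0 : 0 ≤ Q := by positivity
  have hB : 1 ≤ B := by linarith
  set C₂ : ℝ := 8 * CE + 128 * Q * CE + 32 * V * (16 * Q + 2) + 32 * V + 128 * B ^ 2 with hC₂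
  refine ⟨C₂, ?_, ?_⟩
  · have : 0 ≤ 128 * Q * CE := by positivity
    have : 0 ≤ 32 * V * (16 * Q + 2) := by positivity
    have : 0 ≤ 128 * B ^ 2 := by positivity
    linarith
  intro R U hR hU hUR ψ hS hBd'
  have hψ := hS.c2
  obtain ⟨L, hL0, hL⟩ := HH_bdd hψ (3 * R)
  set ω : ℝ := 1 / (B * (2 * (2 * p + 6) * (K + 1)) * (2 * L + 2) * R ^ 2) with hω
  have hω0 : 0 < ω := by positivity
  have e1 := ev_shift (tt_cont hψ) (3 * R) (ω := 1 / 2) (by norm_num)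
  have e2 := ev_shift (dd_c1 hψ (k := 0)).continuous (3 * R) (ω := 1) (by norm_num)
  have e3 := ev_Dq (eta_c1 R) (3 * R) (ω := 1 / R) (by positivity)
  have e4 := ev_shift ((eta_cont R).pow (2 * p + 5)) (3 * R) hω0
  have e5 := ev_Dq (dd_c1 hψ (k := 0)) (3 * R) hω0
  have e6 := ev_Dq (dd_c1 hψ (k := 1)) (3 * R) hω0
  have e7 : ∀ᶠ s in nhdsWithin (0:ℝ) (Set.Ioi 0), s ∈ Set.Ioo (0:ℝ) 1 := Ioo_mem_nhdsGT one_pos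
  filter_upwards [e1, e2, e3, e4, e5, e6, e7] with s f1 f2 f3 f4 f5 f6 f7
  have sm : Sm p ψ R U B (K + 1) ω L s := by
    refine ⟨f7.1, f7.2.le, f1, ?_, ?_, f4, fun k x hx => (f5 k x hx).1, fun k x hx => (f6 k x hx).2, hL0, hL⟩
    · intro k x hx
      have a := f2 k x hx
      have b := hBd'.d 0 x hx
      have : M * U + 1 ≤ B * U := by rw [hBd]; linarith
      rw [abs_le] at *
      constructor <;> linarith
    · intro k x hx
      have a := (f3 k x hx).1
      have b := (hbd R hR x).1 k
      rw [add_div]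
      rw [abs_le] at *
      constructor <;> linarith
  have Ei : Integrable (fun x => eta R x ^ 6 * (tt ψ x ^ 2 / (1 + tt ψ x))) := by
    apply int_of_zero (R := 2 * R)
    · have h1 := eta_cont R
      have h2 := tt_cont hψ
      exact (h1.pow _).mul ((h2.pow _).div (by fun_prop) (fun x => by have := tt_nonneg ψ x; positivity))
    · intro x hx
      simp [eta_zero (by linarith) hx]
  have jd := J_det (V := V) hψ hμ1 hμ2 hp hR hU hB (by linarith) sm hω Ei
  rw [← hQ] at jd
  have χi : Integrable (eta (2 * (2 * R))) := eta2_int (by linarith)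
  have Di : Integrable (fun x => (Dq 0 s (dd 0 ψ) x * Dq 1 (-s) (dd 1 ψ) x -
      Dq 1 s (dd 0 ψ) x * Dq 0 (-s) (dd 1 ψ) x) * WW p R ψ x) := by
    have c0 : Continuous (dd 0 ψ) := (dd_c1 hψ).continuous
    have c1 : Continuous (dd 1 ψ) := (dd_c1 hψ).continuous
    have cW := WW_cont p R hψ
    have q0 : Continuous (Dq 0 s (dd 0 ψ)) := Dq_cont c0
    have q1 : Continuous (Dq 1 s (dd 0 ψ)) := Dq_cont c0
    have q2 : Continuous (Dq 0 (-s) (dd 1 ψ)) := Dq_cont c1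
    have q3 : Continuous (Dq 1 (-s) (dd 1 ψ)) := Dq_cont c1
    apply int_of_zero (R := 2 * R)
    · fun_prop
    · intro x hx
      rw [WW_zero p hR ψ hx, mul_zero]
  have jp := int_le5 (c1 := 4) (c2 := 2) (c3 := 4 / R ^ 2) (c4 := 0) (c5 := 0)
    (WH_int p hR hψ) Ei Di χi χi χi (fun x => by
      have := J_pt hψ hR hB (by linarith) sm hω x
      rw [zero_mul, add_zero, add_zero]; exact this)
  have hE := hen R U hR hU ψ hS hBd'
  have hχ := hvol (2 * R) (by linarith)
  have hχ0 : 0 ≤ ∫ x, eta (2 * (2 * R)) x := integral_nonneg (fun x => eta_nonneg _ x)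
  change JJ p R ψ ≤ _ at jp
  set E := ∫ x, eta R x ^ 6 * (tt ψ x ^ 2 / (1 + tt ψ x))
  set X := ∫ x, eta (2 * (2 * R)) x
  have hE0 : 0 ≤ E := integral_nonneg (fun x => by
    have := tt_nonneg ψ x
    have := eta_nonneg R x
    change 0 ≤ eta R x ^ 6 * (tt ψ x ^ 2 / (1 + tt ψ x))
    positivity)
  have hU2 : U ^ 2 / R ^ 2 ≤ 1 := by
    rw [div_le_one (by positivity)]; gcongr
  have hX4 : X / R ^ 2 ≤ 4 * V := by
    rw [div_le_iff₀ (by positivity)]; linarith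
  have b1 : 2 * (16 * Q * U ^ 2 / R ^ 2) * E ≤ 32 * Q * (CE * U ^ 2) := by
    calc 2 * (16 * Q * U ^ 2 / R ^ 2) * E = 32 * Q * ((U ^ 2 / R ^ 2) * E) := by ring
      _ ≤ 32 * Q * (1 * (CE * U ^ 2)) := by gcongr
      _ = _ := by ring
  have b2 : 2 * ((16 * Q + 2) * U ^ 2 / R ^ 2) * X ≤ 2 * (16 * Q + 2) * U ^ 2 * (4 * V) := by
    calc 2 * ((16 * Q + 2) * U ^ 2 / R ^ 2) * X = 2 * (16 * Q + 2) * U ^ 2 * (X / R ^ 2) := by ring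
      _ ≤ _ := by gcongr
  have b3 : 4 / R ^ 2 * X ≤ 16 * V * U ^ 2 := by
    calc 4 / R ^ 2 * X = 4 * (X / R ^ 2) := by ring
      _ ≤ 4 * (4 * V) := by gcongr
      _ ≤ _ := by
        have hU1 : 1 ≤ U ^ 2 := one_le_pow₀ hU
        have := mul_le_mul_of_nonneg_left hU1 (by linarith : 0 ≤ 16 * V)
        linarith
  have hX0 : 0 ≤ XX μ p R ψ 0 s + XX μ p R ψ 1 s := by
    have : ∀ k, 0 ≤ XX μ p R ψ k s := fun k => integral_nonneg (fun x => by
      have := tt_nonneg ψ x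
      have := eta_nonneg R x
      change 0 ≤ eta R x ^ (2 * p + 8) * (1 + tt ψ x) ^ (-μ) * DP2 k s ψ x
      unfold DP2
      positivity)
    exact add_nonneg (this 0) (this 1)
  set X01 := XX μ p R ψ 0 s + XX μ p R ψ 1 s with hX01
  have fin1 : JJ p R ψ ≤ (8 * CE + 128 * Q * CE + 32 * V * (16 * Q + 2) + 32 * V) * U ^ 2 +
      128 * B ^ 2 * U ^ 2 * X01 := by
    rw [hX01]
    linarith
  refine fin1.trans ?_
  have : 0 ≤ 128 * Q * CE := by positivity
  have : 0 ≤ 32 * V * (16 * Q + 2) := by positivity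
  have : 0 ≤ 128 * B ^ 2 := by positivity
  have g1 : 8 * CE + 128 * Q * CE + 32 * V * (16 * Q + 2) + 32 * V ≤ C₂ := by rw [hC₂]; linarith
  have g2 : 128 * B ^ 2 ≤ C₂ := by rw [hC₂]; linarith
  gcongr

theorem combine {g : ℝ → ℝ} {c C μ : ℝ} (hg : Adm g c C μ) {M : ℝ} (hM : 1 ≤ M) (p : ℕ)
    (hμ1 : 1 < μ) (hμ2 : μ < 2) (hp : 2 ≤ p * (2 - μ)) :
    ∃ C₃ : ℝ, 1 ≤ C₃ ∧ ∀ R U : ℝ, 1 ≤ R → 1 ≤ U → C₃ * U ^ 2 ≤ R ^ 2 → ∀ ψ, Sol g ψ → Bd ψ M R U →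
      ∀ᶠ s in nhdsWithin (0:ℝ) (Set.Ioi 0), ∀ k, XX μ p R ψ k s ≤ C₃ * U ^ 2 / R ^ 2 := by
  obtain ⟨C₁, hC1, h1⟩ := stepI hg hM p
  obtain ⟨C₂, hC2, h2⟩ := stepII hg hM p hμ1 hμ2 hp
  have hCC : 1 ≤ C₁ * C₂ := by nlinarith
  refine ⟨4 * (C₁ * C₂), by linarith, ?_⟩
  intro R U hR hU hUR ψ hS hB
  have hUR' : U ≤ R := by
    have : U ^ 2 ≤ R ^ 2 := by nlinarith [sq_nonneg U]
    exact le_of_sq_le_sq this (by linarith)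
  filter_upwards [h1 R U hR hU ψ hS hB, h2 R U hR hU hUR' ψ hS hB] with s e1 e2 k
  have hR2 : 0 < R ^ 2 := by positivity
  have hU1 : 1 ≤ U ^ 2 := one_le_pow₀ hU
  have hJ0 : 0 ≤ JJ p R ψ := integral_nonneg (fun x => mul_nonneg (WW_nonneg p R ψ x) (HH_nonneg ψ x))
  have hq : C₁ * C₂ * (U ^ 2 / R ^ 2) ≤ 1 / 4 := by
    rw [← mul_div_assoc, div_le_iff₀ hR2]; linarith
  have hs : XX μ p R ψ 0 s + XX μ p R ψ 1 s ≤ 2 * (C₁ / R ^ 2 * JJ p R ψ + C₁ * U ^ 2 / R ^ 2) := by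
    linarith [e1 0, e1 1]
  have hJ : JJ p R ψ ≤ C₂ * U ^ 2 + 2 * (C₁ * C₂ * (U ^ 2 / R ^ 2)) * (JJ p R ψ + U ^ 2) := by
    calc JJ p R ψ ≤ C₂ * U ^ 2 + C₂ * U ^ 2 * (2 * (C₁ / R ^ 2 * JJ p R ψ + C₁ * U ^ 2 / R ^ 2)) := by
          refine e2.trans ?_; gcongr
      _ = _ := by ring
  have hJ2 : JJ p R ψ ≤ 3 * C₂ * U ^ 2 := by
    have a : 2 * (C₁ * C₂ * (U ^ 2 / R ^ 2)) * (JJ p R ψ + U ^ 2) ≤ 2 * (1 / 4) * (JJ p R ψ + U ^ 2) := by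
      gcongr
    have b : U ^ 2 ≤ C₂ * U ^ 2 := by nlinarith
    linarith
  calc XX μ p R ψ k s ≤ C₁ / R ^ 2 * JJ p R ψ + C₁ * U ^ 2 / R ^ 2 := e1 k
    _ ≤ C₁ / R ^ 2 * (3 * C₂ * U ^ 2) + C₁ * C₂ * U ^ 2 / R ^ 2 := by
      gcongr
      nlinarith
    _ = _ := by ring

theorem tele {f : E2 → ℝ} (hf : Continuous f) {r T R' s : ℝ} (hr : 1 ≤ r) (hT : 0 ≤ T) (hR : 2 * r + T ≤ R')
    (k : Fin 2) (hs : 0 < s) : ∀ j : ℕ, j * s ≤ T →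
      ∫ x, eta r x * |f (x + (j * s) • ee k) - f x| ≤ j * s * ∫ x, eta R' x * |Dq k s f x| := by
  have hinteg : ∀ a b : E2, Integrable (fun x => eta r x * |f (x + a) - f (x + b)|) := fun a b => by
    apply int_of_zero (R := 2 * r)
    · have := eta_cont r
      fun_prop
    · intro x hx; rw [eta_zero (by linarith) hx, zero_mul]
  have hintR : Integrable (fun x => eta R' x * |Dq k s f x|) := by
    apply int_of_zero (R := 2 * R')
    · have := eta_cont R'
      have h2 : Continuous (Dq k s f) := Dq_cont hf
      fun_prop
    · intro x hx; rw [eta_zero (by linarith) hx, zero_mul]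
  intro j
  induction j with
  | zero => intro _; simp
  | succ j ih =>
    intro hj
    push_cast at hj ⊢
    have hj' : j * s ≤ T := by linarith
    have hjs : 0 ≤ j * s := by positivity
    have I := ih hj'
    set a : E2 := (j * s) • ee k with ha
    have e : ((j + 1) * s) • ee k = a + s • ee k := by rw [ha, ← add_smul]; ring_nf
    have h1 : ∫ x, eta r x * |f (x + ((j + 1) * s) • ee k) - f x| ≤
        (∫ x, eta r x * |f (x + a) - f x|) + ∫ x, eta r x * |f (x + (a + s • ee k)) - f (x + a)| := by
      have i1 := hinteg a 0
      simp only [add_zero] at i1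
      rw [← integral_add i1 (hinteg _ _)]
      apply integral_mono
      · have := hinteg ((((j:ℝ) + 1) * s) • ee k) 0
        simpa only [add_zero] using this
      · exact i1.add (hinteg _ _)
      · intro x
        change _ ≤ eta r x * |f (x + a) - f x| + eta r x * |f (x + (a + s • ee k)) - f (x + a)|
        rw [← mul_add]
        change eta r x * _ ≤ _
        rw [e]
        apply mul_le_mul_of_nonneg_left _ (eta_nonneg r x)
        have := abs_add_le (f (x + a) - f x) (f (x + (a + s • ee k)) - f (x + a))
        rw [add_comm, sub_add_sub_cancel] at this
        linarith
    have h2 : ∫ x, eta r x * |f (x + (a + s • ee k)) - f (x + a)| ≤ s * ∫ x, eta R' x * |Dq k s f x| := by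
      have e2 : ∫ x, eta r x * |f (x + (a + s • ee k)) - f (x + a)| =
          ∫ y, eta r (y - a) * |f (y + s • ee k) - f y| := by
        rw [← integral_add_right_eq_self (fun y => eta r (y - a) * |f (y + s • ee k) - f y|) a]
        simp only [add_sub_cancel_right, add_assoc]
      rw [e2, ← integral_const_mul]
      apply integral_mono
      · have := (hinteg (a + s • ee k) a).comp_sub_right a
        refine this.congr (Eventually.of_forall fun y => ?_)
        simp only []
        congr 3
        · congr 1; abel
        · congr 1; abel
      · exact hintR.const_mul s
      · intro y
        change eta r (y - a) * |f (y + s • ee k) - f y| ≤ s * (eta R' y * |Dq k s f y|)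
        have e3 : |f (y + s • ee k) - f y| = s * |Dq k s f y| := by
          unfold Dq; rw [abs_div, abs_of_pos hs]; field_simp
        rw [e3]
        have hle : eta r (y - a) ≤ eta R' y := by
          by_cases hy : 2 * r ≤ ‖y - a‖
          · rw [eta_zero (by linarith) hy]; exact eta_nonneg _ _
          · have na : ‖a‖ ≤ T := by
              rw [ha, norm_smul, norm_ee, mul_one, Real.norm_eq_abs, abs_of_nonneg hjs]; exact hj'
            have : ‖y‖ ≤ ‖y - a‖ + ‖a‖ := by
              have := norm_add_le (y - a) a
              simpa using this
            rw [eta_one (R := R') (by linarith) (by linarith)]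
            exact eta_le_one _ _
        calc eta r (y - a) * (s * |Dq k s f y|) ≤ eta R' y * (s * |Dq k s f y|) := by gcongr
          _ = _ := by ring
    linarith

theorem const_shift {ψ : E2 → ℝ} (hψ : ContDiff ℝ 2 ψ) {f : E2 → ℝ} (hf : Continuous f) {μ : ℝ} {p : ℕ}
    (hμ : 0 < μ) (hfD : ∀ k s x, Dq k s f x ^ 2 ≤ DP2 k s ψ x)
    (hX : ∀ δ > 0, ∀ R0 : ℝ, ∃ R ≥ R0, 1 ≤ R ∧ ∀ᶠ s in nhdsWithin (0:ℝ) (Set.Ioi 0), ∀ k, XX μ p R ψ k s ≤ δ)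
    (k : Fin 2) {T : ℝ} (hT : 0 < T) (x₀ : E2) : f (x₀ + T • ee k) = f x₀ := by
  set r : ℝ := 1 + ‖x₀‖ with hr
  have hr1 : 1 ≤ r := by have := norm_nonneg x₀; linarith
  set R' : ℝ := 2 * r + T with hR'
  have hR'1 : 1 ≤ R' := by linarith
  obtain ⟨Λ, hΛ0, hΛ⟩ : ∃ Λ : ℝ, 0 ≤ Λ ∧ ∀ x : E2, ‖x‖ ≤ 2 * R' → tt ψ x ≤ Λ := by
    obtain ⟨L, hL⟩ := (isCompact_closedBall (0 : E2) (2 * R')).exists_bound_of_continuousOn (tt_cont hψ).continuousOn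
    refine ⟨max L 0, le_max_right _ _, fun x hx => ?_⟩
    have := hL x (by simpa using hx)
    rw [Real.norm_eq_abs] at this
    exact (le_abs_self _).trans (this.trans (le_max_left _ _))
  set m : ℝ := (1 + Λ) ^ (-μ) with hm
  have hm0 : 0 < m := by positivity
  set N : ℝ := ∫ x, eta R' x with hN
  have hN0 : 0 ≤ N := integral_nonneg (fun x => eta_nonneg _ x)
  have hRi : Integrable (eta R') := (eta_cont _).integrable_of_hasCompactSupport (eta_compact (by linarith))
  have hAc : Continuous (fun x => eta r x * |f (x + T • ee k) - f x|) := by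
    have := eta_cont r
    fun_prop
  have key : ∫ x, eta r x * |f (x + T • ee k) - f x| ≤ 0 := by
    apply le_of_forall_pos_le_add
    intro ε hε
    rw [zero_add]
    set θ : ℝ := ε / (2 * T * (N + 1)) with hθ
    have hθ0 : 0 < θ := by positivity
    set δ : ℝ := ε * θ * m / (2 * T) with hδ
    have hδ0 : 0 < δ := by positivity
    obtain ⟨R, hR0, hR1, hev⟩ := hX δ hδ0 (2 * R')
    have hten : Tendsto (fun n : ℕ => T / (n : ℝ)) atTop (nhdsWithin 0 (Set.Ioi 0)) := by
      rw [tendsto_nhdsWithin_iff]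
      refine ⟨tendsto_const_div_atTop_nhds_zero_nat T, ?_⟩
      filter_upwards [eventually_gt_atTop 0] with n hn
      have : (0:ℝ) < n := by exact_mod_cast hn
      exact div_pos hT this
    obtain ⟨n, hn, hn0⟩ := ((hten.eventually hev).and (eventually_gt_atTop 0)).exists
    have hn1 : (0:ℝ) < n := by exact_mod_cast hn0
    set s := T / (n : ℝ) with hs
    have hs0 : 0 < s := div_pos hT hn1
    have hns : n * s = T := by rw [hs]; field_simp
    have t := tele hf hr1 hT.le le_rfl k hs0 n hns.le
    rw [hns] at t
    have hX' := hn k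
    have i2 : ∫ x, eta R' x * |Dq k s f x| ≤ θ * (∫ x, eta R' x) + 1 / (θ * m) * XX μ p R ψ k s := by
      unfold XX
      apply int_le2 _ hRi (X_int μ p hR1 hψ k s)
      · intro x
        have hD0 : 0 ≤ DP2 k s ψ x := by unfold DP2; positivity
        have ht := tt_nonneg ψ x
        have he := eta_nonneg R x
        by_cases hx : 2 * R' ≤ ‖x‖
        · rw [eta_zero (by linarith) hx, zero_mul, mul_zero, zero_add]
          positivity
        · have hx' : ‖x‖ ≤ 2 * R' := (not_le.1 hx).le
          rw [eta_one (R := R) (by linarith) (by linarith), one_pow, one_mul]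
          have hmt : m ≤ (1 + tt ψ x) ^ (-μ) := by
            rw [hm]
            exact Real.rpow_le_rpow_of_nonpos (by linarith) (by linarith [hΛ x hx']) (by linarith)
          have h1 : |Dq k s f x| ≤ θ + Dq k s f x ^ 2 / θ := by
            rw [← sq_abs]
            have : θ + |Dq k s f x| ^ 2 / θ - |Dq k s f x| =
              ((|Dq k s f x| - θ) ^ 2 + θ * |Dq k s f x|) / θ := by field_simp; ring
            have h0 : 0 ≤ ((|Dq k s f x| - θ) ^ 2 + θ * |Dq k s f x|) / θ := by positivity
            linarith
          have h2 : 1 / (θ * m) * (m * DP2 k s ψ x) ≤ 1 / (θ * m) * ((1 + tt ψ x) ^ (-μ) * DP2 k s ψ x) := by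
            gcongr
          have h3 : 1 / (θ * m) * (m * DP2 k s ψ x) = DP2 k s ψ x / θ := by field_simp
          have h4 : Dq k s f x ^ 2 / θ ≤ DP2 k s ψ x / θ := by gcongr; exact hfD k s x
          have h5 : eta R' x * (Dq k s f x ^ 2 / θ) ≤ Dq k s f x ^ 2 / θ :=
            mul_le_of_le_one_left (by positivity) (eta_le_one _ _)
          have h6 := mul_le_mul_of_nonneg_left h1 (eta_nonneg R' x)
          linarith
      · apply int_of_zero (R := 2 * R')
        · have := eta_cont R'
          have h2 : Continuous (Dq k s f) := Dq_cont hf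
          fun_prop
        · intro x hx; rw [eta_zero (by linarith) hx, zero_mul]
    calc _ ≤ T * ∫ x, eta R' x * |Dq k s f x| := t
      _ ≤ T * (θ * N + 1 / (θ * m) * δ) := by
        apply mul_le_mul_of_nonneg_left _ hT.le
        refine i2.trans ?_
        gcongr
      _ ≤ T * (θ * (N + 1) + 1 / (θ * m) * δ) := by gcongr; linarith
      _ = ε := by rw [hδ, hθ]; field_simp; ring
  by_contra hne
  have hcs : HasCompactSupport (fun x => eta r x * |f (x + T • ee k) - f x|) :=
    (eta_compact (by linarith)).mul_right
  have := hAc.integral_pos_of_hasCompactSupport_nonneg_nonzero (μ := volume) hcs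
    (fun x => mul_nonneg (eta_nonneg _ _) (abs_nonneg _)) (x := x₀) (by
      rw [eta_one (by linarith) (by linarith), one_mul]
      exact abs_ne_zero.2 (sub_ne_zero.2 hne))
  linarith

theorem ee_sum (x : E2) : x = (x 0) • ee 0 + (x 1) • ee 1 := by
  ext i
  fin_cases i <;> simp [ee]

theorem const_all {f : E2 → ℝ} (h : ∀ (k : Fin 2) (T : ℝ), 0 < T → ∀ x, f (x + T • ee k) = f x) (x : E2) :
    f x = f 0 := by
  have h' : ∀ (k : Fin 2) (T : ℝ) (x : E2), f (x + T • ee k) = f x := by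
    intro k T x
    rcases lt_trichotomy T 0 with hT | hT | hT
    · have := h k (-T) (by linarith) (x + T • ee k)
      rw [← this]; congr 1; rw [add_assoc, ← add_smul]; simp
    · simp [hT]
    · exact h k T hT x
  rw [ee_sum x, h' 1]
  have := h' 0 (x 0) 0
  rwa [zero_add] at this

theorem comp_c1 {n : WithTop ℕ∞} {u : E2 → E2} (hu : ContDiff ℝ n u) (i : Fin 2) : ContDiff ℝ n (fun y => u y i) :=
  contDiff_euclidean.1 hu i

theorem pd_eq {u : E2 → E2} (hu : ContDiff ℝ 1 u) (k i : Fin 2) (x : E2) :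
    pd u k x i = dd k (fun y => u y i) x := by
  have h1 : HasFDerivAt u (fderiv ℝ u x) x := (hu.differentiable (by norm_num) x).hasFDerivAt
  have h2 := ((EuclideanSpace.proj i : E2 →L[ℝ] ℝ).hasFDerivAt (x := u x)).comp x h1
  have h3 : fderiv ℝ (fun y => u y i) x = (EuclideanSpace.proj i : E2 →L[ℝ] ℝ).comp (fderiv ℝ u x) := h2.fderiv
  unfold dd pd
  rw [h3]
  rfl

theorem clm_ext2 {L : E2 →L[ℝ] ℝ} (v : E2) : L v = v 0 * L (ee 0) + v 1 * L (ee 1) := by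
  conv_lhs => rw [ee_sum v]
  simp

theorem stream {u : E2 → E2} (hu : ContDiff ℝ 1 u) (hdiv : ∀ x, divg u x = 0) :
    ∃ ψ : E2 → ℝ, ContDiff ℝ 2 ψ ∧ ψ 0 = 0 ∧ (∀ x, dd 1 ψ x = u x 0) ∧ (∀ x, dd 0 ψ x = -u x 1) := by
  set ω : E2 → (E2 →L[ℝ] ℝ) := fun x =>
    (u x 0) • (EuclideanSpace.proj 1 : E2 →L[ℝ] ℝ) - (u x 1) • (EuclideanSpace.proj 0 : E2 →L[ℝ] ℝ) with hω
  have hu0 := comp_c1 hu 0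
  have hu1 := comp_c1 hu 1
  have hωc : ContDiff ℝ 1 ω := (hu0.smul contDiff_const).sub (hu1.smul contDiff_const)
  have hωd : ∀ a v, fderiv ℝ ω a v = (fderiv ℝ (fun y => u y 0) a v) • (EuclideanSpace.proj 1 : E2 →L[ℝ] ℝ) -
      (fderiv ℝ (fun y => u y 1) a v) • (EuclideanSpace.proj 0 : E2 →L[ℝ] ℝ) := by
    intro a v
    have d0 := (hu0.differentiable (by norm_num) a).hasFDerivAt
    have d1 := (hu1.differentiable (by norm_num) a).hasFDerivAt
    have := (d0.smul_const (EuclideanSpace.proj 1 : E2 →L[ℝ] ℝ)).sub (d1.smul_const (EuclideanSpace.proj 0 : E2 →L[ℝ] ℝ))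
    have e : fderiv ℝ ω a = _ := this.fderiv
    rw [e]; rfl
  obtain ⟨f, hf⟩ := (convex_univ (𝕜 := ℝ) (E := E2)).exists_forall_hasFDerivAt_of_fderiv_symmetric isOpen_univ
    (ω := ω) (hωc.differentiable (by norm_num)).differentiableOn (by
      intro a _ v w
      have hd := hdiv a
      unfold divg at hd
      rw [Fin.sum_univ_two, pd_eq hu, pd_eq hu] at hd
      unfold dd at hd
      rw [hωd, hωd]
      simp only [ContinuousLinearMap.sub_apply, ContinuousLinearMap.smul_apply, smul_eq_mul]
      have pr : ∀ (i : Fin 2) (z : E2), (EuclideanSpace.proj i : E2 →L[ℝ] ℝ) z = z i := fun _ _ => rfl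
      rw [pr, pr, pr, pr]
      rw [clm_ext2 (L := fderiv ℝ (fun y => u y 0) a) v, clm_ext2 (L := fderiv ℝ (fun y => u y 1) a) v,
        clm_ext2 (L := fderiv ℝ (fun y => u y 0) a) w, clm_ext2 (L := fderiv ℝ (fun y => u y 1) a) w]
      linear_combination (v 0 * w 1 - v 1 * w 0) * hd)
  have hf' : ∀ a, HasFDerivAt (fun x => f x - f 0) (ω a) a := fun a => (hf a trivial).sub_const _
  refine ⟨fun x => f x - f 0, ?_, by simp, ?_, ?_⟩
  · rw [show (2 : WithTop ℕ∞) = 1 + 1 by norm_num, contDiff_succ_iff_fderiv]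
    have : fderiv ℝ (fun x => f x - f 0) = ω := funext fun a => (hf' a).fderiv
    exact ⟨fun a => (hf' a).differentiableAt, by simp, by rw [this]; exact hωc⟩
  · intro x
    unfold dd
    rw [(hf' x).fderiv]
    simp [hω, ee]
  · intro x
    unfold dd
    rw [(hf' x).fderiv]
    simp [hω, ee]

/-- `v` is the rotated gradient of `ζ`. -/
structure IsCurl (v : E2 → E2) (ζ : E2 → ℝ) : Prop where
  v1 : ContDiff ℝ 1 v
  c2 : ContDiff ℝ 2 ζ
  e0 : ∀ x, dd 1 ζ x = v x 0
  e1 : ∀ x, dd 0 ζ x = -v x 1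

theorem IsCurl.f0 {v ζ} (h : IsCurl v ζ) : (fun y => v y 0) = dd 1 ζ := funext fun x => (h.e0 x).symm

theorem IsCurl.f1 {v ζ} (h : IsCurl v ζ) (k : Fin 2) (x : E2) : dd k (fun y => v y 1) x = - dd k (dd 0 ζ) x := by
  have : (fun y => v y 1) = fun y => -(dd 0 ζ y) := funext fun x => by rw [h.e1, neg_neg]
  rw [this]
  unfold dd
  rw [fderiv_fun_neg]
  rfl

theorem IsCurl.sym {v ζ} (h : IsCurl v ζ) (x : E2) :
    symGrad v x 0 0 = LA ζ x ∧ symGrad v x 0 1 = LB ζ x ∧ symGrad v x 1 0 = LB ζ x ∧ symGrad v x 1 1 = -LA ζ x := by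
  have hs := dd_symm h.c2 0 1 x
  unfold symGrad LA LB
  simp only [pd_eq h.v1, h.f0, h.f1]
  refine ⟨by ring, by ring, by ring, by rw [hs]; ring⟩

theorem frob2 (A B : Matrix (Fin 2) (Fin 2) ℝ) :
    frob A B = A 0 0 * B 0 0 + A 0 1 * B 0 1 + (A 1 0 * B 1 0 + A 1 1 * B 1 1) := by
  unfold frob; simp [Fin.sum_univ_two]

theorem frob_DH (h : ℝ → ℝ) {v w ψ ζ} (hv : IsCurl v ψ) (hw : IsCurl w ζ) (x : E2) :
    frob (DH h (symGrad v x)) (symGrad w x) =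
      2 * (slopeH h (√2 * tt ψ x) * LA ψ x * LA ζ x + slopeH h (√2 * tt ψ x) * LB ψ x * LB ζ x) := by
  obtain ⟨a1, a2, a3, a4⟩ := hv.sym x
  obtain ⟨b1, b2, b3, b4⟩ := hw.sym x
  have hn : fnorm (symGrad v x) = √2 * tt ψ x := by
    unfold fnorm tt nrm
    rw [frob2, a1, a2, a3, a4, ← Real.sqrt_mul (by norm_num)]
    congr 1; ring
  rw [frob2, b1, b2, b3, b4]
  unfold DH slopeH
  rw [hn]
  by_cases h0 : √2 * tt ψ x = 0
  · have ht : tt ψ x = 0 := by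
      rcases mul_eq_zero.1 h0 with h | h
      · exact absurd h (by positivity)
      · exact h
    have h2 : LA ψ x ^ 2 + LB ψ x ^ 2 = 0 := by
      rw [← nrm_sq]; change tt ψ x ^ 2 = 0; rw [ht]; norm_num
    have hA : LA ψ x = 0 := by nlinarith [sq_nonneg (LA ψ x), sq_nonneg (LB ψ x)]
    have hB : LB ψ x = 0 := by nlinarith [sq_nonneg (LA ψ x), sq_nonneg (LB ψ x)]
    simp [h0, hA, hB]
  · simp only [h0, if_false, Matrix.smul_apply, smul_eq_mul, a1, a2, a3, a4]
    ring

theorem curl_of {ζ : E2 → ℝ} (hζ : ContDiff ℝ (⊤ : ℕ∞) ζ) (hc : HasCompactSupport ζ) :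
    ∃ w : E2 → E2, ContDiff ℝ (⊤ : ℕ∞) w ∧ HasCompactSupport w ∧ (∀ x, divg w x = 0) ∧ IsCurl w ζ := by
  have hζ2 : ContDiff ℝ 2 ζ := hζ.of_le (WithTop.coe_le_coe.2 (le_top : (2:ℕ∞) ≤ ⊤))
  set w : E2 → E2 := fun x => !₂[dd 1 ζ x, -dd 0 ζ x] with hw
  have hd : ∀ k, ContDiff ℝ (⊤ : ℕ∞) (dd k ζ) := fun k => dd_contDiff (by simpa using hζ)
  have hwc : ContDiff ℝ (⊤ : ℕ∞) w := by
    rw [contDiff_euclidean]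
    intro i
    fin_cases i
    · exact hd 1
    · exact (hd 0).neg
  have hIs : IsCurl w ζ := ⟨hwc.of_le (by exact_mod_cast le_top), hζ2, fun x => by simp [hw], fun x => by simp [hw]⟩
  refine ⟨w, hwc, ?_, ?_, hIs⟩
  · have h0 : HasCompactSupport (dd 0 ζ) := dd_compactSupport hc
    have h1 : HasCompactSupport (dd 1 ζ) := dd_compactSupport hc
    apply HasCompactSupport.intro (IsCompact.union h0 h1)
    intro x hx
    rw [Set.mem_union, not_or] at hx
    have a0 := image_eq_zero_of_notMem_tsupport hx.1
    have a1 := image_eq_zero_of_notMem_tsupport hx.2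
    ext i
    fin_cases i <;> simp [hw, a0, a1]
  · intro x
    unfold divg
    rw [Fin.sum_univ_two, pd_eq hIs.v1, pd_eq hIs.v1, hIs.f0, hIs.f1, dd_symm hζ2 0 1 x]
    ring

theorem sol_of {h : ℝ → ℝ} {c C μ : ℝ} (hg : Adm (fun t => slopeH h (√2 * t)) c C μ)
    {u : E2 → E2} {ψ : E2 → ℝ} (hu : IsCurl u ψ) (hweak : IsStokesWeakSolution h u) :
    Sol (fun t => slopeH h (√2 * t)) ψ := by
  refine ⟨hu.c2, ?_⟩
  have hgc : Continuous (fun x => (fun t => slopeH h (√2 * t)) (tt ψ x)) :=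
    hg.cont.comp (tt_cont hu.c2)
  apply weak_ext (hgc.mul (LA_cont hu.c2)) (hgc.mul (LB_cont hu.c2))
  intro ζ hζ hc
  obtain ⟨w, hw1, hw2, hw3, hw4⟩ := curl_of hζ hc
  have := hweak w hw1 hw2 hw3
  simp only [frob_DH h hu hw4] at this
  rw [integral_const_mul] at this
  exact (mul_eq_zero.1 this).resolve_left two_ne_zero

theorem growth_of {u : E2 → E2} {α : ℝ} (hα₀ : 0 ≤ α)
    (hgrow : ∃ C : ℝ, ∀ x, x ≠ 0 → ‖x‖ ^ (-α) * ‖u x‖ ≤ C) :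
    ∃ C : ℝ, 1 ≤ C ∧ ∀ x, ‖u x‖ ≤ C * (1 + ‖x‖) ^ α := by
  obtain ⟨C, hC⟩ := hgrow
  refine ⟨|C| + ‖u 0‖ + 1, by have := abs_nonneg C; have := norm_nonneg (u 0); linarith, fun x => ?_⟩
  have h1 : 1 ≤ (1 + ‖x‖) ^ α := Real.one_le_rpow (by have := norm_nonneg x; linarith) hα₀
  by_cases hx : x = 0
  · subst hx
    have := abs_nonneg C
    have := norm_nonneg (u 0)
    nlinarith
  · have hn : 0 < ‖x‖ := norm_pos_iff.2 hx
    have h2 := hC x hx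
    rw [Real.rpow_neg hn.le, inv_mul_le_iff₀ (by positivity)] at h2
    have h3 : ‖x‖ ^ α ≤ (1 + ‖x‖) ^ α := Real.rpow_le_rpow hn.le (by linarith) hα₀
    have h4 : 0 ≤ ‖x‖ ^ α := by positivity
    calc ‖u x‖ ≤ ‖x‖ ^ α * C := h2
      _ ≤ ‖x‖ ^ α * (|C| + ‖u 0‖ + 1) := by
        gcongr
        have := le_abs_self C
        have := norm_nonneg (u 0)
        linarith
      _ ≤ (1 + ‖x‖) ^ α * (|C| + ‖u 0‖ + 1) := by gcongr
      _ = _ := mul_comm _ _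

theorem bd_of {u : E2 → E2} {ψ : E2 → ℝ} (h : IsCurl u ψ) (h0 : ψ 0 = 0) {α C : ℝ} (hα₀ : 0 ≤ α) (hα : α < 1)
    (hC : 1 ≤ C) (hg : ∀ x, ‖u x‖ ≤ C * (1 + ‖x‖) ^ α) {R : ℝ} (hR : 1 ≤ R) :
    Bd ψ (24 * C) R (R ^ α) := by
  have hRp : 0 < R ^ α := by positivity
  have hu : ∀ x : E2, ‖x‖ ≤ 3 * R → ‖u x‖ ≤ 4 * C * R ^ α := by
    intro x hx
    have h4 : (4:ℝ) ^ α ≤ 4 := by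
      calc (4:ℝ) ^ α ≤ 4 ^ (1:ℝ) := Real.rpow_le_rpow_of_exponent_le (by norm_num) hα.le
        _ = 4 := Real.rpow_one 4
    calc ‖u x‖ ≤ C * (1 + ‖x‖) ^ α := hg x
      _ ≤ C * (4 * R) ^ α := by
        gcongr
        linarith
      _ = C * (4 ^ α * R ^ α) := by rw [Real.mul_rpow (by norm_num) (by linarith)]
      _ ≤ C * (4 * R ^ α) := by gcongr
      _ = _ := by ring
  have hd : ∀ k x, ‖x‖ ≤ 3 * R → |dd k ψ x| ≤ 4 * C * R ^ α := by
    intro k x hx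
    have hc : ∀ i, |u x i| ≤ ‖u x‖ := fun i => by
      have := EuclideanSpace.norm_eq (u x)
      rw [this]
      apply Real.abs_le_sqrt
      simp only [Fin.sum_univ_two, Real.norm_eq_abs, sq_abs]
      fin_cases i <;> simp <;> positivity
    fin_cases k
    · change |dd 0 ψ x| ≤ _
      rw [h.e1, abs_neg]; exact (hc 1).trans (hu x hx)
    · change |dd 1 ψ x| ≤ _
      rw [h.e0]; exact (hc 0).trans (hu x hx)
  refine ⟨fun k x hx => (hd k x hx).trans (by gcongr; norm_num), fun x hx => ?_⟩
  have hdif : ∀ y ∈ Metric.closedBall (0:E2) (3 * R), DifferentiableAt ℝ ψ y := fun y _ =>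
    h.c2.differentiable (by norm_num) y
  have hb : ∀ y ∈ Metric.closedBall (0:E2) (3 * R), ‖fderiv ℝ ψ y‖ ≤ 8 * C * R ^ α := by
    intro y hy
    have hy' : ‖y‖ ≤ 3 * R := by simpa using hy
    apply ContinuousLinearMap.opNorm_le_bound _ (by positivity)
    intro v
    rw [clm_ext2, Real.norm_eq_abs]
    have d0 := hd 0 y hy'
    have d1 := hd 1 y hy'
    unfold dd at d0 d1
    have v0 : |v 0| ≤ ‖v‖ := by simpa using PiLp.norm_apply_le v 0
    have v1 : |v 1| ≤ ‖v‖ := by simpa using PiLp.norm_apply_le v 1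
    calc _ ≤ |v 0 * fderiv ℝ ψ y (ee 0)| + |v 1 * fderiv ℝ ψ y (ee 1)| := abs_add_le _ _
      _ ≤ ‖v‖ * (4 * C * R ^ α) + ‖v‖ * (4 * C * R ^ α) := by
        rw [abs_mul, abs_mul]; gcongr
      _ = _ := by ring
  have := (convex_closedBall (0:E2) (3 * R)).norm_image_sub_le_of_norm_fderiv_le hdif hb
    (x := 0) (y := x) (by simp; linarith) (by simpa using hx)
  rw [h0, sub_zero, sub_zero, Real.norm_eq_abs] at this
  calc _ ≤ 8 * C * R ^ α * ‖x‖ := this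
    _ ≤ 8 * C * R ^ α * (3 * R) := by gcongr
    _ = _ := by ring

theorem lin_growth {f : E2 → ℝ} (hf : ContDiff ℝ 1 f) (k : Fin 2) {c : ℝ} (hc : ∀ x, dd k f x = c)
    {α C : ℝ} (hα₀ : 0 ≤ α) (hα : α < 1) (hC : 1 ≤ C) (hg : ∀ x, |f x| ≤ C * (1 + ‖x‖) ^ α) :
    c = 0 ∧ ∀ x (T : ℝ), f (x + T • ee k) = f x := by
  have hT : ∀ x (T : ℝ), f (x + T • ee k) = f x + c * T := by
    intro x T
    have hd : ∀ t : ℝ, HasDerivAt (fun t : ℝ => f (x + t • ee k) - c * t) 0 t := by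
      intro t
      have h1 : HasDerivAt (fun t : ℝ => x + t • ee k) (ee k) t := by
        have := ((hasDerivAt_id t).smul_const (ee k)).const_add x
        simpa using this
      have h2 := (hf.differentiable (by norm_num) (x + t • ee k)).hasFDerivAt.comp_hasDerivAt t h1
      have h3 : fderiv ℝ f (x + t • ee k) (ee k) = c := hc _
      rw [h3] at h2
      have h4 := h2.sub ((hasDerivAt_id t).const_mul c)
      have e5 : c - c * 1 = 0 := by ring
      rw [e5] at h4
      exact h4
    have := is_const_of_deriv_eq_zero (fun t => (hd t).differentiableAt) (fun t => (hd t).deriv) T 0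
    simp at this
    linarith
  have hc0 : |c| ≤ 0 := by
    have ht : Tendsto (fun T : ℝ => 4 * C * (1 + T) ^ (-(1 - α))) atTop (nhds (4 * C * 0)) := by
      apply Tendsto.const_mul
      exact (tendsto_rpow_neg_atTop (by linarith)).comp (tendsto_atTop_add_const_left _ 1 tendsto_id)
    rw [mul_zero] at ht
    apply ge_of_tendsto ht
    filter_upwards [eventually_ge_atTop 1] with T h1
    have e := hT 0 T
    have b1 := hg (0 + T • ee k)
    have b0 := hg 0
    rw [zero_add] at b1 e
    rw [norm_smul, norm_ee, mul_one, Real.norm_eq_abs, abs_of_pos (by linarith : 0 < T)] at b1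
    rw [norm_zero, add_zero, Real.one_rpow, mul_one] at b0
    have h3 : 1 ≤ (1 + T) ^ α := Real.one_le_rpow (by linarith) hα₀
    have h4 : |c| * T ≤ 2 * C * (1 + T) ^ α := by
      have : |c| * T = |f (T • ee k) - f 0| := by
        rw [e, add_sub_cancel_left, abs_mul, abs_of_pos (by linarith : 0 < T)]
      rw [this]
      calc _ ≤ |f (T • ee k)| + |f 0| := abs_sub _ _
        _ ≤ C * (1 + T) ^ α + C := add_le_add b1 b0
        _ ≤ _ := by nlinarith
    have e5 : (1 + T) ^ (-(1 - α)) * (1 + T) = (1 + T) ^ α := by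
      nth_rewrite 2 [← Real.rpow_one (1 + T)]
      rw [← Real.rpow_add (by linarith)]
      congr 1; ring
    have h6 : |c| * (1 + T) ≤ 4 * C * (1 + T) ^ (-(1 - α)) * (1 + T) := by
      rw [mul_assoc, e5]
      have := abs_nonneg c
      nlinarith
    exact le_of_mul_le_mul_right h6 (by linarith)
  have hc' : c = 0 := abs_eq_zero.1 (le_antisymm hc0 (abs_nonneg _))
  exact ⟨hc', fun x T => by rw [hT, hc', zero_mul, add_zero]⟩

theorem dd_inv {f : E2 → ℝ} {a : E2} (h : ∀ x, f (x + a) = f x) (k : Fin 2) (x : E2) :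
    dd k f (x + a) = dd k f x := by
  unfold dd
  have : f = fun y => f (y + a) := funext fun y => (h y).symm
  conv_rhs => rw [this, fderiv_comp_add_right]

theorem u_const {f g : E2 → ℝ} (hf : ContDiff ℝ 1 f) (hg : ContDiff ℝ 1 g) {a b : ℝ}
    (h1 : ∀ x, dd 0 f x = a) (h2 : ∀ x, dd 1 g x = -a) (h3 : ∀ x, dd 1 f x + dd 0 g x = b)
    {α C : ℝ} (hα₀ : 0 ≤ α) (hα : α < 1) (hC : 1 ≤ C) (bf : ∀ x, |f x| ≤ C * (1 + ‖x‖) ^ α)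
    (bg : ∀ x, |g x| ≤ C * (1 + ‖x‖) ^ α) : ∀ x, f x = f 0 ∧ g x = g 0 := by
  obtain ⟨-, f0⟩ := lin_growth hf 0 h1 hα₀ hα hC bf
  obtain ⟨-, g1⟩ := lin_growth hg 1 h2 hα₀ hα hC bg
  have df : ∀ x, dd 1 f x = dd 1 f 0 := by
    apply const_all
    intro k T _ x
    fin_cases k
    · exact dd_inv (fun y => f0 y T) 1 x
    · have e1 := h3 (x + T • ee 1)
      have e2 := h3 x
      rw [dd_inv (fun y => g1 y T) 0 x] at e1
      change dd 1 f (x + T • ee 1) = dd 1 f x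
      linarith
  have dg : ∀ x, dd 0 g x = dd 0 g 0 := fun x => by
    have e1 := h3 x
    have e2 := h3 0
    rw [df] at e1
    linarith
  obtain ⟨-, f1⟩ := lin_growth hf 1 df hα₀ hα hC bf
  obtain ⟨-, g0⟩ := lin_growth hg 0 dg hα₀ hα hC bg
  intro x
  constructor
  · apply const_all
    intro k T _ y
    fin_cases k
    · exact f0 y T
    · exact f1 y T
  · apply const_all
    intro k T _ y
    fin_cases k
    · exact g0 y T
    · exact g1 y T

theorem ratio_small {α C δ : ℝ} (hα : α < 1) (hδ : 0 < δ) :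
    ∀ᶠ R : ℝ in atTop, C * (R ^ α) ^ 2 / R ^ 2 ≤ δ := by
  have ht : Tendsto (fun R : ℝ => C * (R ^ (-(1 - α))) ^ 2) atTop (nhds (C * 0 ^ 2)) := by
    apply Tendsto.const_mul
    exact (tendsto_rpow_neg_atTop (by linarith)).pow 2
  have : C * (0:ℝ) ^ 2 = 0 := by norm_num
  rw [this] at ht
  filter_upwards [ht.eventually_lt_const hδ, eventually_gt_atTop 0] with R h1 h2
  refine le_trans (le_of_eq ?_) h1.le
  have : R ^ (-(1 - α)) = R ^ α / R := by
    rw [show -(1 - α) = α - 1 by ring, Real.rpow_sub h2, Real.rpow_one]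
  rw [this]
  ring

theorem main_aux
    (h : ℝ → ℝ) (c₁ c₂ μ : ℝ)
    (hc₁ : 0 < c₁) (hc₂ : 0 < c₂) (hμ₁ : 1 < μ) (hμ₂ : μ < 2)
    (hreg : ContDiff ℝ 2 h) (h0' : deriv h 0 = 0)
    (hlow : ∀ t, 0 ≤ t →
      c₁ * (1 + t) ^ (-μ) ≤ min (deriv (deriv h) t) (slopeH h t))
    (hup : ∀ t, 0 ≤ t →
      max (deriv (deriv h) t) (slopeH h t) ≤ c₂ / (1 + t))
    (u : E2 → E2)
    (hu : ContDiff ℝ 1 u)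
    (hdiv : ∀ x, divg u x = 0)
    (hweak : IsStokesWeakSolution h u)
    (α : ℝ) (hα₀ : 0 ≤ α) (hα : α < 1)
    (hgrow : ∃ C : ℝ, ∀ x, x ≠ 0 → ‖x‖ ^ (-α) * ‖u x‖ ≤ C) :
    ∃ c, ∀ x, u x = c := by
  obtain ⟨c, C, hg⟩ := adm_of_h h c₁ c₂ μ hc₁ hc₂ hμ₁ hμ₂ hreg h0' hlow hup
  obtain ⟨ψ, hψ, hψ0, e0, e1⟩ := stream hu hdiv
  have hI : IsCurl u ψ := ⟨hu, hψ, e0, e1⟩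
  have hS := sol_of hg hI hweak
  obtain ⟨G, hG, hGu⟩ := growth_of hα₀ hgrow
  obtain ⟨p, hp⟩ : ∃ p : ℕ, 2 ≤ p * (2 - μ) := by
    obtain ⟨p, hp⟩ := exists_nat_ge (2 / (2 - μ))
    exact ⟨p, by rwa [div_le_iff₀ (by linarith)] at hp⟩
  obtain ⟨C₃, hC₃, hcomb⟩ := combine hg (M := 24 * G) (by linarith) p hμ₁ hμ₂ hp
  have hX : ∀ δ > 0, ∀ R0 : ℝ, ∃ R ≥ R0, 1 ≤ R ∧
      ∀ᶠ s in nhdsWithin (0:ℝ) (Set.Ioi 0), ∀ k, XX μ p R ψ k s ≤ δ := by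
    intro δ hδ R0
    obtain ⟨R, h1, h2, h3, h4⟩ := ((eventually_ge_atTop R0).and ((eventually_ge_atTop 1).and
      ((ratio_small (C := C₃) hα hδ).and (ratio_small (C := C₃) hα one_pos)))).exists
    refine ⟨R, h1, h2, ?_⟩
    have hU : 1 ≤ R ^ α := Real.one_le_rpow h2 hα₀
    rw [div_le_one (by positivity)] at h4
    filter_upwards [hcomb R (R ^ α) h2 hU h4 ψ hS (bd_of hI hψ0 hα₀ hα hG hGu h2)] with s hs k
    exact (hs k).trans h3
  have hA : ∀ x, LA ψ x = LA ψ 0 := const_all fun k T hT x =>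
    const_shift hψ (LA_cont hψ) (by linarith) (fun k s x => by unfold DP2; nlinarith [sq_nonneg (Dq k s (LB ψ) x)])
      hX k hT x
  have hB : ∀ x, LB ψ x = LB ψ 0 := const_all fun k T hT x =>
    const_shift hψ (LB_cont hψ) (by linarith) (fun k s x => by unfold DP2; nlinarith [sq_nonneg (Dq k s (LA ψ) x)])
      hX k hT x
  have hcmp : ∀ (i : Fin 2) x, |u x i| ≤ G * (1 + ‖x‖) ^ α := fun i x => by
    have : |u x i| ≤ ‖u x‖ := by simpa using PiLp.norm_apply_le (u x) i
    exact this.trans (hGu x)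
  have hfin := u_const (comp_c1 hu 0) (comp_c1 hu 1) (a := LA ψ 0) (b := 2 * LB ψ 0)
    (fun x => by rw [hI.f0]; exact hA x)
    (fun x => by rw [hI.f1, ← dd_symm hψ 0 1 x, ← hA x]; rfl)
    (fun x => by rw [hI.f0, hI.f1, ← hB x]; unfold LB; ring)
    hα₀ hα hG (hcmp 0) (hcmp 1)
  refine ⟨u 0, fun x => ?_⟩
  ext i
  fin_cases i
  · exact (hfin x).1
  · exact (hfin x).2

/-- Remark 5 of the paper: Liouville theorem for the 2D Stokes-type
system with μ-elliptic potential, 1 < μ < 2, under the growth condition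
|x|^{-α}|u(x)| bounded for some α ∈ [0, 1) (optimal range). -/
theorem liouville_stokes_2d
    (h : ℝ → ℝ) (c₁ c₂ μ : ℝ)
    (hc₁ : 0 < c₁) (hc₂ : 0 < c₂) (hμ₁ : 1 < μ) (hμ₂ : μ < 2)
    (hreg : ContDiff ℝ 2 h)
    (hnonneg : ∀ t, 0 ≤ t → 0 ≤ h t)
    (h0 : h 0 = 0) (h0' : deriv h 0 = 0)
    (hlow : ∀ t, 0 ≤ t →
      c₁ * (1 + t) ^ (-μ) ≤ min (deriv (deriv h) t) (slopeH h t))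
    (hup : ∀ t, 0 ≤ t →
      max (deriv (deriv h) t) (slopeH h t) ≤ c₂ / (1 + t))
    (u : EuclideanSpace ℝ (Fin 2) → EuclideanSpace ℝ (Fin 2))
    (hu : ContDiff ℝ 1 u)
    (hdiv : ∀ x, divg u x = 0)
    (hweak : IsStokesWeakSolution h u)
    (α : ℝ) (hα₀ : 0 ≤ α) (hα : α < 1)
    (hgrow : ∃ C : ℝ, ∀ x, x ≠ 0 → ‖x‖ ^ (-α) * ‖u x‖ ≤ C) :
    ∃ c, ∀ x, u x = c := by
  exact main_aux h c₁ c₂ μ hc₁ hc₂ hμ₁ hμ₂ hreg h0' hlow hup u hu hdiv hweak α hα₀ hα hgrow
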